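/- arXiv:1308.6596 — 2 statements merged into one kernel-verified Lean document; each statement's English description precedes it below -/
import Mathlib

section
/- Assume δ(x_d) = 0 and δ maps span(x_1,…,x_{d−1}) into itself, acting there as a nilpotent linear operator. Then the Hilbert series satisfy H((F_d')^δ, z) = (1−z)^{−2} · ( H((F_{d−1}')^δ, z) + z·H(K[U_{d−1},V_{d−1}]_ω^δ, z) ) in ℤ[[z]]. -/
noncomputable section

/-- The metabelian relation on the free associative algebra:
products of two commutators are identified with zero. -/
def MetabRel (K : Type*) [CommRing K] (d : ℕ) (p q : FreeAlgebra K (Fin d)) : Prop :=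
  q = 0 ∧ ∃ a b c e : FreeAlgebra K (Fin d), p = (a * b - b * a) * (c * e - e * c)

/-- The free metabelian associative algebra `F_d = A_d/(A_d')²`. -/
abbrev FreeMetab (K : Type*) [CommRing K] (d : ℕ) := RingQuot (MetabRel K d)

/-- The free generators `x_i` of `F_d`. -/
def xg (K : Type*) [CommRing K] (d : ℕ) (i : Fin d) : FreeMetab K d :=
  RingQuot.mkAlgHom K (MetabRel K d) (FreeAlgebra.ι K i)

/-- The commutator ideal `F_d'`: the two-sided ideal generated by all commutators. -/
def commIdeal (K : Type*) [CommRing K] (d : ℕ) : Ideal (FreeMetab K d) :=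
  Ideal.span {z | ∃ a f g b : FreeMetab K d, z = a * (f * g - g * f) * b}

/-- `K[U_d,V_d]`. -/
abbrev PolyUV (K : Type*) [CommRing K] (d : ℕ) := MvPolynomial (Fin d ⊕ Fin d) K

def uP (K : Type*) [CommRing K] (d : ℕ) (i : Fin d) : PolyUV K d := MvPolynomial.X (Sum.inl i)
def vP (K : Type*) [CommRing K] (d : ℕ) (i : Fin d) : PolyUV K d := MvPolynomial.X (Sum.inr i)

/-- Action of a monomial of `K[U_d,V_d]` on `F_d`, implementing
`f·u_i = x_i f` and `f·v_i = [f,x_i]` (on the commutator ideal all the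
individual operators commute, so the fixed order of composition is immaterial). -/
def monAct (K : Type*) [CommRing K] (d : ℕ) (m : (Fin d ⊕ Fin d) →₀ ℕ) :
    Module.End K (FreeMetab K d) :=
  (List.ofFn fun i : Fin d =>
      (LinearMap.mulLeft K (xg K d i) : Module.End K (FreeMetab K d)) ^ m (Sum.inl i)).prod *
  (List.ofFn fun i : Fin d =>
      (LinearMap.mulRight K (xg K d i) - LinearMap.mulLeft K (xg K d i) :
        Module.End K (FreeMetab K d)) ^ m (Sum.inr i)).prod

/-- The action of `K[U_d,V_d]` on the commutator ideal of `F_d`. -/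
def act (K : Type*) [CommRing K] (d : ℕ) (p : PolyUV K d) (w : FreeMetab K d) : FreeMetab K d :=
  ∑ m ∈ p.support, p.coeff m • (monAct K d m w)

/-- The homogeneous component of total degree `n` of `F_d`:
the image in `F_d` of the span of the words of length `n`. -/
def degComp (K : Type*) [CommRing K] (d n : ℕ) : Submodule K (FreeMetab K d) :=
  Submodule.map (RingQuot.mkAlgHom K (MetabRel K d)).toLinearMap
    (Submodule.span K {w : FreeAlgebra K (Fin d) | ∃ l : List (Fin d),
      l.length = n ∧ w = (l.map (FreeAlgebra.ι K)).prod})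

/-- The ideal `K[U_d,V_d]_ω` of `K[U_d,V_d]`: the span of the monomials of
positive total degree in the variables `v_1,…,v_d`. -/
def omegaUV (K : Type*) [CommRing K] (d : ℕ) : Submodule K (PolyUV K d) :=
  Submodule.span K {w : PolyUV K d | ∃ m : (Fin d ⊕ Fin d) →₀ ℕ,
    (∃ i, m (Sum.inr i) ≠ 0) ∧ w = MvPolynomial.monomial m (1 : K)}

namespace HSR

/-- A metabelian algebra with generators `x` and Fox-type maps to `K[U,V]`. -/
structure MD (K : Type*) [Field K] (d : ℕ) (R : Type*) [Ring R] [Algebra K R] where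
  x : Fin d → R
  comm : ∀ a b c e : R, (a * b - b * a) * (c * e - e * c) = 0
  gen : Algebra.adjoin K (Set.range x) = ⊤
  lam : R →ₐ[K] PolyUV K d
  rho : R →ₐ[K] PolyUV K d
  D : R →ₗ[K] (Fin d → PolyUV K d)
  lam_x : ∀ i, lam (x i) = uP K d i
  rho_x : ∀ i, rho (x i) = uP K d i + vP K d i
  D_x : ∀ i, D (x i) = Pi.single i 1
  D_mul : ∀ a b, D (a * b) = lam a • D b + rho b • D a

namespace MD

section FSide

variable {K : Type*} [Field K] {d : ℕ} {R : Type*} [Ring R] [Algebra K R]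

/-- the commutator ideal -/
def gI (R : Type*) [Ring R] : Ideal R :=
  Ideal.span {z | ∃ a f g b : R, z = a * (f * g - g * f) * b}

theorem ind (S : MD K d R) {motive : R → Prop}
    (h0 : ∀ r : K, motive (algebraMap K _ r)) (h1 : ∀ i, motive (S.x i))
    (hmul : ∀ a b, motive a → motive b → motive (a * b))
    (hadd : ∀ a b, motive a → motive b → motive (a + b))
    (a : R) : motive a := by
  have ha : a ∈ Algebra.adjoin K (Set.range S.x) := by rw [S.gen]; trivial
  induction ha using Algebra.adjoin_induction with
  | mem x h => obtain ⟨i, rfl⟩ := h; exact h1 i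
  | algebraMap r => exact h0 r
  | add a b _ _ ha hb => exact hadd _ _ ha hb
  | mul a b _ _ ha hb => exact hmul _ _ ha hb

theorem comm_mul_mul_comm (S : MD K d R) (a b r c e : R) :
    (a * b - b * a) * r * (c * e - e * c) = 0 := by
  have h1 := S.comm a (b * r) c e
  have h2 := S.comm a r c e
  have : (a * b - b * a) * r * (c * e - e * c)
    = (a * (b * r) - (b * r) * a) * (c * e - e * c)
      - b * ((a * r - r * a) * (c * e - e * c)) := by noncomm_ring
  rw [this, h1, h2]; simp

theorem comm_mem (a b : R) : a * b - b * a ∈ gI R :=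
  Ideal.subset_span ⟨1, a, b, 1, by simp⟩

theorem mul_right_mem {w : R} (hw : w ∈ gI R) (y : R) :
    w * y ∈ gI R := by
  induction hw using Submodule.span_induction with
  | mem x h =>
    obtain ⟨a, f, g, b, rfl⟩ := h
    exact Ideal.subset_span ⟨a, f, g, b * y, by noncomm_ring⟩
  | zero => simp
  | add x z _ _ hx hz => rw [add_mul]; exact Ideal.add_mem _ hx hz
  | smul a x _ hx => rw [smul_eq_mul, mul_assoc]; exact Ideal.mul_mem_left _ _ hx

theorem comm_mul_mem (S : MD K d R) (f g : R) {w : R} (hw : w ∈ gI R) :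
    ∀ r, (f * g - g * f) * r * w = 0 := by
  induction hw using Submodule.span_induction with
  | mem x h =>
    intro r
    obtain ⟨a, f', g', b, rfl⟩ := h
    have := S.comm_mul_mul_comm f g (r * a) f' g'
    calc _ = ((f * g - g * f) * (r * a) * (f' * g' - g' * f')) * b := by
          simp only [mul_assoc]
      _ = 0 := by rw [this, zero_mul]
  | zero => simp
  | add x z _ _ hx hz => intro r; rw [mul_add, hx, hz, add_zero]
  | smul a x _ hx => intro r; rw [smul_eq_mul, ← mul_assoc, mul_assoc _ r a]; exact hx _

theorem mem_mul_comm (S : MD K d R) (f g : R) {w : R} (hw : w ∈ gI R) :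
    w * (f * g - g * f) = 0 := by
  induction hw using Submodule.span_induction with
  | mem x h =>
    obtain ⟨a, f', g', b, rfl⟩ := h
    have := S.comm_mul_mul_comm f' g' b f g
    calc _ = a * ((f' * g' - g' * f') * b * (f * g - g * f)) := by
          simp only [mul_assoc]
      _ = 0 := by rw [this, mul_zero]
  | zero => simp
  | add x z _ _ hx hz => rw [add_mul, hx, hz, add_zero]
  | smul a x _ hx => rw [smul_eq_mul, mul_assoc, hx, mul_zero]

/-- the commutator ideal as a vector space -/
abbrev CI (K : Type*) [Field K] (R : Type*) [Ring R] [Algebra K R] : Submodule K R :=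
  (gI R).restrictScalars K

/-- left multiplication on `F'` -/
def Lop (K : Type*) [Field K] {R : Type*} [Ring R] [Algebra K R] (a : R) : Module.End K (CI K R) :=
  (LinearMap.mulLeft K a).restrict (p := CI K R) (q := CI K R)
    (fun _ hx => Ideal.mul_mem_left (gI R) a hx)

/-- right multiplication on `F'` -/
def Rop (K : Type*) [Field K] {R : Type*} [Ring R] [Algebra K R] (a : R) : Module.End K (CI K R) :=
  (LinearMap.mulRight K a).restrict (p := CI K R) (q := CI K R)
    (fun _ hx => mul_right_mem hx a)

@[simp] theorem Lop_coe (a : R) (w : CI K R) :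
    ((Lop K a w : CI K R) : R) = a * w := rfl
@[simp] theorem Rop_coe (a : R) (w : CI K R) :
    ((Rop K a w : CI K R) : R) = w * a := rfl

/-- the operators -/
def opUV (S : MD K d R) : Fin d ⊕ Fin d → Module.End K (CI K R)
  | Sum.inl i => Lop K (S.x i)
  | Sum.inr i => Rop K (S.x i) - Lop K (S.x i)

theorem LL (S : MD K d R) (a b : R) : Lop K a * Lop K b = Lop K b * Lop K a := by
  ext w
  simp only [Module.End.mul_apply, Lop_coe]
  have := S.comm_mul_mem a b w.2 1
  rw [mul_one, sub_mul, sub_eq_zero, mul_assoc, mul_assoc] at this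
  exact this

theorem RR (S : MD K d R) (a b : R) : Rop K a * Rop K b = Rop K b * Rop K a := by
  ext w
  simp only [Module.End.mul_apply, Rop_coe]
  have := S.mem_mul_comm a b w.2
  rw [mul_sub, sub_eq_zero, ← mul_assoc, ← mul_assoc] at this
  exact this.symm

theorem LR (a b : R) : Lop K a * Rop K b = Rop K b * Lop K a := by
  ext w
  simp only [Module.End.mul_apply, Rop_coe, Lop_coe, mul_assoc]

theorem op_comm (S : MD K d R) (s t : Fin d ⊕ Fin d) :
    (S.opUV s : Module.End K (CI K R)) * S.opUV t = S.opUV t * S.opUV s := by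
  refine LinearMap.ext fun w => ?_
  have hLL : ∀ i j, S.x i * (S.x j * (w : R)) = S.x j * (S.x i * (w : R)) := fun i j =>
    congrArg Subtype.val (LinearMap.congr_fun (S.LL (S.x i) (S.x j)) w)
  have hRR : ∀ i j, (w : R) * S.x i * S.x j = (w : R) * S.x j * S.x i := fun i j =>
    congrArg Subtype.val (LinearMap.congr_fun (S.RR (S.x j) (S.x i)) w)
  ext
  rcases s with i | i <;> rcases t with j | j <;>
    simp only [opUV, Module.End.mul_apply, LinearMap.sub_apply, Submodule.coe_sub, Lop_coe,
      Rop_coe, mul_sub, sub_mul, hLL i j, hRR i j, mul_assoc]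
  abel

open scoped IsMulCommutative in
theorem exists_Phi (S : MD K d R) : ∃ Φ : PolyUV K d →ₐ[K] Module.End K (CI K R),
    ∀ s, Φ (MvPolynomial.X s) = S.opUV s := by
  have hc : ∀ a ∈ Set.range (S.opUV : Fin d ⊕ Fin d → Module.End K (CI K R)),
      ∀ b ∈ Set.range (S.opUV : Fin d ⊕ Fin d → Module.End K (CI K R)), a * b = b * a := by
    rintro _ ⟨s, rfl⟩ _ ⟨t, rfl⟩
    exact S.op_comm s t
  have := Algebra.isMulCommutative_adjoin K hc
  refine ⟨(Subalgebra.val _).comp (MvPolynomial.aeval (R := K)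
    (S₁ := Algebra.adjoin K (Set.range (S.opUV : Fin d ⊕ Fin d → Module.End K (CI K R))))
    (fun s => ⟨S.opUV s, Algebra.subset_adjoin ⟨s, rfl⟩⟩)), fun s => ?_⟩
  simp

/-- the action of `K[U,V]` on `F'` -/
def Phi (S : MD K d R) : PolyUV K d →ₐ[K] Module.End K (CI K R) :=
  S.exists_Phi.choose

theorem Phi_X (S : MD K d R) (s : Fin d ⊕ Fin d) : S.Phi (MvPolynomial.X s) = S.opUV s :=
  S.exists_Phi.choose_spec s

/-- the commutators of generators -/
def cc (S : MD K d R) (i j : Fin d) : CI K R :=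
  ⟨S.x i * S.x j - S.x j * S.x i, comm_mem _ _⟩

theorem cc_swap (S : MD K d R) (i j : Fin d) : S.cc i j = - S.cc j i := by
  ext; simp [cc]

theorem jacobi (S : MD K d R) (i j l : Fin d) :
    S.Phi (MvPolynomial.X (Sum.inr l)) (S.cc i j)
    = S.Phi (MvPolynomial.X (Sum.inr j)) (S.cc i l)
      - S.Phi (MvPolynomial.X (Sum.inr i)) (S.cc j l) := by
  ext
  simp only [S.Phi_X, opUV, LinearMap.sub_apply, Submodule.coe_sub, Lop_coe, Rop_coe, cc]
  noncomm_ring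

/-- `F'` is spanned by the `g·[x_i,x_j]`, `g` a monomial. -/
theorem span_top (S : MD K d R) :
    Submodule.span K {w : CI K R | ∃ m i j, w = S.Phi (MvPolynomial.monomial m 1) (S.cc i j)}
      = ⊤ := by
  set N := Submodule.span K
    {w : CI K R | ∃ m i j, w = S.Phi (MvPolynomial.monomial m 1) (S.cc i j)} with hN
  have hX : ∀ s, ∀ w ∈ N, (S.opUV s : Module.End K (CI K R)) w ∈ N := by
    intro s w hw
    induction hw using Submodule.span_induction with
    | mem x h =>
      obtain ⟨m, i, j, rfl⟩ := h
      refine Submodule.subset_span ⟨Finsupp.single s 1 + m, i, j, ?_⟩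
      rw [← S.Phi_X, ← Module.End.mul_apply, ← map_mul, MvPolynomial.X, MvPolynomial.monomial_mul,
        one_mul]
    | zero => simp
    | add x z _ _ hx hz => rw [map_add]; exact N.add_mem hx hz
    | smul a x _ hx => rw [map_smul]; exact N.smul_mem _ hx
  have hL : ∀ a : R, ∀ w ∈ N, Lop K a w ∈ N := by
    intro a
    induction a using S.ind with
    | h0 r =>
      intro w hw
      have : Lop K (algebraMap K (R) r) w = r • w := by
        ext; simp [Algebra.smul_def]
      rw [this]; exact N.smul_mem _ hw
    | h1 i => exact hX (Sum.inl i)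
    | hmul a b ha hb =>
      intro w hw
      have : Lop K (a * b) w = Lop K a (Lop K b w) := by ext; simp [mul_assoc]
      rw [this]; exact ha _ (hb _ hw)
    | hadd a b ha hb =>
      intro w hw
      have : Lop K (a + b) w = Lop K a w + Lop K b w := by ext; simp [add_mul]
      rw [this]; exact N.add_mem (ha _ hw) (hb _ hw)
  have hR : ∀ a : R, ∀ w ∈ N, Rop K a w ∈ N := by
    intro a
    induction a using S.ind with
    | h0 r =>
      intro w hw
      have : Rop K (algebraMap K (R) r) w = r • w := by
        ext; simp [Algebra.smul_def, Algebra.commutes]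
      rw [this]; exact N.smul_mem _ hw
    | h1 i =>
      intro w hw
      have := N.add_mem (hX (Sum.inr i) w hw) (hX (Sum.inl i) w hw)
      simpa [opUV] using this
    | hmul a b ha hb =>
      intro w hw
      have : Rop K (a * b) w = Rop K b (Rop K a w) := by ext; simp [mul_assoc]
      rw [this]; exact hb _ (ha _ hw)
    | hadd a b ha hb =>
      intro w hw
      have : Rop K (a + b) w = Rop K a w + Rop K b w := by ext; simp [mul_add]
      rw [this]; exact N.add_mem (ha _ hw) (hb _ hw)
  have hC : ∀ f g : R, (⟨f * g - g * f, comm_mem f g⟩ : CI K R) ∈ N := by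
    intro f
    induction f using S.ind with
    | h0 r =>
      intro g
      have : (⟨algebraMap K _ r * g - g * algebraMap K _ r, comm_mem _ g⟩ : CI K R) = 0 := by
        ext; simp [Algebra.commutes]
      rw [this]; exact N.zero_mem
    | h1 i =>
      intro g
      induction g using S.ind with
      | h0 r =>
        have : (⟨S.x i * algebraMap K _ r - algebraMap K _ r * S.x i, comm_mem _ _⟩
          : CI K R) = 0 := by
          ext; simp [Algebra.commutes]
        rw [this]; exact N.zero_mem
      | h1 j =>
        refine Submodule.subset_span ⟨0, i, j, ?_⟩
        have : (MvPolynomial.monomial 0 1 : PolyUV K d) = 1 := rfl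
        rw [this, map_one]; rfl
      | hmul a b ha hb =>
        convert N.add_mem (hR b _ ha) (hL a _ hb) using 1
        ext; simp only [Submodule.coe_add, Lop_coe, Rop_coe]; noncomm_ring
      | hadd a b ha hb =>
        convert N.add_mem ha hb using 1
        ext; simp only [Submodule.coe_add]; noncomm_ring
    | hmul a b ha hb =>
      intro g
      convert N.add_mem (hR b _ (ha g)) (hL a _ (hb g)) using 1
      ext; simp only [Submodule.coe_add, Lop_coe, Rop_coe]; noncomm_ring
    | hadd a b ha hb =>
      intro g
      convert N.add_mem (ha g) (hb g) using 1
      ext; simp only [Submodule.coe_add]; noncomm_ring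
  rw [eq_top_iff]
  rintro ⟨w, hw⟩ -
  have hw' : w ∈ gI R := hw
  suffices h : ∃ y ∈ N, (y : R) = w by
    obtain ⟨y, hy, rfl⟩ := h; exact hy
  clear hw
  induction hw' using Submodule.span_induction with
  | mem x h =>
    obtain ⟨a, f, g, b, rfl⟩ := h
    exact ⟨_, hR b _ (hL a _ (hC f g)), rfl⟩
  | zero => exact ⟨0, N.zero_mem, rfl⟩
  | add x z _ _ hx hz =>
    obtain ⟨y, hy, rfl⟩ := hx
    obtain ⟨y', hy', rfl⟩ := hz
    exact ⟨_, N.add_mem hy hy', rfl⟩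
  | smul a x _ hx =>
    obtain ⟨y, hy, rfl⟩ := hx
    exact ⟨_, hL a _ hy, rfl⟩

end FSide

end MD

end HSR

namespace HSR

open MvPolynomial

section PSide

variable {K : Type*} [Field K] {d : ℕ}

/-- degree in the `v` variables -/
def vdeg (m : (Fin d ⊕ Fin d) →₀ ℕ) : ℕ := ∑ i, m (Sum.inr i)

theorem vdeg_add (m m' : (Fin d ⊕ Fin d) →₀ ℕ) : vdeg (m + m') = vdeg m + vdeg m' := by
  simp [vdeg, Finset.sum_add_distrib]

theorem vdeg_single (i : Fin d) : vdeg (Finsupp.single (Sum.inr i : Fin d ⊕ Fin d) 1) = 1 := by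
  simp [vdeg, Finsupp.single_apply]

/-- diagonal operator -/
def Wt (c : ((Fin d ⊕ Fin d) →₀ ℕ) → K) : PolyUV K d →ₗ[K] PolyUV K d :=
  (basisMonomials (Fin d ⊕ Fin d) K).constr K (fun m => monomial m (c m))

theorem Wt_monomial (c : ((Fin d ⊕ Fin d) →₀ ℕ) → K) (m) (a : K) :
    Wt c (monomial m a) = c m • monomial m a := by
  have : (monomial m a : PolyUV K d) = a • basisMonomials (Fin d ⊕ Fin d) K m := by
    simp [smul_monomial]
  rw [this, map_smul, Wt, Module.Basis.constr_basis]
  simp [smul_monomial, mul_comm]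

theorem coeff_Wt (c : ((Fin d ⊕ Fin d) →₀ ℕ) → K) (m) (f : PolyUV K d) :
    coeff m (Wt c f) = c m * coeff m f := by
  induction f using MvPolynomial.induction_on' with
  | monomial m' a =>
    rw [Wt_monomial, coeff_smul, coeff_monomial]
    split_ifs with h
    · simp [h]
    · simp
  | add p q hp hq => rw [map_add, coeff_add, coeff_add, hp, hq, mul_add]

theorem Wt_hom (c : ((Fin d ⊕ Fin d) →₀ ℕ) → K) {f : PolyUV K d} {n : ℕ}
    (hf : f.IsHomogeneous n) : (Wt c f).IsHomogeneous n := by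
  intro m hm
  rw [coeff_Wt] at hm
  exact hf (right_ne_zero_of_mul hm)

/-- partial derivatives in `v` -/
abbrev dv (i : Fin d) : Derivation K (PolyUV K d) (PolyUV K d) := pderiv (Sum.inr i)

/-- Euler operator -/
def EE (f : PolyUV K d) : PolyUV K d := ∑ i, vP K d i * dv i f

theorem EE_add (f g : PolyUV K d) : EE (f + g) = EE f + EE g := by
  simp [EE, mul_add, Finset.sum_add_distrib]

theorem EE_monomial (m) (a : K) :
    EE (monomial m a : PolyUV K d) = (vdeg m : K) • monomial m a := by
  unfold EE vP
  simp only [X_mul_pderiv_monomial]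
  rw [vdeg, ← Finset.sum_smul, Nat.cast_smul_eq_nsmul]

/-- `J` -/
def JJ (K : Type*) [Field K] (d : ℕ) : PolyUV K d →ₗ[K] PolyUV K d :=
  Wt (fun m => ((vdeg m : K) + 1)⁻¹)

/-- `J'` -/
def JP (K : Type*) [Field K] (d : ℕ) : PolyUV K d →ₗ[K] PolyUV K d :=
  Wt (fun m => ((vdeg m : K))⁻¹)

theorem EE_JJ [CharZero K] (f : PolyUV K d) : EE (JJ K d f) + JJ K d f = f := by
  induction f using MvPolynomial.induction_on' with
  | monomial m a =>
    have hh : ∀ (c : K) (y : PolyUV K d), c • y + y = (c + 1) • y := fun c y => by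
      rw [add_smul, one_smul]
    rw [JJ, Wt_monomial, smul_monomial, EE_monomial, hh, smul_monomial, smul_eq_mul,
      smul_eq_mul, ← mul_assoc, mul_inv_cancel₀ (Nat.cast_add_one_ne_zero _), one_mul]
  | add p q hp hq =>
    rw [map_add, EE_add]; nth_rewrite 3 [← hp]; nth_rewrite 3 [← hq]; abel

theorem JJ_EE [CharZero K] (f : PolyUV K d) : JJ K d (EE f + f) = f := by
  induction f using MvPolynomial.induction_on' with
  | monomial m a =>
    have hh : ∀ (c : K) (y : PolyUV K d), c • y + y = (c + 1) • y := fun c y => by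
      rw [add_smul, one_smul]
    rw [JJ, EE_monomial, hh, smul_monomial, Wt_monomial, smul_monomial, smul_eq_mul,
      smul_eq_mul, ← mul_assoc, inv_mul_cancel₀ (Nat.cast_add_one_ne_zero _), one_mul]
  | add p q hp hq =>
    rw [EE_add, add_add_add_comm, map_add, hp, hq]

theorem vP_mul_monomial (i : Fin d) (m) (a : K) :
    vP K d i * monomial m a = monomial (Finsupp.single (Sum.inr i) 1 + m) a := by
  rw [vP, X, monomial_mul, one_mul]

theorem vP_JJ (i : Fin d) (f : PolyUV K d) : vP K d i * JJ K d f = JP K d (vP K d i * f) := by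
  induction f using MvPolynomial.induction_on' with
  | monomial m a =>
    rw [JJ, JP, Wt_monomial, vP_mul_monomial, Wt_monomial, vdeg_add, vdeg_single,
      mul_smul_comm, vP_mul_monomial]
    push_cast
    rw [add_comm (1 : K)]
  | add p q hp hq => rw [map_add, mul_add, mul_add, map_add, hp, hq]

theorem JP_EE [CharZero K] {w : PolyUV K d} (hw : w ∈ omegaUV K d) : JP K d (EE w) = w := by
  induction hw using Submodule.span_induction with
  | mem x h =>
    obtain ⟨m, ⟨i, hi⟩, rfl⟩ := h
    rw [JP, EE_monomial, map_smul, Wt_monomial, smul_smul, mul_inv_cancel₀, one_smul]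
    rw [Nat.cast_ne_zero]
    intro h0
    exact hi (Finset.sum_eq_zero_iff.mp h0 i (Finset.mem_univ i))
  | zero => simp [EE]
  | add x y _ _ hx hy => rw [EE_add, map_add, hx, hy]
  | smul a x _ hx =>
    have : EE (a • x) = a • EE x := by simp [EE, Finset.smul_sum]
    rw [this, map_smul, hx]

theorem vP_mul_mem (i : Fin d) (f : PolyUV K d) : vP K d i * f ∈ omegaUV K d := by
  induction f using MvPolynomial.induction_on' with
  | monomial m a =>
    have : (monomial (Finsupp.single (Sum.inr i) 1 + m) a : PolyUV K d)
      = a • monomial (Finsupp.single (Sum.inr i) 1 + m) 1 := by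
      simp [smul_monomial]
    rw [vP_mul_monomial, this]
    exact Submodule.smul_mem _ _ (Submodule.subset_span ⟨_, ⟨i, by simp⟩, rfl⟩)
  | add p q hp hq => rw [mul_add]; exact Submodule.add_mem _ hp hq

section der

variable (β : Matrix (Fin d) (Fin d) K) (δ' : Derivation K (PolyUV K d) (PolyUV K d))

/-- δ' is induced by the matrix β -/
structure Ind : Prop where
  hu : ∀ j, δ' (uP K d j) = ∑ i, β i j • uP K d i
  hv : ∀ j, δ' (vP K d j) = ∑ i, β i j • vP K d i

variable {β δ'}

theorem dv_uP (i j : Fin d) : dv i (uP K d j) = 0 := by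
  simp [uP]

theorem dv_vP (i j : Fin d) : dv i (vP K d j) = if j = i then 1 else 0 := by
  simp [vP, pderiv_X, Pi.single_apply]

theorem der_sum (c : Fin d → K) (f : PolyUV K d) :
    (∑ k, c k • (dv k : Derivation K (PolyUV K d) (PolyUV K d))) f = ∑ k, c k • dv k f := by
  have := congrFun (map_sum (Derivation.coeFnAddMonoidHom (R := K) (A := PolyUV K d)
    (M := PolyUV K d)) (fun k => c k • dv k) Finset.univ) f
  rw [Finset.sum_apply] at this
  exact this

theorem comm_dv (h : Ind β δ') (i : Fin d) (f : PolyUV K d) :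
    δ' (dv i f) = dv i (δ' f) - ∑ k, β i k • dv k f := by
  have : (⁅δ', dv i⁆ : Derivation K (PolyUV K d) (PolyUV K d)) = - ∑ k, β i k • dv k := by
    apply MvPolynomial.derivation_ext
    rintro (j | j)
    · change ⁅δ', dv i⁆ (uP K d j) = (- ∑ k, β i k • dv k : Derivation K _ _) (uP K d j)
      rw [Derivation.commutator_apply, dv_uP, h.hu]
      simp [dv_uP, der_sum]
    · change ⁅δ', dv i⁆ (vP K d j) = (- ∑ k, β i k • dv k : Derivation K _ _) (vP K d j)
      rw [Derivation.commutator_apply, dv_vP, h.hv]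
      have h1 : δ' (if j = i then 1 else 0) = 0 := by split_ifs <;> simp
      rw [h1]
      simp [dv_vP, der_sum]
  have h2 := DFunLike.congr_fun this f
  rw [Derivation.commutator_apply] at h2
  simp only [Derivation.neg_apply, der_sum] at h2
  rw [sub_eq_iff_eq_add.mp h2]; abel

theorem comm_EE (h : Ind β δ') (f : PolyUV K d) : δ' (EE f) = EE (δ' f) := by
  simp only [EE, map_sum, Derivation.leibniz, smul_eq_mul, comm_dv h, h.hv, mul_sub,
    Finset.sum_add_distrib, Finset.sum_sub_distrib, Finset.mul_sum]
  rw [sub_add_eq_add_sub, add_sub_assoc, add_eq_left, sub_eq_zero, Finset.sum_comm]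
  refine Finset.sum_congr rfl fun i _ => Finset.sum_congr rfl fun j _ => ?_
  simp [mul_comm]

theorem comm_JJ [CharZero K] (h : Ind β δ') (f : PolyUV K d) : δ' (JJ K d f) = JJ K d (δ' f) := by
  nth_rewrite 2 [← EE_JJ f]
  rw [map_add, comm_EE h, JJ_EE]

end der

/-- The model of `(F')^δ` in polynomial degree `n`. -/
def ZK (β : Matrix (Fin d) (Fin d) K) (δ' : Derivation K (PolyUV K d) (PolyUV K d)) (n : ℕ) :
    Submodule K (Fin d → PolyUV K d) where
  carrier := {f | ∑ i, vP K d i * f i = 0 ∧ (∀ i, δ' (f i) + ∑ j, β i j • f j = 0) ∧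
    ∀ i, (f i).IsHomogeneous n}
  add_mem' := by
    rintro f g ⟨h1, h2, h3⟩ ⟨k1, k2, k3⟩
    refine ⟨?_, fun i => ?_, fun i => (h3 i).add (k3 i)⟩
    · simp [mul_add, Finset.sum_add_distrib, h1, k1]
    · have := congrArg₂ (· + ·) (h2 i) (k2 i)
      simp only [add_zero] at this
      rw [← this]
      simp [Finset.sum_add_distrib]; abel
  zero_mem' := ⟨by simp, by simp, fun i => isHomogeneous_zero _ _ _⟩
  smul_mem' := by
    rintro c f ⟨h1, h2, h3⟩
    refine ⟨?_, fun i => ?_, fun i => (homogeneousSubmodule _ _ n).smul_mem c (h3 i)⟩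
    · simp [← Finset.smul_sum, h1]
    · have := congrArg (c • ·) (h2 i)
      simp only [smul_zero, smul_add, Finset.smul_sum] at this
      rw [← this]
      simp [smul_comm c]

theorem mem_ZK {β : Matrix (Fin d) (Fin d) K} {δ' : Derivation K (PolyUV K d) (PolyUV K d)} {n : ℕ}
    {f : Fin d → PolyUV K d} : f ∈ ZK β δ' n ↔
    ∑ i, vP K d i * f i = 0 ∧ (∀ i, δ' (f i) + ∑ j, β i j • f j = 0) ∧
    ∀ i, (f i).IsHomogeneous n := Iff.rfl

/-- all homogeneous vectors -/
def MH (K : Type*) [Field K] (d n : ℕ) : Submodule K (Fin d → PolyUV K d) :=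
  Submodule.pi Set.univ (fun _ => homogeneousSubmodule _ K n)

theorem finite_of_hom {n : ℕ} (N : Submodule K (Fin d → PolyUV K d))
    (hN : ∀ f ∈ N, ∀ i, (f i).IsHomogeneous n) : FiniteDimensional K N := by
  have : Module.Finite K (homogeneousSubmodule (Fin d ⊕ Fin d) K n) :=
    Module.Finite.iff_fg.mpr (homogeneousSubmodule_fg _ _ n)
  let φ : N →ₗ[K] (Fin d → homogeneousSubmodule (Fin d ⊕ Fin d) K n) :=
    LinearMap.pi fun i => ((LinearMap.proj i).comp N.subtype).codRestrict _ (fun f => hN f f.2 i)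
  refine FiniteDimensional.of_injective φ ?_
  intro f g hfg
  ext1
  funext i
  exact congrArg Subtype.val (congrFun hfg i)

end PSide

end HSR

namespace HSR

open MvPolynomial

namespace MD

section Main

variable {K : Type*} [Field K] {d : ℕ} {R : Type*} [Ring R] [Algebra K R]

theorem hom_gI (φ : R →ₐ[K] PolyUV K d) {w : R} (hw : w ∈ gI R) : φ w = 0 := by
  induction hw using Submodule.span_induction with
  | mem x h =>
    obtain ⟨a, f, g, b, rfl⟩ := h
    simp only [map_mul, map_sub]; ring
  | zero => simp
  | add x y _ _ hx hy => rw [map_add, hx, hy, add_zero]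
  | smul a x _ hx => rw [smul_eq_mul, map_mul, hx, mul_zero]

theorem D_left (S : MD K d R) (i : Fin d) {w : R} (hw : w ∈ gI R) :
    S.D (S.x i * w) = uP K d i • S.D w := by
  rw [S.D_mul, hom_gI S.rho hw, zero_smul, add_zero, S.lam_x]

theorem D_right (S : MD K d R) (i : Fin d) {w : R} (hw : w ∈ gI R) :
    S.D (w * S.x i) = (uP K d i + vP K d i) • S.D w := by
  rw [S.D_mul, hom_gI S.lam hw, zero_smul, zero_add, S.rho_x]

theorem D_Phi (S : MD K d R) (g : PolyUV K d) (w : CI K R) :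
    S.D (S.Phi g w : CI K R) = g • S.D w := by
  induction g using MvPolynomial.induction_on generalizing w with
  | C a =>
    have : S.Phi (C a) w = a • w := by
      rw [← algebraMap_eq, AlgHom.commutes, Module.algebraMap_end_apply]
    rw [this, Submodule.coe_smul, map_smul, ← algebraMap_eq, algebraMap_smul]
  | add p q hp hq => rw [map_add, LinearMap.add_apply, Submodule.coe_add, map_add, hp, hq, add_smul]
  | mul_X p s hp =>
    rw [map_mul, Module.End.mul_apply, hp, mul_smul]
    congr 1
    rw [S.Phi_X]
    rcases s with i | i
    · exact S.D_left i w.2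
    · simp only [opUV, LinearMap.sub_apply, Submodule.coe_sub, Lop_coe, Rop_coe, map_sub]
      rw [S.D_left i w.2, S.D_right i w.2, add_smul, add_sub_cancel_left]; rfl

theorem D_cc (S : MD K d R) (i j : Fin d) :
    S.D (S.cc i j : CI K R) = vP K d j • Pi.single i 1 - vP K d i • Pi.single j 1 := by
  simp only [cc, map_sub, S.D_mul, S.D_x, S.lam_x, S.rho_x, add_smul]
  abel

theorem D_algebraMap (S : MD K d R) (r : K) : S.D (algebraMap K R r) = 0 := by
  have h1 : S.D 1 = 0 := by
    have := S.D_mul 1 1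
    simpa using this
  rw [Algebra.algebraMap_eq_smul_one, map_smul, h1, smul_zero]

theorem fund (S : MD K d R) (a : R) : ∑ i, vP K d i * S.D a i = S.rho a - S.lam a := by
  induction a using S.ind with
  | h0 r => simp [D_algebraMap, AlgHom.commutes]
  | h1 i => simp [S.D_x, S.rho_x, S.lam_x, Pi.single_apply]
  | hmul a b ha hb =>
    have : ∑ i, vP K d i * S.D (a * b) i
      = S.lam a * ∑ i, vP K d i * S.D b i + S.rho b * ∑ i, vP K d i * S.D a i := by
      rw [S.D_mul, Finset.mul_sum, Finset.mul_sum, ← Finset.sum_add_distrib]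
      refine Finset.sum_congr rfl fun i _ => ?_
      simp only [Pi.add_apply, Pi.smul_apply, smul_eq_mul]; ring
    rw [this, ha, hb, map_mul, map_mul]; ring
  | hadd a b ha hb =>
    simp only [map_add, Pi.add_apply, mul_add, Finset.sum_add_distrib, ha, hb]; ring

/-- The homotopy -/
def TT (S : MD K d R) (f : Fin d → PolyUV K d) : CI K R :=
  ∑ k, ∑ l, S.Phi (dv l (f k)) (S.cc k l)

theorem TT_add (S : MD K d R) (f g : Fin d → PolyUV K d) : S.TT (f + g) = S.TT f + S.TT g := by
  simp [TT, Finset.sum_add_distrib]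

theorem TT_smul (S : MD K d R) (c : K) (f : Fin d → PolyUV K d) : S.TT (c • f) = c • S.TT f := by
  simp [TT, Finset.smul_sum]

theorem TT_single (S : MD K d R) (i : Fin d) (g : PolyUV K d) :
    S.TT (Pi.single i g) = ∑ l, S.Phi (dv l g) (S.cc i l) := by
  rw [TT, Finset.sum_eq_single i]
  · simp
  · intro k _ hk
    simp [Pi.single_eq_of_ne hk]
  · simp

theorem TT_single_mul (S : MD K d R) (i j : Fin d) (g : PolyUV K d) :
    S.TT (Pi.single i (g * vP K d j)) = S.Phi g (S.cc i j)
      + ∑ l, S.Phi (dv l g) (S.Phi (vP K d j) (S.cc i l)) := by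
  rw [TT_single]
  simp only [Derivation.leibniz, dv_vP, smul_eq_mul, map_add, LinearMap.add_apply,
    Finset.sum_add_distrib]
  congr 1
  · rw [Finset.sum_eq_single j]
    · simp
    · intro l _ hl
      simp [hl.symm]
    · simp
  · refine Finset.sum_congr rfl fun l _ => ?_
    rw [mul_comm, map_mul, Module.End.mul_apply]

theorem TT_key (S : MD K d R) (i j : Fin d) (g : PolyUV K d) :
    S.TT (g • (vP K d j • Pi.single i 1 - vP K d i • Pi.single j 1))
      = S.Phi (EE g + g + g) (S.cc i j) := by
  have h1 : g • (vP K d j • (Pi.single i 1 : Fin d → PolyUV K d) - vP K d i • Pi.single j 1)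
    = Pi.single i (g * vP K d j)
      + (-1 : K) • (Pi.single j (g * vP K d i) : Fin d → PolyUV K d) := by
    funext k
    simp only [Pi.smul_apply, Pi.sub_apply, Pi.add_apply, Pi.single_apply, smul_eq_mul]
    split_ifs <;> simp
    ring
  rw [h1, TT_add, TT_smul, TT_single_mul, TT_single_mul, map_add, map_add, S.cc_swap j i, EE,
    map_sum, LinearMap.add_apply, LinearMap.add_apply, LinearMap.sum_apply]
  have h2 : ∀ l, S.Phi (vP K d l * dv l g) (S.cc i j)
      = S.Phi (dv l g) (S.Phi (vP K d j) (S.cc i l))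
        - S.Phi (dv l g) (S.Phi (vP K d i) (S.cc j l)) := by
    intro l
    rw [mul_comm, map_mul, Module.End.mul_apply, vP, S.jacobi, map_sub]; rfl
  simp only [h2, Finset.sum_sub_distrib, map_neg]
  have h3 : ∀ y : CI K R, (-1 : K) • y = -y := fun y => by ext; simp
  rw [h3]
  abel

/-- The inverse of `D` -/
def Psi (S : MD K d R) (f : Fin d → PolyUV K d) : CI K R := S.TT (fun k => JJ K d (f k))

theorem Psi_add (S : MD K d R) (f g : Fin d → PolyUV K d) : S.Psi (f + g) = S.Psi f + S.Psi g := by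
  rw [Psi, Psi, Psi, ← TT_add]; congr 1; funext k; simp

theorem Psi_smul (S : MD K d R) (c : K) (f : Fin d → PolyUV K d) :
    S.Psi (c • f) = c • S.Psi f := by
  rw [Psi, Psi, ← TT_smul]; congr 1; funext k; simp

theorem Psi_D [CharZero K] (S : MD K d R) (w : CI K R) : S.Psi (S.D w) = w := by
  have hw : w ∈ (⊤ : Submodule K (CI K R)) := trivial
  rw [← S.span_top] at hw
  induction hw using Submodule.span_induction with
  | mem x h =>
    obtain ⟨m, i, j, rfl⟩ := h
    rw [D_Phi, D_cc]
    have h1 : ∀ i : Fin d, JJ K d (monomial m 1 * vP K d i)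
        = ((vdeg m : K) + 2)⁻¹ • (monomial m 1 * vP K d i) := by
      intro i
      rw [mul_comm, vP_mul_monomial, JJ, Wt_monomial, vdeg_add, vdeg_single]
      congr 2; push_cast; ring
    have h2 : ∀ i j k : Fin d, JJ K d (monomial m 1 * (vP K d i * (Pi.single j 1 : Fin d → PolyUV K d) k))
      = ((vdeg m : K) + 2)⁻¹ • (monomial m 1 * (vP K d i * (Pi.single j 1 : Fin d → PolyUV K d) k)) := by
      intro i j k
      by_cases hk : k = j
      · subst hk; simp [h1]
      · simp [Pi.single_eq_of_ne hk]
    have h3 : S.Psi ((monomial m 1 : PolyUV K d) •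
        (vP K d j • Pi.single i 1 - vP K d i • Pi.single j 1))
      = S.TT (((vdeg m : K) + 2)⁻¹ • ((monomial m 1 : PolyUV K d) •
        (vP K d j • Pi.single i 1 - vP K d i • Pi.single j 1))) := by
      rw [Psi]; congr 1; funext k
      simp only [Pi.smul_apply, Pi.sub_apply, smul_eq_mul, mul_sub, map_sub, h2, smul_sub]
    rw [h3, TT_smul, TT_key, EE_monomial]
    have h4 : (vdeg m : K) • (monomial m 1 : PolyUV K d) + monomial m 1 + monomial m 1
      = ((vdeg m : K) + 2) • monomial m 1 := by
      rw [add_smul, two_smul, add_assoc]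
    have h5 : (vdeg m : K) + 2 ≠ 0 := by exact_mod_cast (by omega : vdeg m + 2 ≠ 0)
    rw [h4, map_smul, LinearMap.smul_apply, smul_smul, inv_mul_cancel₀ h5, one_smul]
  | zero =>
    have := S.Psi_smul 0 0
    simpa using this
  | add x y _ _ hx hy => rw [Submodule.coe_add, map_add, Psi_add, hx, hy]
  | smul a x _ hx => rw [Submodule.coe_smul, map_smul, Psi_smul, hx]

theorem D_TT (S : MD K d R) (f : Fin d → PolyUV K d) (hf : ∑ i, vP K d i * f i = 0) (k : Fin d) :
    S.D (S.TT f) k = EE (f k) + f k := by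
  have h1 : S.D (S.TT f) = ∑ k, ∑ l, dv l (f k) • (vP K d l • Pi.single k 1
      - vP K d k • Pi.single l 1 : Fin d → PolyUV K d) := by
    simp only [TT, Submodule.coe_sum, map_sum, D_Phi, D_cc]
  have h2 : ∀ k, dv k (∑ i, vP K d i * f i) = 0 := fun k => by rw [hf, map_zero]
  have h3 := h2 k
  simp only [map_sum, Derivation.leibniz, dv_vP, smul_eq_mul, Finset.sum_add_distrib] at h3
  have h4 : ∑ x, f x * (if x = k then 1 else 0) = f k := by simp
  rw [h4] at h3
  rw [h1]
  simp only [Finset.sum_apply, Pi.smul_apply, Pi.sub_apply, smul_eq_mul, mul_sub,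
    Finset.sum_sub_distrib, Pi.single_apply]
  rw [Finset.sum_comm]
  have h5 : ∑ x, ∑ l, (dv x) (f l) * (vP K d x * if k = l then 1 else 0) = EE (f k) := by
    simp [EE, mul_comm]
  have h6 : ∑ x, ∑ l, (dv l) (f x) * (vP K d x * if k = l then 1 else 0)
      = ∑ x, vP K d x * dv k (f x) := by
    simp [mul_comm]
  rw [h5, h6, eq_neg_of_add_eq_zero_left h3]; ring

theorem D_Psi [CharZero K] (S : MD K d R) (f : Fin d → PolyUV K d)
    (hf : ∑ i, vP K d i * f i = 0) : S.D (S.Psi f) = f := by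
  funext k
  rw [Psi, D_TT, EE_JJ]
  simp only [vP_JJ]
  rw [← map_sum, hf, map_zero]

end Main
end MD
end HSR

namespace HSR

open MvPolynomial

namespace MD

section Deg

variable {K : Type*} [Field K] {d : ℕ} {R : Type*} [Ring R] [Algebra K R]

/-- homogeneous components -/
def dg (S : MD K d R) (n : ℕ) : Submodule K R :=
  Submodule.span K {w | ∃ l : List (Fin d), l.length = n ∧ w = (l.map S.x).prod}

theorem lam_word (S : MD K d R) (l : List (Fin d)) :
    (S.lam (l.map S.x).prod).IsHomogeneous l.length := by
  induction l with
  | nil => simpa using isHomogeneous_one _ _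
  | cons i l ih =>
    rw [List.map_cons, List.prod_cons, map_mul, S.lam_x, List.length_cons, add_comm]
    exact (isHomogeneous_X _ _).mul ih

theorem rho_word (S : MD K d R) (l : List (Fin d)) :
    (S.rho (l.map S.x).prod).IsHomogeneous l.length := by
  induction l with
  | nil => simpa using isHomogeneous_one _ _
  | cons i l ih =>
    rw [List.map_cons, List.prod_cons, map_mul, S.rho_x, List.length_cons, add_comm l.length]
    exact ((isHomogeneous_X _ _).add (isHomogeneous_X _ _)).mul ih

theorem D_word (S : MD K d R) (l : List (Fin d)) (k : Fin d) : ∀ n, l.length = n + 1 →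
    (S.D (l.map S.x).prod k).IsHomogeneous n := by
  induction l with
  | nil => simp
  | cons i l ih =>
    intro n hn
    have hl : l.length = n := by simpa using hn
    rw [List.map_cons, List.prod_cons, S.D_mul, S.lam_x, S.D_x]
    simp only [Pi.add_apply, Pi.smul_apply, smul_eq_mul]
    refine IsHomogeneous.add ?_ ?_
    · cases n with
      | zero =>
        have : l = [] := List.length_eq_zero_iff.mp hl
        subst this
        have h1 := S.D_algebraMap 1
        rw [map_one] at h1
        simp [h1, isHomogeneous_zero]
      | succ n =>
        rw [add_comm]
        exact (isHomogeneous_X _ _).mul (ih n hl)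
    · rw [← hl, ← add_zero l.length]
      refine (S.rho_word l).mul ?_
      rw [Pi.single_apply]
      split_ifs
      · exact isHomogeneous_one _ _
      · exact isHomogeneous_zero _ _ _

theorem D_dg (S : MD K d R) {n : ℕ} {w : R} (hw : w ∈ S.dg (n + 1)) (k : Fin d) :
    (S.D w k).IsHomogeneous n := by
  induction hw using Submodule.span_induction with
  | mem x h => obtain ⟨l, hl, rfl⟩ := h; exact S.D_word l k n hl
  | zero => simpa using isHomogeneous_zero _ _ _
  | add x y _ _ hx hy => rw [map_add]; exact hx.add hy
  | smul a x _ hx => rw [map_smul]; exact (homogeneousSubmodule _ _ n).smul_mem a hx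

theorem D_dg_zero (S : MD K d R) {w : R} (hw : w ∈ S.dg 0) : S.D w = 0 := by
  induction hw using Submodule.span_induction with
  | mem x h =>
    obtain ⟨l, hl, rfl⟩ := h
    rw [List.length_eq_zero_iff] at hl; subst hl
    have h1 := S.D_algebraMap 1
    rw [map_one] at h1
    simp [h1]
  | zero => simp
  | add x y _ _ hx hy => rw [map_add, hx, hy, add_zero]
  | smul a x _ hx => rw [map_smul, hx, smul_zero]

theorem x_mul_dg (S : MD K d R) (i : Fin d) {n : ℕ} {w : R} (hw : w ∈ S.dg n) :
    S.x i * w ∈ S.dg (n + 1) := by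
  induction hw using Submodule.span_induction with
  | mem x h =>
    obtain ⟨l, hl, rfl⟩ := h
    exact Submodule.subset_span ⟨i :: l, by simp [hl], by simp⟩
  | zero => simp
  | add x y _ _ hx hy => rw [mul_add]; exact Submodule.add_mem _ hx hy
  | smul a x _ hx => rw [mul_smul_comm]; exact Submodule.smul_mem _ _ hx

theorem mul_x_dg (S : MD K d R) (i : Fin d) {n : ℕ} {w : R} (hw : w ∈ S.dg n) :
    w * S.x i ∈ S.dg (n + 1) := by
  induction hw using Submodule.span_induction with
  | mem x h =>
    obtain ⟨l, hl, rfl⟩ := h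
    exact Submodule.subset_span ⟨l ++ [i], by simp [hl], by simp⟩
  | zero => simp
  | add x y _ _ hx hy => rw [add_mul]; exact Submodule.add_mem _ hx hy
  | smul a x _ hx => rw [smul_mul_assoc]; exact Submodule.smul_mem _ _ hx

theorem cc_dg (S : MD K d R) (i j : Fin d) : (S.cc i j : R) ∈ S.dg 2 := by
  refine Submodule.sub_mem _ (Submodule.subset_span ⟨[i, j], by simp, by simp⟩)
    (Submodule.subset_span ⟨[j, i], by simp, by simp⟩)

theorem op_dg (S : MD K d R) (s : Fin d ⊕ Fin d) {n : ℕ} {w : CI K R} (hw : (w : R) ∈ S.dg n) :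
    ((S.opUV s w : CI K R) : R) ∈ S.dg (n + 1) := by
  rcases s with i | i
  · exact S.x_mul_dg i hw
  · exact Submodule.sub_mem _ (S.mul_x_dg i hw) (S.x_mul_dg i hw)

theorem Phi_mon_dg (S : MD K d R) (m : (Fin d ⊕ Fin d) →₀ ℕ) : ∀ {n : ℕ} {w : CI K R},
    (w : R) ∈ S.dg n → ((S.Phi (monomial m 1) w : CI K R) : R) ∈ S.dg (n + m.degree) := by
  induction m using Finsupp.induction_linear with
  | zero =>
    intro n w hw
    have : (monomial 0 1 : PolyUV K d) = 1 := rfl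
    rw [this, map_one]; simpa using hw
  | add f g hf hg =>
    intro n w hw
    have : (monomial (f + g) 1 : PolyUV K d) = monomial f 1 * monomial g 1 := by
      rw [monomial_mul, one_mul]
    rw [this, map_mul, Module.End.mul_apply, map_add, add_comm f.degree, ← add_assoc]
    exact hf (hg hw)
  | single s k =>
    intro n w hw
    rw [← X_pow_eq_monomial, map_pow, S.Phi_X, Finsupp.degree_single]
    induction k with
    | zero => simpa using hw
    | succ k ih =>
      rw [pow_succ', Module.End.mul_apply, ← add_assoc]
      exact S.op_dg s ih

theorem Phi_dg (S : MD K d R) {n p : ℕ} {w : CI K R} (hw : (w : R) ∈ S.dg n) {g : PolyUV K d}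
    (hg : g.IsHomogeneous p) : ((S.Phi g w : CI K R) : R) ∈ S.dg (n + p) := by
  rw [g.as_sum, map_sum, LinearMap.sum_apply, Submodule.coe_sum]
  refine Submodule.sum_mem _ fun m hm => ?_
  have : (monomial m (coeff m g) : PolyUV K d) = coeff m g • monomial m 1 := by
    simp [smul_monomial]
  rw [this, map_smul, LinearMap.smul_apply, Submodule.coe_smul]
  have h2 : m.degree = p := by
    rw [← hg (mem_support_iff.mp hm), Finsupp.degree_eq_weight_one]; rfl
  rw [← h2]
  exact Submodule.smul_mem _ _ (S.Phi_mon_dg m hw)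

theorem dv_hom {n : ℕ} {f : PolyUV K d} (hf : f.IsHomogeneous (n + 1)) (l : Fin d) :
    (dv l f).IsHomogeneous n := by
  simpa using hf.pderiv (i := Sum.inr l)

theorem dv_hom_zero {f : PolyUV K d} (hf : f.IsHomogeneous 0) (l : Fin d) :
    dv l f = 0 := by
  rw [← totalDegree_zero_iff_isHomogeneous] at hf
  rw [totalDegree_eq_zero_iff_eq_C.mp hf]
  simp

theorem Psi_dg (S : MD K d R) {n : ℕ} {f : Fin d → PolyUV K d}
    (hf : ∀ k, (f k).IsHomogeneous n) : (S.Psi f : R) ∈ S.dg (n + 1) := by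
  rw [Psi, TT, Submodule.coe_sum]
  refine Submodule.sum_mem _ fun k _ => ?_
  rw [Submodule.coe_sum]
  refine Submodule.sum_mem _ fun l _ => ?_
  have h1 : (JJ K d (f k)).IsHomogeneous n := Wt_hom _ (hf k)
  cases n with
  | zero => rw [dv_hom_zero h1]; simp
  | succ n =>
    have := S.Phi_dg (S.cc_dg k l) (dv_hom h1 l)
    rwa [show n + 1 + 1 = 2 + n by ring]

end Deg

section Equiv

variable {K : Type*} [Field K] {d : ℕ} {R : Type*} [Ring R] [Algebra K R]

/-- δ on `R` is induced by β -/
structure IndR (S : MD K d R) (β : Matrix (Fin d) (Fin d) K) (δ : R →ₗ[K] R) : Prop where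
  leib : ∀ a b, δ (a * b) = δ a * b + a * δ b
  gx : ∀ j, δ (S.x j) = ∑ i, β i j • S.x i

variable {S : MD K d R} {β : Matrix (Fin d) (Fin d) K} {δ : R →ₗ[K] R}
  {δ' : Derivation K (PolyUV K d) (PolyUV K d)}

theorem IndR.alg (h : IndR S β δ) (r : K) : δ (algebraMap K R r) = 0 := by
  have h1 : δ 1 = 0 := by
    have := h.leib 1 1
    simpa using this
  rw [Algebra.algebraMap_eq_smul_one, map_smul, h1, smul_zero]

theorem lam_delta (h : IndR S β δ) (h' : Ind β δ') (a : R) : S.lam (δ a) = δ' (S.lam a) := by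
  induction a using S.ind with
  | h0 r => rw [h.alg, AlgHom.commutes, Derivation.map_algebraMap, map_zero]
  | h1 i => simp [h.gx, S.lam_x, h'.hu]
  | hmul a b ha hb => rw [h.leib, map_add, map_mul, map_mul, map_mul, ha, hb,
      Derivation.leibniz, smul_eq_mul, smul_eq_mul]; ring
  | hadd a b ha hb => simp [ha, hb]

theorem rho_delta (h : IndR S β δ) (h' : Ind β δ') (a : R) : S.rho (δ a) = δ' (S.rho a) := by
  induction a using S.ind with
  | h0 r => rw [h.alg, AlgHom.commutes, Derivation.map_algebraMap, map_zero]
  | h1 i => simp [h.gx, S.rho_x, h'.hu, h'.hv, Finset.sum_add_distrib]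
  | hmul a b ha hb => rw [h.leib, map_add, map_mul, map_mul, map_mul, ha, hb,
      Derivation.leibniz, smul_eq_mul, smul_eq_mul]; ring
  | hadd a b ha hb => simp [ha, hb]

theorem D_delta (h : IndR S β δ) (h' : Ind β δ') (a : R) (i : Fin d) :
    S.D (δ a) i = δ' (S.D a i) + ∑ j, β i j • S.D a j := by
  induction a using S.ind with
  | h0 r => rw [h.alg, D_algebraMap]; simp
  | h1 j =>
    rw [h.gx, S.D_x, map_sum]
    simp only [map_smul, S.D_x, Finset.sum_apply, Pi.smul_apply, Pi.single_apply]
    have : δ' (if i = j then 1 else 0) = 0 := by split_ifs <;> simp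
    rw [this]
    simp
  | hmul a b ha hb =>
    have hs : ∑ j, β i j • S.D (a * b) j
        = S.lam a * ∑ j, β i j • S.D b j + S.rho b * ∑ j, β i j • S.D a j := by
      rw [S.D_mul, Finset.mul_sum, Finset.mul_sum, ← Finset.sum_add_distrib]
      refine Finset.sum_congr rfl fun j _ => ?_
      simp
    rw [hs, h.leib, map_add, S.D_mul, S.D_mul, S.D_mul]
    simp only [Pi.add_apply, Pi.smul_apply, smul_eq_mul, ha, hb, map_add, Derivation.leibniz,
      lam_delta h h', rho_delta h h']
    ring
  | hadd a b ha hb =>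
    simp only [map_add, Pi.add_apply, ha, hb, smul_add, Finset.sum_add_distrib]; abel

theorem delta_gI (h : IndR S β δ) {w : R} (hw : w ∈ gI R) : δ w ∈ gI R := by
  induction hw using Submodule.span_induction with
  | mem x hx =>
    obtain ⟨a, f, g, b, rfl⟩ := hx
    have e : δ (a * (f * g - g * f) * b) = δ a * (f * g - g * f) * b
      + a * (δ f * g - g * δ f) * b + a * (f * δ g - δ g * f) * b + a * (f * g - g * f) * δ b := by
      simp only [h.leib, map_sub]; noncomm_ring
    rw [e]
    exact Ideal.add_mem _ (Ideal.add_mem _ (Ideal.add_mem _ (Ideal.subset_span ⟨_, _, _, _, rfl⟩)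
      (Ideal.subset_span ⟨_, _, _, _, rfl⟩)) (Ideal.subset_span ⟨_, _, _, _, rfl⟩))
      (Ideal.subset_span ⟨_, _, _, _, rfl⟩)
  | zero => simp
  | add x y _ _ hx hy => rw [map_add]; exact Ideal.add_mem _ hx hy
  | smul a x hx' hx =>
    rw [smul_eq_mul, h.leib]
    exact Ideal.add_mem _ (Ideal.mul_mem_left _ _ hx') (Ideal.mul_mem_left _ _ hx)

theorem D_inj [CharZero K] (S : MD K d R) {w : R} (hw : w ∈ gI R) (h : S.D w = 0) : w = 0 := by
  have h1 := S.Psi_D ⟨w, hw⟩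
  have h2 : S.Psi 0 = 0 := by simpa using S.Psi_smul 0 0
  rw [show S.D (⟨w, hw⟩ : CI K R) = 0 from h, h2] at h1
  exact (congrArg Subtype.val h1).symm

theorem finrank_zero [CharZero K] (S : MD K d R) (δ : R →ₗ[K] R) :
    Module.finrank K ((gI R).restrictScalars K ⊓ LinearMap.ker δ ⊓ S.dg 0 : Submodule K R) = 0 := by
  have : ((gI R).restrictScalars K ⊓ LinearMap.ker δ ⊓ S.dg 0 : Submodule K R) = ⊥ := by
    rw [eq_bot_iff]
    rintro w ⟨⟨h1, _⟩, h3⟩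
    exact S.D_inj h1 (S.D_dg_zero h3)
  rw [this, finrank_bot]

theorem finrank_succ [CharZero K] (h : IndR S β δ) (h' : Ind β δ') (n : ℕ) :
    Module.finrank K ((gI R).restrictScalars K ⊓ LinearMap.ker δ ⊓ S.dg (n + 1) : Submodule K R)
      = Module.finrank K (ZK β δ' n) := by
  set N := ((gI R).restrictScalars K ⊓ LinearMap.ker δ ⊓ S.dg (n + 1) : Submodule K R) with hN
  have hmap : ∀ w : N, S.D w ∈ ZK β δ' n := by
    rintro ⟨w, ⟨h1, h2⟩, h3⟩
    refine ⟨?_, fun i => ?_, fun i => S.D_dg h3 i⟩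
    · rw [fund, hom_gI _ h1, hom_gI _ h1, sub_zero]
    · rw [← D_delta h h', show δ w = 0 from h2]; simp
  refine (LinearEquiv.ofBijective ((S.D.comp N.subtype).codRestrict _ hmap) ⟨?_, ?_⟩).finrank_eq
  · rw [injective_iff_map_eq_zero]
    rintro ⟨w, ⟨h1, h2⟩, h3⟩ hw
    exact Subtype.ext (S.D_inj h1 (congrArg Subtype.val hw))
  · rintro ⟨f, h1, h2, h3⟩
    refine ⟨⟨S.Psi f, ⟨(S.Psi f).2, ?_⟩, S.Psi_dg h3⟩, Subtype.ext (S.D_Psi f h1)⟩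
    refine S.D_inj (delta_gI h (S.Psi f).2) ?_
    funext i
    rw [D_delta h h', S.D_Psi f h1, h2]; rfl

end Equiv
end MD
end HSR

namespace HSR

open MvPolynomial

section Conc

variable (K : Type*) [Field K] (d : ℕ)

/-- lifting the metabelian quotient -/
def liftM {A : Type*} [Ring A] [Algebra K A] (φ : FreeAlgebra K (Fin d) →ₐ[K] A)
    (h : ∀ a b c e, φ ((a * b - b * a) * (c * e - e * c)) = 0) : FreeMetab K d →ₐ[K] A :=
  RingQuot.liftAlgHom K ⟨φ, by
    rintro x y ⟨rfl, a, b, c, e, rfl⟩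
    rw [h, map_zero]⟩

theorem liftM_mk {A : Type*} [Ring A] [Algebra K A] (φ : FreeAlgebra K (Fin d) →ₐ[K] A)
    (h : ∀ a b c e, φ ((a * b - b * a) * (c * e - e * c)) = 0) (p) :
    liftM K d φ h (RingQuot.mkAlgHom K (MetabRel K d) p) = φ p :=
  RingQuot.liftAlgHom_mkAlgHom_apply _ _ _ _

/-- `λ` on the free algebra -/
def lam0 : FreeAlgebra K (Fin d) →ₐ[K] PolyUV K d := FreeAlgebra.lift K (uP K d)

/-- `ρ` on the free algebra -/
def rho0 : FreeAlgebra K (Fin d) →ₐ[K] PolyUV K d :=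
  FreeAlgebra.lift K (fun i => uP K d i + vP K d i)

/-- the matrix representation -/
def mat0 (k : Fin d) : FreeAlgebra K (Fin d) →ₐ[K] Matrix (Fin 2) (Fin 2) (PolyUV K d) :=
  FreeAlgebra.lift K (fun i => !![uP K d i, if k = i then 1 else 0; 0, uP K d i + vP K d i])

theorem mat0_entries (k : Fin d) (a : FreeAlgebra K (Fin d)) :
    mat0 K d k a 1 0 = 0 ∧ mat0 K d k a 0 0 = lam0 K d a ∧ mat0 K d k a 1 1 = rho0 K d a := by
  induction a using FreeAlgebra.induction with
  | grade0 r =>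
    simp only [AlgHom.commutes, Matrix.algebraMap_matrix_apply]
    simp
  | grade1 x => simp [mat0, lam0, rho0]
  | mul a b ha hb =>
    simp only [map_mul, Matrix.mul_apply, Fin.sum_univ_two, ha.1, ha.2.1, ha.2.2, hb.1, hb.2.1,
      hb.2.2]
    simp
  | add a b ha hb =>
    simp only [map_add, Matrix.add_apply, ha.1, ha.2.1, ha.2.2, hb.1, hb.2.1, hb.2.2]
    simp

theorem mat0_comm (k : Fin d) (a b c e : FreeAlgebra K (Fin d)) :
    mat0 K d k ((a * b - b * a) * (c * e - e * c)) = 0 := by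
  have h1 := mat0_entries K d k (a * b - b * a)
  have h2 := mat0_entries K d k (c * e - e * c)
  have hc : ∀ (φ : FreeAlgebra K (Fin d) →ₐ[K] PolyUV K d) (a b), φ (a * b - b * a) = 0 := by
    intro φ a b
    rw [map_sub, map_mul, map_mul]; ring
  rw [hc, hc] at h1 h2
  rw [map_mul]
  ext1 i j
  rw [Matrix.mul_apply, Fin.sum_univ_two]
  fin_cases i <;> fin_cases j <;> simp [h1.1, h1.2.1, h1.2.2, h2.1, h2.2.1, h2.2.2]

theorem pol_comm (φ : FreeAlgebra K (Fin d) →ₐ[K] PolyUV K d) (a b c e : FreeAlgebra K (Fin d)) :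
    φ ((a * b - b * a) * (c * e - e * c)) = 0 := by
  simp only [map_mul, map_sub]; ring

/-- the matrix representation of `F_d` -/
def matF (k : Fin d) : FreeMetab K d →ₐ[K] Matrix (Fin 2) (Fin 2) (PolyUV K d) :=
  liftM K d (mat0 K d k) (mat0_comm K d k)

/-- `λ` -/
def lamF : FreeMetab K d →ₐ[K] PolyUV K d := liftM K d (lam0 K d) (pol_comm K d _)

/-- `ρ` -/
def rhoF : FreeMetab K d →ₐ[K] PolyUV K d := liftM K d (rho0 K d) (pol_comm K d _)

theorem matF_entries (k : Fin d) (a : FreeMetab K d) :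
    matF K d k a 0 0 = lamF K d a ∧ matF K d k a 1 1 = rhoF K d a := by
  obtain ⟨a, rfl⟩ := RingQuot.mkAlgHom_surjective K (MetabRel K d) a
  rw [matF, lamF, rhoF, liftM_mk, liftM_mk, liftM_mk]
  exact (mat0_entries K d k a).2

/-- the Fox derivation -/
def DF : FreeMetab K d →ₗ[K] (Fin d → PolyUV K d) where
  toFun a k := matF K d k a 0 1
  map_add' a b := by funext k; simp
  map_smul' r a := by funext k; simp

theorem fm_gen : Algebra.adjoin K (Set.range (xg K d)) = ⊤ := by
  rw [eq_top_iff]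
  rintro a -
  obtain ⟨p, rfl⟩ := RingQuot.mkAlgHom_surjective K (MetabRel K d) a
  induction p using FreeAlgebra.induction with
  | grade0 r => rw [AlgHom.commutes]; exact Subalgebra.algebraMap_mem _ r
  | grade1 x => exact Algebra.subset_adjoin ⟨x, rfl⟩
  | mul a b ha hb => rw [map_mul]; exact Subalgebra.mul_mem _ ha hb
  | add a b ha hb => rw [map_add]; exact Subalgebra.add_mem _ ha hb

theorem fm_comm (a b c e : FreeMetab K d) :
    (a * b - b * a) * (c * e - e * c) = 0 := by
  obtain ⟨a, rfl⟩ := RingQuot.mkAlgHom_surjective K (MetabRel K d) a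
  obtain ⟨b, rfl⟩ := RingQuot.mkAlgHom_surjective K (MetabRel K d) b
  obtain ⟨c, rfl⟩ := RingQuot.mkAlgHom_surjective K (MetabRel K d) c
  obtain ⟨e, rfl⟩ := RingQuot.mkAlgHom_surjective K (MetabRel K d) e
  have := RingQuot.mkAlgHom_rel K (s := MetabRel K d)
    (x := (a * b - b * a) * (c * e - e * c)) (y := 0) ⟨rfl, a, b, c, e, rfl⟩
  simpa using this

/-- the free metabelian algebra fits the setting -/
def SF : MD K d (FreeMetab K d) where
  x := xg K d
  comm := fm_comm K d
  gen := fm_gen K d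
  lam := lamF K d
  rho := rhoF K d
  D := DF K d
  lam_x i := by rw [lamF, xg, liftM_mk]; simp [lam0]
  rho_x i := by rw [rhoF, xg, liftM_mk]; simp [rho0]
  D_x i := by
    funext k
    change matF K d k _ 0 1 = _
    rw [matF, xg, liftM_mk]; simp [mat0, Pi.single_apply]
  D_mul a b := by
    funext k
    change matF K d k _ 0 1 = _
    rw [map_mul, Matrix.mul_apply, Fin.sum_univ_two, (matF_entries K d k a).1,
      (matF_entries K d k b).2, mul_comm (matF K d k a 0 1)]
    rfl

theorem degComp_eq (n : ℕ) : degComp K d n = (SF K d).dg n := by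
  rw [degComp, Submodule.map_span, MD.dg]
  congr 1
  ext w
  constructor
  · rintro ⟨_, ⟨l, hl, rfl⟩, rfl⟩
    refine ⟨l, hl, ?_⟩
    rw [AlgHom.toLinearMap_apply, map_list_prod, List.map_map]; rfl
  · rintro ⟨l, hl, rfl⟩
    refine ⟨_, ⟨l, hl, rfl⟩, ?_⟩
    rw [AlgHom.toLinearMap_apply, map_list_prod, List.map_map]; rfl

theorem commIdeal_eq : commIdeal K d = MD.gI (FreeMetab K d) := rfl

variable {K d} in
theorem F_zero [CharZero K] (δ : FreeMetab K d →ₗ[K] FreeMetab K d) :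
    Module.finrank K ((commIdeal K d).restrictScalars K ⊓ LinearMap.ker δ ⊓ degComp K d 0 :
      Submodule K (FreeMetab K d)) = 0 := by
  rw [degComp_eq]
  exact (SF K d).finrank_zero δ

variable {K d} in
theorem F_succ [CharZero K] {δ : FreeMetab K d →ₗ[K] FreeMetab K d}
    {β : Matrix (Fin d) (Fin d) K} {δ' : Derivation K (PolyUV K d) (PolyUV K d)}
    (h1 : ∀ a b, δ (a * b) = δ a * b + a * δ b)
    (h2 : ∀ j, δ (xg K d j) = ∑ i, β i j • xg K d i) (h' : Ind β δ') (n : ℕ) :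
    Module.finrank K ((commIdeal K d).restrictScalars K ⊓ LinearMap.ker δ ⊓ degComp K d (n + 1) :
      Submodule K (FreeMetab K d)) = Module.finrank K (ZK β δ' n) := by
  rw [degComp_eq]
  exact MD.finrank_succ (S := SF K d) ⟨h1, h2⟩ h' n

end Conc
end HSR

namespace HSR

open MvPolynomial

section Gen

theorem exact_finrank {K M M' N : Type*} [Field K] [AddCommGroup M] [Module K M] [AddCommGroup M']
    [Module K M'] [AddCommGroup N] [Module K N] (A : Submodule K M) [FiniteDimensional K A]
    (A' : Submodule K M') (B : Submodule K N) (φ : M →ₗ[K] N) (ι : M' →ₗ[K] M)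
    (hι : Function.Injective ι) (h1 : A.map φ = B) (h2 : A ⊓ LinearMap.ker φ = A'.map ι) :
    Module.finrank K A = Module.finrank K A' + Module.finrank K B := by
  have h := LinearMap.finrank_range_add_finrank_ker (φ.domRestrict A)
  have e1 : LinearMap.range (φ.domRestrict A) = B := by
    rw [← h1]; ext y; simp
  have e2 : Module.finrank K (LinearMap.ker (φ.domRestrict A)) = Module.finrank K A' := by
    have : (LinearMap.ker (φ.domRestrict A)).map A.subtype = A'.map ι := by
      rw [← h2]; ext y; simp [and_comm]
    rw [(Submodule.equivMapOfInjective _ A.subtype_injective _).finrank_eq, this,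
      ← (Submodule.equivMapOfInjective _ hι _).finrank_eq]
  rw [← h, e1, e2, add_comm]

variable {K : Type*} [Field K] {σ τ : Type*}

theorem der_comm (π : MvPolynomial σ K →ₐ[K] MvPolynomial τ K)
    (δ₁ : Derivation K (MvPolynomial σ K) (MvPolynomial σ K))
    (δ₂ : Derivation K (MvPolynomial τ K) (MvPolynomial τ K))
    (h : ∀ s, π (δ₁ (X s)) = δ₂ (π (X s))) (f : MvPolynomial σ K) : π (δ₁ f) = δ₂ (π f) := by
  induction f using MvPolynomial.induction_on with
  | C a => rw [← algebraMap_eq, Derivation.map_algebraMap, AlgHom.commutes,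
      Derivation.map_algebraMap, map_zero]
  | add p q hp hq => simp only [map_add, hp, hq]
  | mul_X p s hp => simp only [Derivation.leibniz, map_add, map_mul, smul_eq_mul, hp, h]

theorem aeval_hom (g : σ → MvPolynomial τ K) (hg : ∀ i, (g i).IsHomogeneous 1) {n : ℕ}
    {f : MvPolynomial σ K} (hf : f.IsHomogeneous n) : (aeval g f).IsHomogeneous n := by
  simpa using hf.aeval g hg

theorem hom_of_X_mul (s : σ) {n : ℕ} {g : MvPolynomial σ K} (h : (X s * g).IsHomogeneous (n + 1)) :
    g.IsHomogeneous n := by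
  intro m hm
  rw [← coeff_X_mul m s] at hm
  have := h hm
  rw [map_add, Finsupp.weight_single] at this
  have h1 : 1 + (Finsupp.weight 1) m = n + 1 := by simpa using this
  omega

theorem eq_C_of_hom_zero {f : MvPolynomial σ K} (hf : f.IsHomogeneous 0) : ∃ c, f = C c := by
  rw [← totalDegree_zero_iff_isHomogeneous, totalDegree_eq_zero_iff_eq_C] at hf
  exact ⟨_, hf⟩

variable [DecidableEq σ]

/-- kill one variable -/
def eps (s : σ) : MvPolynomial σ K →ₐ[K] MvPolynomial σ K :=
  aeval (fun t => if t = s then 0 else X t)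

theorem eps_self (s : σ) : eps s (X s : MvPolynomial σ K) = 0 := by simp [eps]

theorem eps_ne {s t : σ} (h : t ≠ s) : eps s (X t : MvPolynomial σ K) = X t := by simp [eps, h]

theorem eps_hom (s : σ) {n : ℕ} {f : MvPolynomial σ K} (hf : f.IsHomogeneous n) :
    (eps s f).IsHomogeneous n := by
  refine aeval_hom _ (fun i => ?_) hf
  split_ifs
  · exact isHomogeneous_zero _ _ _
  · exact isHomogeneous_X _ _

theorem eps_eps (s : σ) (f : MvPolynomial σ K) : eps s (eps s f) = eps s f := by
  rw [← AlgHom.comp_apply]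
  congr 1
  apply MvPolynomial.algHom_ext
  intro t
  rw [AlgHom.comp_apply]
  by_cases h : t = s
  · subst h; simp [eps_self]
  · simp [eps_ne h]

theorem eps_div (s : σ) (f : MvPolynomial σ K) : ∃ g, f = X s * g + eps s f := by
  induction f using MvPolynomial.induction_on with
  | C a => exact ⟨0, by simp [eps]⟩
  | add p q hp hq =>
    obtain ⟨g, hg⟩ := hp
    obtain ⟨k, hk⟩ := hq
    refine ⟨g + k, ?_⟩
    rw [map_add, mul_add]
    nth_rewrite 1 [hg, hk]
    ring
  | mul_X p t hp =>
    obtain ⟨g, hg⟩ := hp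
    by_cases h : t = s
    · subst h
      exact ⟨p, by rw [map_mul, eps_self]; ring⟩
    · refine ⟨g * X t, ?_⟩
      rw [map_mul, eps_ne h]
      nth_rewrite 1 [hg]
      ring


end Gen
end HSR

namespace HSR

open MvPolynomial

section Rec

variable {K : Type*} [Field K] {d : ℕ}

/-- extension of a matrix by zeros -/
def bex (α : Matrix (Fin d) (Fin d) K) : Matrix (Fin (d + 1)) (Fin (d + 1)) K :=
  fun i j => Fin.lastCases (motive := fun _ => K) 0
    (fun i' => Fin.lastCases (motive := fun _ => K) 0 (fun j' => α i' j') j) i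

@[simp] theorem bex_cs (α : Matrix (Fin d) (Fin d) K) (i j : Fin d) :
    bex α i.castSucc j.castSucc = α i j := by simp [bex]
@[simp] theorem bex_last_left (α : Matrix (Fin d) (Fin d) K) (j : Fin (d + 1)) :
    bex α (Fin.last d) j = 0 := by simp [bex]
@[simp] theorem bex_last_right (α : Matrix (Fin d) (Fin d) K) (i : Fin (d + 1)) :
    bex α i (Fin.last d) = 0 := by
  refine Fin.lastCases ?_ (fun i => ?_) i <;> simp [bex]

/-- the derivation of `K[U,V]` given by a matrix -/
def derM {e : ℕ} (β : Matrix (Fin e) (Fin e) K) : Derivation K (PolyUV K e) (PolyUV K e) :=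
  mkDerivation K (Sum.elim (fun j => ∑ i, β i j • uP K e i) (fun j => ∑ i, β i j • vP K e i))

theorem derM_ind {e : ℕ} (β : Matrix (Fin e) (Fin e) K) : Ind β (derM β) where
  hu j := by simp [derM, uP, mkDerivation_X]
  hv j := by simp [derM, vP, mkDerivation_X]

/-- last u -/
abbrev uL (K : Type*) [Field K] (d : ℕ) : PolyUV K (d + 1) := uP K (d + 1) (Fin.last d)
/-- last v -/
abbrev vL (K : Type*) [Field K] (d : ℕ) : PolyUV K (d + 1) := vP K (d + 1) (Fin.last d)

/-- kill last u -/
abbrev epu (K : Type*) [Field K] (d : ℕ) : PolyUV K (d + 1) →ₐ[K] PolyUV K (d + 1) :=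
  eps (Sum.inl (Fin.last d))
/-- kill last v -/
abbrev epv (K : Type*) [Field K] (d : ℕ) : PolyUV K (d + 1) →ₐ[K] PolyUV K (d + 1) :=
  eps (Sum.inr (Fin.last d))

theorem epu_u (i : Fin d) : epu K d (uP K (d + 1) i.castSucc) = uP K (d + 1) i.castSucc :=
  eps_ne (by simp)
theorem epu_uL : epu K d (uL K d) = 0 := eps_self _
theorem epu_v (i : Fin (d + 1)) : epu K d (vP K (d + 1) i) = vP K (d + 1) i :=
  eps_ne (by simp)
theorem epv_v (i : Fin d) : epv K d (vP K (d + 1) i.castSucc) = vP K (d + 1) i.castSucc :=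
  eps_ne (by simp)
theorem epv_vL : epv K d (vL K d) = 0 := eps_self _
theorem epv_u (i : Fin (d + 1)) : epv K d (uP K (d + 1) i) = uP K (d + 1) i :=
  eps_ne (by simp)

/-- kill both -/
def pr (K : Type*) [Field K] (d : ℕ) : PolyUV K (d + 1) →ₐ[K] PolyUV K d :=
  aeval (Sum.elim (fun i => Fin.lastCases (motive := fun _ => PolyUV K d) 0 (uP K d) i)
    (fun i => Fin.lastCases (motive := fun _ => PolyUV K d) 0 (vP K d) i))

/-- embed -/
def em (K : Type*) [Field K] (d : ℕ) : PolyUV K d →ₐ[K] PolyUV K (d + 1) :=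
  aeval (Sum.elim (fun i => uP K (d + 1) i.castSucc) (fun i => vP K (d + 1) i.castSucc))

@[simp] theorem pr_u (i : Fin d) : pr K d (uP K (d + 1) i.castSucc) = uP K d i := by
  simp [pr, uP]
@[simp] theorem pr_v (i : Fin d) : pr K d (vP K (d + 1) i.castSucc) = vP K d i := by
  simp [pr, vP]
@[simp] theorem pr_uL : pr K d (uP K (d + 1) (Fin.last d)) = 0 := by
  simp [pr, uP]
@[simp] theorem pr_vL : pr K d (vP K (d + 1) (Fin.last d)) = 0 := by
  simp [pr, vP]
@[simp] theorem em_u (i : Fin d) : em K d (uP K d i) = uP K (d + 1) i.castSucc := by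
  simp [em, uP]
@[simp] theorem em_v (i : Fin d) : em K d (vP K d i) = vP K (d + 1) i.castSucc := by
  simp [em, vP]

theorem alg_ext {e : ℕ} {A : Type*} [CommRing A] [Algebra K A] {φ ψ : PolyUV K e →ₐ[K] A}
    (hu : ∀ i, φ (uP K e i) = ψ (uP K e i)) (hv : ∀ i, φ (vP K e i) = ψ (vP K e i))
    (f : PolyUV K e) : φ f = ψ f := by
  have : φ = ψ := by
    apply MvPolynomial.algHom_ext
    rintro (i | i)
    · exact hu i
    · exact hv i
  rw [this]

theorem pr_em (f : PolyUV K d) : pr K d (em K d f) = f :=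
  alg_ext (φ := (pr K d).comp (em K d)) (ψ := AlgHom.id K _) (by simp) (by simp) f

theorem epu_em (f : PolyUV K d) : epu K d (em K d f) = em K d f :=
  alg_ext (φ := (epu K d).comp (em K d)) (ψ := em K d) (by simp [epu_u]) (by simp [epu_v]) f

theorem em_pr (f : PolyUV K (d + 1)) : em K d (pr K d f) = epv K d (epu K d f) := by
  refine alg_ext (φ := (em K d).comp (pr K d)) (ψ := (epv K d).comp (epu K d)) (fun i => ?_)
    (fun i => ?_) f
  · refine Fin.lastCases ?_ (fun i => ?_) i
    · simp [epu_uL]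
    · simp [epu_u, epv_u]
  · refine Fin.lastCases ?_ (fun i => ?_) i
    · simp [epu_v, epv_vL]
    · simp [epu_v, epv_v]

theorem pr_epv (f : PolyUV K (d + 1)) : pr K d (epv K d f) = pr K d f := by
  refine alg_ext (φ := (pr K d).comp (epv K d)) (ψ := pr K d) (by simp [epv_u]) (fun i => ?_) f
  refine Fin.lastCases ?_ (fun i => ?_) i
  · simp [epv_vL]
  · simp [epv_v]

theorem pr_hom {n : ℕ} {f : PolyUV K (d + 1)} (hf : f.IsHomogeneous n) :
    (pr K d f).IsHomogeneous n := by
  refine aeval_hom _ ?_ hf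
  rintro (i | i) <;> refine Fin.lastCases ?_ (fun i => ?_) i
  · simpa using isHomogeneous_zero _ _ _
  · simp only [Sum.elim_inl, Fin.lastCases_castSucc]; exact isHomogeneous_X _ _
  · simpa using isHomogeneous_zero _ _ _
  · simp only [Sum.elim_inr, Fin.lastCases_castSucc]; exact isHomogeneous_X _ _

theorem em_hom {n : ℕ} {f : PolyUV K d} (hf : f.IsHomogeneous n) :
    (em K d f).IsHomogeneous n := by
  refine aeval_hom _ ?_ hf
  rintro (i | i)
  · exact isHomogeneous_X _ _
  · exact isHomogeneous_X _ _

section der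
variable (α : Matrix (Fin d) (Fin d) K)

/-- the derivation upstairs -/
abbrev dB : Derivation K (PolyUV K (d + 1)) (PolyUV K (d + 1)) := derM (bex α)

theorem dB_u (j : Fin d) : dB α (uP K (d + 1) j.castSucc) = ∑ i, α i j • uP K (d + 1) i.castSucc := by
  rw [(derM_ind _).hu, Fin.sum_univ_castSucc]; simp
theorem dB_v (j : Fin d) : dB α (vP K (d + 1) j.castSucc) = ∑ i, α i j • vP K (d + 1) i.castSucc := by
  rw [(derM_ind _).hv, Fin.sum_univ_castSucc]; simp
theorem dB_uL : dB α (uL K d) = 0 := by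
  rw [(derM_ind _).hu]; simp
theorem dB_vL : dB α (vL K d) = 0 := by
  rw [(derM_ind _).hv]; simp

theorem epu_dB (f : PolyUV K (d + 1)) : epu K d (dB α f) = dB α (epu K d f) := by
  refine der_comm _ _ _ ?_ f
  rintro (i | i)
  · change epu K d (dB α (uP K (d + 1) i)) = dB α (epu K d (uP K (d + 1) i))
    refine Fin.lastCases ?_ (fun i => ?_) i
    · rw [dB_uL, epu_uL, map_zero, map_zero]
    · rw [epu_u, dB_u]; simp [epu_u]
  · change epu K d (dB α (vP K (d + 1) i)) = dB α (epu K d (vP K (d + 1) i))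
    rw [epu_v, (derM_ind _).hv]; simp [epu_v]

variable {α} {δ' : Derivation K (PolyUV K d) (PolyUV K d)}

theorem pr_dB (h : Ind α δ') (f : PolyUV K (d + 1)) : pr K d (dB α f) = δ' (pr K d f) := by
  refine der_comm _ _ _ ?_ f
  rintro (i | i)
  · change pr K d (dB α (uP K (d + 1) i)) = δ' (pr K d (uP K (d + 1) i))
    refine Fin.lastCases ?_ (fun i => ?_) i
    · rw [dB_uL, pr_uL, map_zero, map_zero]
    · rw [pr_u, dB_u, h.hu]; simp
  · change pr K d (dB α (vP K (d + 1) i)) = δ' (pr K d (vP K (d + 1) i))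
    refine Fin.lastCases ?_ (fun i => ?_) i
    · rw [dB_vL, pr_vL, map_zero, map_zero]
    · rw [pr_v, dB_v, h.hv]; simp

theorem em_d (h : Ind α δ') (f : PolyUV K d) : em K d (δ' f) = dB α (em K d f) := by
  refine der_comm _ _ _ ?_ f
  rintro (i | i)
  · change em K d (δ' (uP K d i)) = dB α (em K d (uP K d i))
    rw [em_u, dB_u, h.hu]; simp
  · change em K d (δ' (vP K d i)) = dB α (em K d (vP K d i))
    rw [em_v, dB_v, h.hv]; simp

end der

/-- T -/
abbrev TZ (α : Matrix (Fin d) (Fin d) K) (n : ℕ) : Submodule K (Fin (d + 1) → PolyUV K (d + 1)) :=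
  ZK (bex α) (dB α) n

theorem mem_TZ {α : Matrix (Fin d) (Fin d) K} {n : ℕ} {f : Fin (d + 1) → PolyUV K (d + 1)} :
    f ∈ TZ α n ↔
    (∑ i : Fin d, vP K (d + 1) i.castSucc * f i.castSucc) + vL K d * f (Fin.last d) = 0 ∧
    ((∀ i : Fin d, dB α (f i.castSucc) + ∑ j, α i j • f (Fin.castSucc j) = 0) ∧
      dB α (f (Fin.last d)) = 0) ∧
    ∀ i, (f i).IsHomogeneous n := by
  rw [mem_ZK, Fin.sum_univ_castSucc, Fin.forall_fin_succ']
  simp [Fin.sum_univ_castSucc]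

/-- componentwise application -/
def cw (φ : PolyUV K (d + 1) →ₗ[K] PolyUV K (d + 1)) :
    (Fin (d + 1) → PolyUV K (d + 1)) →ₗ[K] (Fin (d + 1) → PolyUV K (d + 1)) :=
  LinearMap.pi fun i => φ.comp (LinearMap.proj i)

theorem cw_apply (φ : PolyUV K (d + 1) →ₗ[K] PolyUV K (d + 1)) (f) (i) : cw φ f i = φ (f i) := rfl

/-- S -/
def SZ (α : Matrix (Fin d) (Fin d) K) (n : ℕ) : Submodule K (Fin (d + 1) → PolyUV K (d + 1)) :=
  TZ α n ⊓ LinearMap.ker (cw ((epu K d).toLinearMap - LinearMap.id))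

theorem mem_SZ {α : Matrix (Fin d) (Fin d) K} {n : ℕ} {f : Fin (d + 1) → PolyUV K (d + 1)} :
    f ∈ SZ α n ↔ f ∈ TZ α n ∧ ∀ i, epu K d (f i) = f i := by
  rw [SZ, Submodule.mem_inf, LinearMap.mem_ker, funext_iff]
  refine and_congr_right fun _ => forall_congr' fun i => ?_
  rw [cw_apply, LinearMap.sub_apply]
  exact sub_eq_zero

instance (α : Matrix (Fin d) (Fin d) K) (n : ℕ) : FiniteDimensional K (TZ α n) :=
  finite_of_hom _ (fun _ hf => hf.2.2)

instance (α : Matrix (Fin d) (Fin d) K) (n : ℕ) : FiniteDimensional K (SZ α n) :=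
  finite_of_hom _ (fun _ hf => hf.1.2.2)

theorem TZ_zero (α : Matrix (Fin d) (Fin d) K) : TZ α 0 = SZ α 0 := by
  ext f
  rw [mem_SZ]
  refine ⟨fun h => ⟨h, fun i => ?_⟩, fun h => h.1⟩
  obtain ⟨c, hc⟩ := eq_C_of_hom_zero (h.2.2 i)
  rw [hc, ← algebraMap_eq, AlgHom.commutes]

theorem mul_inj (q : PolyUV K (d + 1)) (hq : q ≠ 0) :
    Function.Injective (cw (LinearMap.mulLeft K q)) := by
  intro f g h
  funext i
  exact mul_left_cancel₀ hq (congrFun h i)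

theorem epu_TZ {α : Matrix (Fin d) (Fin d) K} {n : ℕ} {f : Fin (d + 1) → PolyUV K (d + 1)}
    (hf : f ∈ TZ α n) : cw (epu K d).toLinearMap f ∈ TZ α n := by
  rw [mem_TZ] at hf ⊢
  obtain ⟨h1, ⟨h2, h3⟩, h4⟩ := hf
  refine ⟨?_, ⟨fun i => ?_, ?_⟩, fun i => eps_hom _ (h4 i)⟩
  · have := congrArg (epu K d) h1
    simpa [epu_v, cw_apply] using this
  · have := congrArg (epu K d) (h2 i)
    simpa [cw_apply, epu_dB] using this
  · have := congrArg (epu K d) h3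
    simpa [cw_apply, epu_dB] using this

theorem mul_TZ {α : Matrix (Fin d) (Fin d) K} {n : ℕ} {q : PolyUV K (d + 1)} (hq : q ≠ 0)
    (hd : dB α q = 0) {f : Fin (d + 1) → PolyUV K (d + 1)} :
    (((∑ i : Fin d, vP K (d + 1) i.castSucc * (q * f i.castSucc)) + vL K d * (q * f (Fin.last d)) = 0 ∧
    ((∀ i : Fin d, dB α (q * f i.castSucc) + ∑ j, α i j • (q * f (Fin.castSucc j)) = 0) ∧
      dB α (q * f (Fin.last d)) = 0) ∧
    ∀ i, (f i).IsHomogeneous n)) ↔ f ∈ TZ α n := by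
  have hδ : ∀ g, dB α (q * g) = q * dB α g := fun g => by
    rw [Derivation.leibniz, hd]; simp
  have h1 : (∑ i : Fin d, vP K (d + 1) i.castSucc * (q * f i.castSucc))
      + vL K d * (q * f (Fin.last d))
      = q * ((∑ i : Fin d, vP K (d + 1) i.castSucc * f i.castSucc) + vL K d * f (Fin.last d)) := by
    rw [mul_add, Finset.mul_sum]
    congr 1
    · exact Finset.sum_congr rfl fun i _ => by ring
    · ring
  have h2 : ∀ i : Fin d, dB α (q * f i.castSucc) + ∑ j, α i j • (q * f (Fin.castSucc j))
      = q * (dB α (f i.castSucc) + ∑ j, α i j • (f (Fin.castSucc j))) := by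
    intro i
    rw [hδ, mul_add, Finset.mul_sum]
    simp
  rw [mem_TZ, h1, hδ]
  simp only [h2, mul_eq_zero, hq, false_or]

theorem T_rec (α : Matrix (Fin d) (Fin d) K) (n : ℕ) :
    Module.finrank K (TZ α (n + 1)) = Module.finrank K (TZ α n) + Module.finrank K (SZ α (n + 1)) := by
  have hq : uL K d ≠ 0 := X_ne_zero _
  refine exact_finrank _ _ _ (cw (epu K d).toLinearMap) (cw (LinearMap.mulLeft K (uL K d)))
    (mul_inj _ hq) ?_ ?_
  · ext f
    rw [mem_SZ]
    constructor
    · rintro ⟨g, hg, rfl⟩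
      exact ⟨epu_TZ hg, fun i => eps_eps _ _⟩
    · rintro ⟨h1, h2⟩
      exact ⟨f, h1, funext h2⟩
  · ext f
    constructor
    · rintro ⟨h1, h2⟩
      have h2' : ∀ i, epu K d (f i) = 0 := fun i => congrFun h2 i
      choose g hg using fun i => eps_div (Sum.inl (Fin.last d)) (f i)
      have hg' : ∀ i, f i = uL K d * g i := fun i => by
        have := hg i
        rw [h2', add_zero] at this
        exact this
      have hfg : f = cw (LinearMap.mulLeft K (uL K d)) g := funext hg'
      refine ⟨g, ?_, hfg.symm⟩
      have h1' := mem_TZ.mp h1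
      simp only [hg'] at h1'
      exact (mul_TZ hq (dB_uL α)).mp ⟨h1'.1, h1'.2.1, fun i => hom_of_X_mul _ (h1'.2.2 i)⟩
    · rintro ⟨g, hg, rfl⟩
      have := (mul_TZ hq (dB_uL α)).mpr hg
      refine ⟨mem_TZ.mpr ⟨this.1, this.2.1, fun i => ?_⟩, ?_⟩
      · rw [add_comm n 1]
        exact (isHomogeneous_X _ _).mul (this.2.2 i)
      · funext i
        change epu K d (uL K d * g i) = 0
        rw [map_mul, epu_uL, zero_mul]

/-- ω-part -/
abbrev OM (δ' : Derivation K (PolyUV K d) (PolyUV K d)) (n : ℕ) : Submodule K (PolyUV K d) :=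
  omegaUV K d ⊓ LinearMap.ker δ'.toLinearMap ⊓ homogeneousSubmodule (Fin d ⊕ Fin d) K n

/-- restriction map -/
def kap (K : Type*) [Field K] (d : ℕ) : (Fin (d + 1) → PolyUV K (d + 1)) →ₗ[K]
    (Fin d → PolyUV K d) × PolyUV K d :=
  LinearMap.prod (LinearMap.pi fun i => (pr K d).toLinearMap.comp (LinearMap.proj i.castSucc))
    ((pr K d).toLinearMap.comp (LinearMap.proj (Fin.last d)))

theorem kap_apply (f : Fin (d + 1) → PolyUV K (d + 1)) :
    kap K d f = (fun i => pr K d (f i.castSucc), pr K d (f (Fin.last d))) := rfl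

theorem kap_map [CharZero K] {α : Matrix (Fin d) (Fin d) K}
    {δ' : Derivation K (PolyUV K d) (PolyUV K d)} (h : Ind α δ') (n : ℕ) :
    (SZ α n).map (kap K d) = (ZK α δ' n).prod (OM δ' n) := by
  have hq : vL K d ≠ 0 := X_ne_zero _
  ext ⟨z, w⟩
  rw [Submodule.mem_prod]
  constructor
  · rintro ⟨f, hf, hfz⟩
    obtain ⟨hf, hu⟩ := mem_SZ.mp hf
    obtain ⟨h1, ⟨h2, h3⟩, h4⟩ := mem_TZ.mp hf
    rw [kap_apply, Prod.mk.injEq] at hfz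
    obtain ⟨rfl, rfl⟩ := hfz
    refine ⟨mem_ZK.mpr ⟨?_, fun i => ?_, fun i => pr_hom (h4 _)⟩, ⟨?_, ?_⟩, pr_hom (h4 _)⟩
    · have := congrArg (pr K d) h1
      simpa using this
    · have := congrArg (pr K d) (h2 i)
      simpa [pr_dB h] using this
    · choose g hg using fun i => eps_div (Sum.inr (Fin.last d)) (f i)
      have e1 := congrArg (epv K d) h1
      simp only [map_add, map_sum, map_mul, epv_v, epv_vL, zero_mul, add_zero, map_zero] at e1
      have e2 : vL K d * (f (Fin.last d) + ∑ i : Fin d, vP K (d + 1) i.castSucc * g i.castSucc)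
          = 0 := by
        rw [← h1, mul_add, Finset.mul_sum, add_comm (vL K d * _)]
        congr 1
        rw [← sub_zero (∑ i : Fin d, vP K (d + 1) i.castSucc * f i.castSucc), ← e1,
          ← Finset.sum_sub_distrib]
        refine Finset.sum_congr rfl fun i _ => ?_
        have e : f i.castSucc = vL K d * g i.castSucc + epv K d (f i.castSucc) := hg i.castSucc
        linear_combination (-vP K (d + 1) i.castSucc) * e
      have e3 := (mul_eq_zero.mp e2).resolve_left hq
      rw [eq_neg_of_add_eq_zero_left e3]
      simp only [map_neg, map_sum, map_mul, pr_v]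
      exact Submodule.neg_mem _ (Submodule.sum_mem _ fun i _ => vP_mul_mem _ _)
    · change δ' (pr K d (f (Fin.last d))) = 0
      rw [← pr_dB h, h3, map_zero]
  · rintro ⟨hz, ⟨hw, hw2⟩, hw3⟩
    replace hz : z ∈ ZK α δ' n := hz
    replace hw : w ∈ omegaUV K d := hw
    obtain ⟨h1, h2, h3⟩ := mem_ZK.mp hz
    have hw2 : δ' w = 0 := hw2
    have hw3 : w.IsHomogeneous n := hw3
    let f : Fin (d + 1) → PolyUV K (d + 1) := fun i =>
      Fin.lastCases (motive := fun _ => PolyUV K (d + 1)) (em K d w)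
        (fun i => em K d (z i) - vL K d * em K d (JJ K d (dv i w))) i
    have fL : f (Fin.last d) = em K d w := by simp [f]
    have fc : ∀ i : Fin d, f i.castSucc = em K d (z i) - vL K d * em K d (JJ K d (dv i w)) :=
      fun i => by simp [f]
    have hδ : ∀ g, dB α (vL K d * g) = vL K d * dB α g := fun g => by
      rw [Derivation.leibniz, dB_vL]; simp
    refine ⟨f, mem_SZ.mpr ⟨mem_TZ.mpr ⟨?_, ⟨fun i => ?_, ?_⟩, fun i => ?_⟩, fun i => ?_⟩, ?_⟩
    · simp only [fL, fc, mul_sub, Finset.sum_sub_distrib]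
      have e1 : ∑ i : Fin d, vP K (d + 1) i.castSucc * em K d (z i) = 0 := by
        have := congrArg (em K d) h1
        simpa using this
      have e2 : ∑ i : Fin d, vP K (d + 1) i.castSucc * (vL K d * em K d (JJ K d (dv i w)))
          = vL K d * em K d w := by
        nth_rewrite 2 [← JP_EE hw]
        rw [EE, map_sum, map_sum, Finset.mul_sum]
        refine Finset.sum_congr rfl fun i _ => ?_
        rw [← vP_JJ, map_mul, em_v]; ring
      rw [e1, e2]; ring
    · simp only [fc, map_sub, hδ, ← em_d h, comm_JJ h, comm_dv h, hw2, map_zero, zero_sub,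
        map_neg, map_sum, map_smul, smul_sub, Finset.sum_sub_distrib]
      have e1 := congrArg (em K d) (h2 i)
      simp only [map_add, map_sum, map_smul, map_zero] at e1
      have e2 : ∑ x, α i x • (vL K d * em K d (JJ K d (dv x w)))
        = vL K d * ∑ x, α i x • em K d (JJ K d (dv x w)) := by
        rw [Finset.mul_sum]; simp
      rw [e2, eq_neg_of_add_eq_zero_left e1]; ring
    · rw [fL, ← em_d h, hw2, map_zero]
    · refine Fin.lastCases ?_ (fun i => ?_) i
      · rw [fL]; exact em_hom hw3
      · rw [fc]
        refine (em_hom (h3 i)).sub ?_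
        cases n with
        | zero => rw [MD.dv_hom_zero hw3]; simpa using isHomogeneous_zero _ _ _
        | succ n =>
          rw [add_comm n 1]
          exact (isHomogeneous_X _ _).mul (em_hom (Wt_hom _ (MD.dv_hom hw3 i)))
    · refine Fin.lastCases ?_ (fun i => ?_) i
      · rw [fL, epu_em]
      · rw [fc, map_sub, map_mul, epu_v, epu_em, epu_em]
    · rw [kap_apply, fL, pr_em]
      congr 1
      funext i
      rw [fc, map_sub, map_mul, pr_vL, pr_em]; simp

theorem finrank_prod' {α : Matrix (Fin d) (Fin d) K}
    {δ' : Derivation K (PolyUV K d) (PolyUV K d)} (n : ℕ) :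
    Module.finrank K ((ZK α δ' n).prod (OM δ' n))
      = Module.finrank K (ZK α δ' n) + Module.finrank K (OM δ' n) := by
  have : Module.Finite K (homogeneousSubmodule (Fin d ⊕ Fin d) K n) :=
    Module.Finite.iff_fg.mpr (homogeneousSubmodule_fg _ _ n)
  have : FiniteDimensional K (ZK α δ' n) := finite_of_hom _ (fun _ hf => hf.2.2)
  have : FiniteDimensional K (OM δ' n) := Submodule.finiteDimensional_of_le inf_le_right
  let e : ((ZK α δ' n).prod (OM δ' n)) ≃ₗ[K] (ZK α δ' n) × (OM δ' n) :=
    { toFun := fun x => (⟨x.1.1, x.2.1⟩, ⟨x.1.2, x.2.2⟩)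
      invFun := fun y => ⟨(y.1.1, y.2.1), y.1.2, y.2.2⟩
      map_add' := fun _ _ => rfl
      map_smul' := fun _ _ => rfl
      left_inv := fun _ => rfl
      right_inv := fun _ => rfl }
  rw [e.finrank_eq, Module.finrank_prod]

theorem S_zero [CharZero K] {α : Matrix (Fin d) (Fin d) K}
    {δ' : Derivation K (PolyUV K d) (PolyUV K d)} (h : Ind α δ') :
    Module.finrank K (SZ α 0) = Module.finrank K (ZK α δ' 0) + Module.finrank K (OM δ' 0) := by
  rw [← finrank_prod']
  have := exact_finrank (SZ α 0) (⊥ : Submodule K (Fin (d + 1) → PolyUV K (d + 1))) _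
    (kap K d) LinearMap.id (fun _ _ h => h) (kap_map h 0) (by
      rw [Submodule.map_id, eq_bot_iff]
      rintro f ⟨hf, hk⟩
      have hf' : f ∈ SZ α 0 := hf
      have h4 := (mem_TZ.mp (mem_SZ.mp hf').1).2.2
      have hk' : kap K d f = 0 := hk
      rw [kap_apply, Prod.mk_eq_zero] at hk'
      have hp : ∀ i, pr K d (f i) = 0 := fun i =>
        Fin.lastCases hk'.2 (fun i => congrFun hk'.1 i) i
      refine funext fun i => ?_
      obtain ⟨c, hc⟩ := eq_C_of_hom_zero (h4 i)
      have := hp i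
      rw [hc, ← algebraMap_eq, AlgHom.commutes, algebraMap_eq, C_eq_zero] at this
      rw [hc, this, map_zero]; rfl)
  rw [this, finrank_bot, zero_add]

theorem S_rec [CharZero K] {α : Matrix (Fin d) (Fin d) K}
    {δ' : Derivation K (PolyUV K d) (PolyUV K d)} (h : Ind α δ') (n : ℕ) :
    Module.finrank K (SZ α (n + 1)) = Module.finrank K (SZ α n)
      + (Module.finrank K (ZK α δ' (n + 1)) + Module.finrank K (OM δ' (n + 1))) := by
  have hq : vL K d ≠ 0 := X_ne_zero _
  rw [← finrank_prod']
  refine exact_finrank _ _ _ (kap K d) (cw (LinearMap.mulLeft K (vL K d)))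
    (mul_inj _ hq) (kap_map h (n + 1)) ?_
  ext f
  constructor
  · rintro ⟨h1, hk⟩
    have hk' : kap K d f = 0 := hk
    rw [kap_apply, Prod.mk_eq_zero] at hk'
    have hp : ∀ i, pr K d (f i) = 0 := fun i =>
      Fin.lastCases hk'.2 (fun i => congrFun hk'.1 i) i
    obtain ⟨h1, hu⟩ := mem_SZ.mp h1
    have h2' : ∀ i, epv K d (f i) = 0 := fun i => by
      rw [← hu i, ← em_pr, hp, map_zero]
    choose g hg using fun i => eps_div (Sum.inr (Fin.last d)) (f i)
    have hg' : ∀ i, f i = vL K d * g i := fun i => by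
      have := hg i
      rw [h2', add_zero] at this
      exact this
    have hfg : f = cw (LinearMap.mulLeft K (vL K d)) g := funext hg'
    refine ⟨g, mem_SZ.mpr ⟨?_, fun i => ?_⟩, hfg.symm⟩
    · have h1' := mem_TZ.mp h1
      simp only [hg'] at h1'
      exact (mul_TZ hq (dB_vL α)).mp ⟨h1'.1, h1'.2.1, fun i => hom_of_X_mul _ (h1'.2.2 i)⟩
    · have := hu i
      rw [hg', map_mul, epu_v] at this
      exact mul_left_cancel₀ hq this
  · rintro ⟨g, hg, rfl⟩
    obtain ⟨hg, hu⟩ := mem_SZ.mp hg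
    have := (mul_TZ hq (dB_vL α)).mpr hg
    refine ⟨mem_SZ.mpr ⟨mem_TZ.mpr ⟨this.1, this.2.1, fun i => ?_⟩, fun i => ?_⟩, ?_⟩
    · rw [add_comm n 1]
      exact (isHomogeneous_X _ _).mul (this.2.2 i)
    · change epu K d (vL K d * g i) = vL K d * g i
      rw [map_mul, epu_v, hu]
    · change kap K d _ = 0
      rw [kap_apply, Prod.mk_eq_zero]
      refine ⟨funext fun i => ?_, ?_⟩
      · change pr K d (vL K d * g i.castSucc) = 0
        rw [map_mul, pr_vL, zero_mul]
      · change pr K d (vL K d * g (Fin.last d)) = 0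
        rw [map_mul, pr_vL, zero_mul]

end Rec
end HSR

/-- If the Weitzenböck derivation `δ` of `F_{d+1}` satisfies `δ(x_{d+1}) = 0`
and maps the span of `x_1,…,x_d` nilpotently into itself, then
`H((F_{d+1}')^δ, z) = (1-z)⁻² (H((F_d')^δ, z) + z·H(K[U_d,V_d]_ω^δ, z))`. -/
theorem hilbert_series_reduction
    (K : Type*) [Field K] [CharZero K] (d : ℕ) (hd : 1 ≤ d)
    (α : Matrix (Fin d) (Fin d) K) (hnil : IsNilpotent α) (hne : α ≠ 0)
    (δB : FreeMetab K (d + 1) →ₗ[K] FreeMetab K (d + 1))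
    (hleibB : ∀ a b : FreeMetab K (d + 1), δB (a * b) = δB a * b + a * δB b)
    (hδBx : ∀ j : Fin d, δB (xg K (d + 1) j.castSucc)
      = ∑ i : Fin d, α i j • xg K (d + 1) i.castSucc)
    (hδBlast : δB (xg K (d + 1) (Fin.last d)) = 0)
    (δS : FreeMetab K d →ₗ[K] FreeMetab K d)
    (hleibS : ∀ a b : FreeMetab K d, δS (a * b) = δS a * b + a * δS b)
    (hδSx : ∀ j, δS (xg K d j) = ∑ i, α i j • xg K d i)
    (δ' : Derivation K (PolyUV K d) (PolyUV K d))
    (hu : ∀ j, δ' (uP K d j) = ∑ i, α i j • uP K d i)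
    (hv : ∀ j, δ' (vP K d j) = ∑ i, α i j • vP K d i) :
    ((1 - PowerSeries.X : PowerSeries ℤ)) ^ 2 *
        (PowerSeries.mk fun n => (Module.finrank K
          (((commIdeal K (d + 1)).restrictScalars K ⊓ LinearMap.ker δB
            ⊓ degComp K (d + 1) n : Submodule K (FreeMetab K (d + 1)))) : ℤ))
      = (PowerSeries.mk fun n => (Module.finrank K
          (((commIdeal K d).restrictScalars K ⊓ LinearMap.ker δS
            ⊓ degComp K d n : Submodule K (FreeMetab K d))) : ℤ))
        + PowerSeries.X *
          (PowerSeries.mk fun n => (Module.finrank K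
            ((omegaUV K d ⊓ LinearMap.ker δ'.toLinearMap
              ⊓ MvPolynomial.homogeneousSubmodule (Fin d ⊕ Fin d) K n :
                Submodule K (PolyUV K d))) : ℤ)) := by
  have h' : HSR.Ind α δ' := ⟨hu, hv⟩
  have hB : ∀ j, δB (xg K (d + 1) j) = ∑ i, HSR.bex α i j • xg K (d + 1) i := by
    intro j
    rw [Fin.sum_univ_castSucc]
    refine Fin.lastCases ?_ (fun j => ?_) j
    · rw [hδBlast]; simp
    · rw [hδBx]; simp
  have eB := HSR.F_succ hleibB hB (HSR.derM_ind (HSR.bex α))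
  have eS := HSR.F_succ hleibS hδSx h'
  set fB : ℕ → ℤ := fun n => (Module.finrank K
          (((commIdeal K (d + 1)).restrictScalars K ⊓ LinearMap.ker δB
            ⊓ degComp K (d + 1) n : Submodule K (FreeMetab K (d + 1)))) : ℤ) with hfB
  set fS : ℕ → ℤ := fun n => (Module.finrank K
          (((commIdeal K d).restrictScalars K ⊓ LinearMap.ker δS
            ⊓ degComp K d n : Submodule K (FreeMetab K d))) : ℤ) with hfS
  set fO : ℕ → ℤ := fun n => (Module.finrank K
            ((omegaUV K d ⊓ LinearMap.ker δ'.toLinearMap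
              ⊓ MvPolynomial.homogeneousSubmodule (Fin d ⊕ Fin d) K n :
                Submodule K (PolyUV K d))) : ℤ) with hfO
  have b0 : fB 0 = 0 := (congrArg (Nat.cast : ℕ → ℤ) (HSR.F_zero δB)).trans Nat.cast_zero
  have s0 : fS 0 = 0 := (congrArg (Nat.cast : ℕ → ℤ) (HSR.F_zero δS)).trans Nat.cast_zero
  have b1 : ∀ n, fB (n + 1) = (Module.finrank K (HSR.TZ α n) : ℤ) := fun n =>
    congrArg (Nat.cast : ℕ → ℤ) (eB n)
  have s1 : ∀ n, fS (n + 1) = (Module.finrank K (HSR.ZK α δ' n) : ℤ) := fun n =>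
    congrArg (Nat.cast : ℕ → ℤ) (eS n)
  have o1 : ∀ n, fO n = (Module.finrank K (HSR.OM δ' n) : ℤ) := fun n => rfl
  clear_value fB fS fO
  have t1 : (1 - PowerSeries.X : PowerSeries ℤ) * PowerSeries.mk fB
      = PowerSeries.X * PowerSeries.mk (fun n => (Module.finrank K (HSR.SZ α n) : ℤ)) := by
    ext n
    rw [sub_mul, one_mul, map_sub]
    cases n with
    | zero => simp [b0]
    | succ n =>
      rw [PowerSeries.coeff_succ_X_mul, PowerSeries.coeff_succ_X_mul]
      simp only [PowerSeries.coeff_mk]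
      cases n with
      | zero => rw [b0, b1, HSR.TZ_zero]; ring
      | succ n => rw [b1, b1, HSR.T_rec]; push_cast; ring
  have t2 : (1 - PowerSeries.X : PowerSeries ℤ)
      * (PowerSeries.X * PowerSeries.mk (fun n => (Module.finrank K (HSR.SZ α n) : ℤ)))
      = PowerSeries.mk fS + PowerSeries.X * PowerSeries.mk fO := by
    ext n
    rw [sub_mul, one_mul, map_sub, map_add]
    cases n with
    | zero => simp [s0]
    | succ n =>
      rw [PowerSeries.coeff_succ_X_mul, PowerSeries.coeff_succ_X_mul, PowerSeries.coeff_succ_X_mul]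
      cases n with
      | zero => simp [s1, o1, HSR.S_zero h']
      | succ n =>
        rw [PowerSeries.coeff_succ_X_mul]
        simp only [PowerSeries.coeff_mk]
        rw [s1, o1, HSR.S_rec h']; push_cast; ring
  rw [sq, mul_assoc, t1, t2]
end
end

section
/- Assume δ(x_d) = 0 and δ maps span(x_1,…,x_{d−1}) into itself, acting there as a nilpotent linear operator, with the corresponding action on K[U_d,V_d] (so δ(u_d) = δ(v_d) = 0). Let {d_i : i ∈ I} be a K-vector space basis of (F_{d−1}')^δ and {g_j : j ∈ J} a K-vector space basis of K[U_{d−1},V_{d−1}]_ω^δ, both consisting of elements homogeneous with respect to both the total-degree ℤ-grading and the ℤ²-grading. Then the set { d_i·u_d^m v_d^n, π(g_j)·u_d^m v_d^n : i ∈ I, j ∈ J, m,n ≥ 0 } is a K-vector space basis of (F_d')^δ. -/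
noncomputable section

/-- The metabelian relation on the free associative algebra on an index set `ι`. -/
def MetabRelI (K : Type*) [CommRing K] (ι : Type*) (x y : FreeAlgebra K ι) : Prop :=
  y = 0 ∧ ∃ a b c e : FreeAlgebra K ι, x = (a * b - b * a) * (c * e - e * c)

/-- The free metabelian associative algebra on the index set `ι`. -/
abbrev FMet (K : Type*) [CommRing K] (ι : Type*) := RingQuot (MetabRelI K ι)

/-- The free generators. -/
def xI (K : Type*) [CommRing K] (ι : Type*) (i : ι) : FMet K ι :=
  RingQuot.mkAlgHom K (MetabRelI K ι) (FreeAlgebra.ι K i)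

/-- The commutator ideal. -/
def commIdealI (K : Type*) [CommRing K] (ι : Type*) : Ideal (FMet K ι) :=
  Ideal.span {z | ∃ a f g b : FMet K ι, z = a * (f * g - g * f) * b}

/-- action of a monomial of `K[U,V]` (`inl = u`-variables, `inr = v`-variables),
implementing `f·u_i = x_i f`, `f·v_i = [f,x_i]`. -/
def monActI (K : Type*) [CommRing K] (ι : Type*) [Fintype ι] [DecidableEq ι]
    (m : (ι ⊕ ι) →₀ ℕ) : Module.End K (FMet K ι) :=
  ((Finset.univ : Finset ι).toList.map fun i =>
      (LinearMap.mulLeft K (xI K ι i) : Module.End K (FMet K ι)) ^ m (Sum.inl i)).prod *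
  ((Finset.univ : Finset ι).toList.map fun i =>
      (LinearMap.mulRight K (xI K ι i) - LinearMap.mulLeft K (xI K ι i) :
        Module.End K (FMet K ι)) ^ m (Sum.inr i)).prod

/-- The action of `K[U,V]` on the commutator ideal of the free metabelian algebra. -/
def actI (K : Type*) [CommRing K] (ι : Type*) [Fintype ι] [DecidableEq ι]
    (q : MvPolynomial (ι ⊕ ι) K) (w : FMet K ι) : FMet K ι :=
  ∑ m ∈ q.support, q.coeff m • (monActI K ι m w)

/-! ### Jordan data.
`s` Jordan cells of sizes `p 0 + 1, …, p (s-1) + 1` together with one extra `1×1` cell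
(corresponding to the variable `x_d` with `δ(x_d) = 0`).  The variable in position `k`
of the `t`-th cell has bidegree `(p t - k, k)`; the last variable has bidegree `(0,0)`. -/

/-- Index set of the variables `x_1,…,x_{d-1}` (the Jordan cells of the nilpotent part). -/
abbrev SmallVar (s : ℕ) (p : Fin s → ℕ) := Σ t : Fin s, Fin (p t + 1)

/-- Index set of all variables `x_1,…,x_d`: the Jordan cells plus the `1×1` cell of `x_d`. -/
abbrev JVar (s : ℕ) (p : Fin s → ℕ) := SmallVar s p ⊕ Unit

/-- bidegree of a variable. -/
def bdeg (s : ℕ) (p : Fin s → ℕ) : JVar s p → ℕ × ℕ :=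
  Sum.elim (fun tk => (p tk.1 - (tk.2 : ℕ), (tk.2 : ℕ))) (fun _ => (0, 0))

/-- Total-degree homogeneous component of the free metabelian algebra. -/
def degCompI (K : Type*) [CommRing K] (ι : Type*) (n : ℕ) : Submodule K (FMet K ι) :=
  Submodule.map (RingQuot.mkAlgHom K (MetabRelI K ι)).toLinearMap
    (Submodule.span K {w : FreeAlgebra K ι | ∃ l : List ι,
      l.length = n ∧ w = (l.map (FreeAlgebra.ι K)).prod})

/-- Bihomogeneous component (w.r.t. the bigrading induced by the Jordan cells). -/
def biCompI (K : Type*) [CommRing K] (s : ℕ) (p : Fin s → ℕ) (qr : ℕ × ℕ) :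
    Submodule K (FMet K (JVar s p)) :=
  Submodule.map (RingQuot.mkAlgHom K (MetabRelI K (JVar s p))).toLinearMap
    (Submodule.span K {w : FreeAlgebra K (JVar s p) | ∃ l : List (JVar s p),
      (l.map (bdeg s p)).sum = qr ∧ w = (l.map (FreeAlgebra.ι K)).prod})

section Main

variable (K : Type*) [Field K] [CharZero K] (s : ℕ) (p : Fin s → ℕ)

/-- `K[U_d,V_d]`. -/
abbrev PolyJ := MvPolynomial (JVar s p ⊕ JVar s p) K

/-- The subalgebra `F_{d-1}` of `F_d` generated by `x_1,…,x_{d-1}`. -/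
def Fsmall : Subalgebra K (FMet K (JVar s p)) :=
  Algebra.adjoin K (Set.range fun tk : SmallVar s p => xI K (JVar s p) (Sum.inl tk))

/-- The commutator ideal of `F_{d-1}`, inside `F_d`. -/
def smallComm : Submodule K (FMet K (JVar s p)) :=
  Submodule.span K {z | ∃ a f g b : FMet K (JVar s p),
    a ∈ Fsmall K s p ∧ f ∈ Fsmall K s p ∧ g ∈ Fsmall K s p ∧ b ∈ Fsmall K s p ∧
    z = a * (f * g - g * f) * b}

/-- `K[U_{d-1},V_{d-1}]_ω`: the span of the monomials in `u_1,…,u_{d-1},v_1,…,v_{d-1}`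
(no occurrence of `u_d` or `v_d`) of positive total degree in `v_1,…,v_{d-1}`. -/
def omegaSmall : Submodule K (PolyJ K s p) :=
  Submodule.span K {w : PolyJ K s p | ∃ m : (JVar s p ⊕ JVar s p) →₀ ℕ,
    m (Sum.inl (Sum.inr ())) = 0 ∧ m (Sum.inr (Sum.inr ())) = 0 ∧
    (∃ tk : SmallVar s p, m (Sum.inr (Sum.inl tk)) ≠ 0) ∧
    w = MvPolynomial.monomial m (1 : K)}

/-- The map `π : K[U_{d-1},V_{d-1}]_ω → F_d'`. -/
def piMapI (q : PolyJ K s p) : FMet K (JVar s p) :=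
  ∑ m ∈ q.support, q.coeff m •
    ∑ tk : SmallVar s p, (m (Sum.inr (Sum.inl tk))) •
      monActI K (JVar s p) (m - Finsupp.single (Sum.inr (Sum.inl tk)) 1)
        (xI K (JVar s p) (Sum.inr ()) * xI K (JVar s p) (Sum.inl tk)
          - xI K (JVar s p) (Sum.inl tk) * xI K (JVar s p) (Sum.inr ()))

/-- `u_d` as element of `K[U_d,V_d]`. -/
def uLast : PolyJ K s p := MvPolynomial.X (Sum.inl (Sum.inr ()))
/-- `v_d` as element of `K[U_d,V_d]`. -/
def vLast : PolyJ K s p := MvPolynomial.X (Sum.inr (Sum.inr ()))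
end Main

namespace Met

section gen

variable (K : Type*) [Field K] (ι : Type*)

/-- commutator ideal as a `K`-submodule -/
abbrev CC : Submodule K (FMet K ι) := (commIdealI K ι).restrictScalars K

variable {K ι}

lemma comm_mem (f g : FMet K ι) : f * g - g * f ∈ CC K ι :=
  Ideal.subset_span ⟨1, f, g, 1, by simp⟩

lemma gen_mem (a f g b : FMet K ι) : a * (f * g - g * f) * b ∈ CC K ι :=
  Ideal.subset_span ⟨a, f, g, b, rfl⟩

lemma left_mem (a : FMet K ι) {w : FMet K ι} (hw : w ∈ CC K ι) : a * w ∈ CC K ι :=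
  Ideal.mul_mem_left (commIdealI K ι) a hw

lemma right_mem (a : FMet K ι) {w : FMet K ι} (hw : w ∈ CC K ι) : w * a ∈ CC K ι := by
  have hw' : w ∈ commIdealI K ι := hw
  unfold commIdealI at hw'
  induction hw' using Submodule.span_induction with
  | mem x h =>
    obtain ⟨a', f, g, b, rfl⟩ := h
    rw [mul_assoc]; exact gen_mem _ _ _ _
  | zero => rw [zero_mul]; exact Submodule.zero_mem _
  | add x y hx hy h1 h2 => rw [add_mul]; exact Submodule.add_mem _ (h1 hx) (h2 hy)
  | smul r x hx h1 =>
    rw [smul_eq_mul, mul_assoc]; exact left_mem _ (h1 hx)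

lemma comm_mul_comm (a b c e : FMet K ι) :
    (a * b - b * a) * (c * e - e * c) = 0 := by
  obtain ⟨a, rfl⟩ := RingQuot.mkAlgHom_surjective K (MetabRelI K ι) a
  obtain ⟨b, rfl⟩ := RingQuot.mkAlgHom_surjective K (MetabRelI K ι) b
  obtain ⟨c, rfl⟩ := RingQuot.mkAlgHom_surjective K (MetabRelI K ι) c
  obtain ⟨e, rfl⟩ := RingQuot.mkAlgHom_surjective K (MetabRelI K ι) e
  have h : MetabRelI K ι ((a * b - b * a) * (c * e - e * c)) 0 := ⟨rfl, a, b, c, e, rfl⟩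
  have := RingQuot.mkAlgHom_rel K h
  simpa using this

lemma comm_mid_comm (a b r c e : FMet K ι) :
    (a * b - b * a) * r * (c * e - e * c) = 0 := by
  have h1 := comm_mul_comm a (b * r) c e
  have h2 := comm_mul_comm a r c e
  have : (a * b - b * a) * r * (c * e - e * c)
    = (a * (b * r) - (b * r) * a) * (c * e - e * c)
      - b * ((a * r - r * a) * (c * e - e * c)) := by
    simp only [mul_sub, sub_mul, mul_assoc]; abel
  rw [this, h1, h2]; simp

lemma mul_eq_zero' {w z : FMet K ι} (hw : w ∈ CC K ι) (hz : z ∈ CC K ι) : w * z = 0 := by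
  have hz' : z ∈ commIdealI K ι := hz
  unfold commIdealI at hz'
  induction hz' using Submodule.span_induction generalizing w with
  | mem x h =>
    obtain ⟨a', c, e, b', rfl⟩ := h
    have hw' : w ∈ commIdealI K ι := hw
    unfold commIdealI at hw'
    clear hw hz
    induction hw' using Submodule.span_induction with
    | mem x h =>
      obtain ⟨a, f, g, b, rfl⟩ := h
      have := comm_mid_comm f g (b * a') c e
      calc _ = a * ((f * g - g * f) * (b * a') * (c * e - e * c)) * b' := by noncomm_ring
        _ = 0 := by rw [this]; simp
    | zero => simp
    | add x y hx hy h1 h2 => rw [add_mul, h1, h2, add_zero]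
    | smul r x hx h1 => rw [smul_eq_mul, mul_assoc, h1, mul_zero]
  | zero => simp
  | add x y hx hy h1 h2 => rw [mul_add, h1 hw hx, h2 hw hy, add_zero]
  | smul r x hx h1 => rw [smul_eq_mul, ← mul_assoc, h1 (right_mem _ hw) hx]

/-- the operators `u_i`, `v_i` on the ambient algebra -/
def opF : ι ⊕ ι → Module.End K (FMet K ι) :=
  Sum.elim (fun i => LinearMap.mulLeft K (xI K ι i))
    (fun i => LinearMap.mulRight K (xI K ι i) - LinearMap.mulLeft K (xI K ι i))

lemma opF_mem (j : ι ⊕ ι) : ∀ w ∈ CC K ι, opF (K := K) j w ∈ CC K ι := by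
  intro w hw
  rcases j with i | i
  · exact left_mem _ hw
  · exact Submodule.sub_mem _ (right_mem _ hw) (left_mem _ hw)

/-- the operators restricted to the commutator ideal -/
def opC (j : ι ⊕ ι) : Module.End K (CC K ι) := (opF (K := K) j).restrict (opF_mem j)

lemma opC_coe (j : ι ⊕ ι) (w : CC K ι) : ((opC j w : CC K ι) : FMet K ι) = opF j w.1 := rfl

lemma LL (a b : FMet K ι) {w : FMet K ι} (hw : w ∈ CC K ι) : a * (b * w) = b * (a * w) := by
  have := mul_eq_zero' (comm_mem a b) hw
  rw [sub_mul, sub_eq_zero] at this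
  simpa [mul_assoc] using this

lemma RR (a b : FMet K ι) {w : FMet K ι} (hw : w ∈ CC K ι) : w * a * b = w * b * a := by
  have := mul_eq_zero' hw (comm_mem a b)
  rw [mul_sub, sub_eq_zero] at this
  simpa [mul_assoc] using this

lemma opC_comm (i j : ι ⊕ ι) : opC (K := K) i * opC j = opC j * opC i := by
  refine LinearMap.ext fun w => Subtype.ext ?_
  rw [Module.End.mul_apply, Module.End.mul_apply, opC_coe, opC_coe, opC_coe, opC_coe]
  rcases w with ⟨w, hw⟩
  rcases i with i | i <;> rcases j with j | j <;>
    simp only [opF, Sum.elim_inl, Sum.elim_inr, LinearMap.sub_apply, LinearMap.mulLeft_apply,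
      LinearMap.mulRight_apply]
  · exact LL _ _ hw
  · rw [mul_sub, LL (xI K ι j) (xI K ι i) hw, mul_assoc]
  · rw [mul_sub, LL (xI K ι j) (xI K ι i) hw, mul_assoc]
  · have h1 := LL (xI K ι j) (xI K ι i) hw
    have h2 := RR (xI K ι j) (xI K ι i) hw
    simp only [sub_mul, mul_sub, h1, h2, mul_assoc]
    abel

open scoped IsMulCommutative in
lemma exists_aeval {σ A : Type*} [Semiring A] [Algebra K A] (f : σ → A)
    (h : ∀ i j, f i * f j = f j * f i) :
    ∃ φ : MvPolynomial σ K →ₐ[K] A, ∀ j, φ (MvPolynomial.X j) = f j := by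
  have : IsMulCommutative (Algebra.adjoin K (Set.range f)) :=
    Algebra.isMulCommutative_adjoin K (by rintro _ ⟨i, rfl⟩ _ ⟨j, rfl⟩; exact h i j)
  refine ⟨(Algebra.adjoin K (Set.range f)).val.comp
    (MvPolynomial.aeval fun j => ⟨f j, Algebra.subset_adjoin ⟨j, rfl⟩⟩), fun j => ?_⟩
  simp

/-- the action as an algebra homomorphism -/
def rho : MvPolynomial (ι ⊕ ι) K →ₐ[K] Module.End K (CC K ι) :=
  (exists_aeval (opC (K := K) (ι := ι)) opC_comm).choose

lemma rho_X (j : ι ⊕ ι) : rho (K := K) (MvPolynomial.X j) = opC j :=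
  (exists_aeval (opC (K := K) (ι := ι)) opC_comm).choose_spec j

instance modCC : Module (MvPolynomial (ι ⊕ ι) K) (CC K ι) :=
  Module.compHom (CC K ι) (rho (K := K) (ι := ι)).toRingHom

lemma smul_def' (q : MvPolynomial (ι ⊕ ι) K) (w : CC K ι) : q • w = rho q w := rfl

instance towCC : IsScalarTower K (MvPolynomial (ι ⊕ ι) K) (CC K ι) where
  smul_assoc a q w := by rw [smul_def', map_smul]; rfl

lemma X_smul_coe (j : ι ⊕ ι) (w : CC K ι) :
    (((MvPolynomial.X j : MvPolynomial (ι ⊕ ι) K) • w : CC K ι) : FMet K ι) = opF j w.1 := by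
  rw [smul_def', rho_X, opC_coe]

lemma u_smul_coe (i : ι) (w : CC K ι) :
    (((MvPolynomial.X (Sum.inl i) : MvPolynomial (ι ⊕ ι) K) • w : CC K ι) : FMet K ι)
      = xI K ι i * w.1 := X_smul_coe _ _

lemma v_smul_coe (i : ι) (w : CC K ι) :
    (((MvPolynomial.X (Sum.inr i) : MvPolynomial (ι ⊕ ι) K) • w : CC K ι) : FMet K ι)
      = w.1 * xI K ι i - xI K ι i * w.1 := X_smul_coe _ _

lemma list_coe (l : List ι) (f : ι → ι ⊕ ι) (m : (ι ⊕ ι) →₀ ℕ) (w : CC K ι) :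
    (((l.map fun i => (opC (K := K) (f i)) ^ m (f i)).prod w : CC K ι) : FMet K ι)
      = (l.map fun i => (opF (K := K) (f i)) ^ m (f i)).prod w.1 := by
  induction l generalizing w with
  | nil => simp
  | cons a l ih =>
    simp only [List.map_cons, List.prod_cons, Module.End.mul_apply]
    rw [← ih]
    generalize (List.map (fun i ↦ opC (K := K) (f i) ^ m (f i)) l).prod w = z
    generalize m (f a) = n
    induction n generalizing z with
    | zero => simp
    | succ n ihn =>
      rw [pow_succ, pow_succ, Module.End.mul_apply, Module.End.mul_apply, ihn, opC_coe]

variable [Fintype ι] [DecidableEq ι]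

lemma monomial_smul (m : (ι ⊕ ι) →₀ ℕ) (w : CC K ι) :
    (((MvPolynomial.monomial m (1 : K)) • w : CC K ι) : FMet K ι) = monActI K ι m w.1 := by
  have h : MvPolynomial.monomial m (1 : K)
     = ((Finset.univ : Finset ι).toList.map fun i =>
          (MvPolynomial.X (Sum.inl i) : MvPolynomial (ι ⊕ ι) K) ^ m (Sum.inl i)).prod *
       ((Finset.univ : Finset ι).toList.map fun i =>
          (MvPolynomial.X (Sum.inr i) : MvPolynomial (ι ⊕ ι) K) ^ m (Sum.inr i)).prod := by
    rw [Finset.prod_map_toList, Finset.prod_map_toList, MvPolynomial.monomial_eq, map_one, one_mul,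
      Finsupp.prod_fintype _ _ (by simp), Fintype.prod_sum_type]
  rw [h, smul_def', map_mul, map_list_prod, map_list_prod, List.map_map, List.map_map,
    Module.End.mul_apply]
  have e1 : ((rho (K := K)) ∘ fun i => (MvPolynomial.X (Sum.inl i) : MvPolynomial (ι ⊕ ι) K) ^ m (Sum.inl i))
      = fun i => (opC (K := K) (Sum.inl i)) ^ m (Sum.inl i) := by
    funext i; simp [rho_X]
  have e2 : ((rho (K := K)) ∘ fun i => (MvPolynomial.X (Sum.inr i) : MvPolynomial (ι ⊕ ι) K) ^ m (Sum.inr i))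
      = fun i => (opC (K := K) (Sum.inr i)) ^ m (Sum.inr i) := by
    funext i; simp [rho_X]
  rw [e1, e2, list_coe, list_coe]
  rfl

lemma act_eq (q : MvPolynomial (ι ⊕ ι) K) (w : CC K ι) :
    actI K ι q w.1 = ((q • w : CC K ι) : FMet K ι) := by
  conv_rhs => rw [MvPolynomial.as_sum q, Finset.sum_smul, Submodule.coe_sum]
  unfold actI
  refine Finset.sum_congr rfl fun m _ => ?_
  rw [← monomial_smul, ← mul_one (q.coeff m), ← smul_eq_mul (q.coeff m) (1 : K),
    ← MvPolynomial.smul_monomial, smul_assoc]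
  simp

end gen

section genB

variable {K : Type*} [Field K] {ι : Type*}

open MvPolynomial

/-- the basic commutators -/
def cc (i j : ι) : CC K ι := ⟨xI K ι i * xI K ι j - xI K ι j * xI K ι i, comm_mem _ _⟩

lemma adjoin_xI : Algebra.adjoin K (Set.range (xI K ι)) = ⊤ := by
  have h : Set.range (xI K ι) = (RingQuot.mkAlgHom K (MetabRelI K ι)) '' (Set.range (FreeAlgebra.ι K)) := by
    rw [← Set.range_comp]; rfl
  rw [h, ← AlgHom.map_adjoin, FreeAlgebra.adjoin_range_ι, Algebra.map_top, AlgHom.range_eq_top]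
  exact RingQuot.mkAlgHom_surjective _ _

lemma cc_self (i : ι) : (cc i i : CC K ι) = 0 := Subtype.ext (sub_self _)

lemma cc_swap (i j : ι) : (cc i j : CC K ι) + cc j i = 0 := Subtype.ext (by
  simp [cc])

/-- the submodule generated by basic commutators, in the algebra -/
def TT (K : Type*) [Field K] (ι : Type*) : Submodule K (FMet K ι) :=
  ((Submodule.span (MvPolynomial (ι ⊕ ι) K)
    (Set.range fun ij : ι × ι => (cc ij.1 ij.2 : CC K ι))).restrictScalars K).map (CC K ι).subtype

lemma TT_smul {w : FMet K ι} (hw : w ∈ TT K ι) (q : MvPolynomial (ι ⊕ ι) K) :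
    ∃ hw' : w ∈ CC K ι, ((q • (⟨w, hw'⟩ : CC K ι) : CC K ι) : FMet K ι) ∈ TT K ι := by
  obtain ⟨z, hz, rfl⟩ := hw
  exact ⟨z.2, ⟨q • z, Submodule.smul_mem _ q hz, rfl⟩⟩

lemma TT_mul (a : FMet K ι) : ∀ w ∈ TT K ι, a * w ∈ TT K ι ∧ w * a ∈ TT K ι := by
  have ha : a ∈ Algebra.adjoin K (Set.range (xI K ι)) := by rw [adjoin_xI]; trivial
  induction ha using Algebra.adjoin_induction with
  | mem x hx =>
    obtain ⟨i, rfl⟩ := hx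
    intro w hw
    obtain ⟨hw', h1⟩ := TT_smul hw (X (Sum.inl i))
    obtain ⟨_, h2⟩ := TT_smul hw (X (Sum.inr i))
    rw [u_smul_coe] at h1
    rw [v_smul_coe] at h2
    refine ⟨h1, ?_⟩
    have := Submodule.add_mem _ h2 h1
    simpa using this
  | algebraMap r =>
    intro w hw
    rw [← Algebra.commutes, ← Algebra.smul_def]
    exact ⟨Submodule.smul_mem _ _ hw, Submodule.smul_mem _ _ hw⟩
  | add x y _ _ h1 h2 =>
    intro w hw
    rw [add_mul, mul_add]
    exact ⟨Submodule.add_mem _ (h1 w hw).1 (h2 w hw).1, Submodule.add_mem _ (h1 w hw).2 (h2 w hw).2⟩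
  | mul x y _ _ h1 h2 =>
    intro w hw
    rw [mul_assoc, ← mul_assoc w]
    exact ⟨(h1 _ (h2 w hw).1).1, (h2 _ (h1 w hw).2).2⟩

/-- commutators with fixed bracket closed under subalgebra generation -/
lemma comm_ind {S : Set (FMet K ι)} {f : FMet K ι} (T : Submodule K (FMet K ι)) (g : FMet K ι)
    (hf : f ∈ Algebra.adjoin K S)
    (hT : ∀ a ∈ Algebra.adjoin K S, ∀ w ∈ T, a * w ∈ T ∧ w * a ∈ T)
    (h : ∀ x ∈ S, x * g - g * x ∈ T) : f * g - g * f ∈ T := by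
  induction hf using Algebra.adjoin_induction with
  | mem x hx => exact h x hx
  | algebraMap r => rw [Algebra.commutes, sub_self]; exact zero_mem _
  | add x y _ _ h1 h2 =>
    have : (x + y) * g - g * (x + y) = (x * g - g * x) + (y * g - g * y) := by
      rw [add_mul, mul_add]; abel
    rw [this]; exact add_mem h1 h2
  | mul x y hx hy h1 h2 =>
    have : (x * y) * g - g * (x * y) = x * (y * g - g * y) + (x * g - g * x) * y := by
      simp only [mul_sub, sub_mul, mul_assoc]; abel
    rw [this]; exact add_mem (hT x hx _ h2).1 (hT y hy _ h1).2

lemma comm_ind2 {S : Set (FMet K ι)} {f g : FMet K ι} (T : Submodule K (FMet K ι))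
    (hf : f ∈ Algebra.adjoin K S) (hg : g ∈ Algebra.adjoin K S)
    (hT : ∀ a ∈ Algebra.adjoin K S, ∀ w ∈ T, a * w ∈ T ∧ w * a ∈ T)
    (h : ∀ x ∈ S, ∀ y ∈ S, x * y - y * x ∈ T) : f * g - g * f ∈ T := by
  refine comm_ind T g hf hT fun x hx => ?_
  rw [← neg_sub]
  refine neg_mem (comm_ind T x hg hT fun y hy => h y hy x hx)

lemma CC_le_TT : CC K ι ≤ TT K ι := by
  intro w hw
  have hw' : w ∈ commIdealI K ι := hw
  unfold commIdealI at hw'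
  induction hw' using Submodule.span_induction with
  | mem x h =>
    obtain ⟨a, f, g, b, rfl⟩ := h
    refine (TT_mul b _ (TT_mul a _ ?_).1).2
    refine comm_ind2 (S := Set.range (xI K ι)) _ (by rw [adjoin_xI]; trivial)
      (by rw [adjoin_xI]; trivial) (fun a _ => TT_mul a) ?_
    rintro _ ⟨i, rfl⟩ _ ⟨j, rfl⟩
    exact ⟨cc i j, Submodule.subset_span ⟨(i, j), rfl⟩, rfl⟩
  | zero => exact zero_mem _
  | add x y hx hy h1 h2 => exact add_mem (h1 hx) (h2 hy)
  | smul r x hx h1 => exact (TT_mul r _ (h1 hx)).1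

lemma CC_gen (w : CC K ι) : w ∈ Submodule.span (MvPolynomial (ι ⊕ ι) K)
    (Set.range fun ij : ι × ι => (cc ij.1 ij.2 : CC K ι)) := by
  obtain ⟨z, hz, h⟩ := CC_le_TT w.2
  have : z = w := Subtype.ext h
  exact this ▸ hz

lemma jacobi (i j k : ι) :
    (X (Sum.inr j) : MvPolynomial (ι ⊕ ι) K) • (cc i k : CC K ι)
      = (X (Sum.inr i) : MvPolynomial (ι ⊕ ι) K) • (cc j k : CC K ι)
        + (X (Sum.inr k) : MvPolynomial (ι ⊕ ι) K) • (cc i j : CC K ι) := by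
  refine Subtype.ext ?_
  rw [Submodule.coe_add, v_smul_coe, v_smul_coe, v_smul_coe]
  simp only [cc, mul_sub, sub_mul, mul_assoc]
  abel

/-- the derivations `phi i`; `phi d` is the map `π` -/
def phi (i : ι) : Derivation K (MvPolynomial (ι ⊕ ι) K) (CC K ι) :=
  mkDerivation K (Sum.elim (fun _ => 0) (fun j => cc i j))

/-- Euler derivation in the `v`s -/
def EE : Derivation K (MvPolynomial (ι ⊕ ι) K) (MvPolynomial (ι ⊕ ι) K) :=
  mkDerivation K (Sum.elim (fun _ => 0) (fun j => X (Sum.inr j)))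

lemma phi_u (i j : ι) : phi (K := K) i (X (Sum.inl j)) = 0 := mkDerivation_X _ _ _
lemma phi_v (i j : ι) : phi (K := K) i (X (Sum.inr j)) = cc i j := mkDerivation_X _ _ _
lemma EE_u (j : ι) : EE (K := K) (X (Sum.inl j)) = 0 := mkDerivation_X _ _ _
lemma EE_v (j : ι) : EE (K := K) (X (Sum.inr j)) = X (Sum.inr j) := mkDerivation_X _ _ _

lemma phi_rel (i j : ι) (g : MvPolynomial (ι ⊕ ι) K) :
    (X (Sum.inr j) : MvPolynomial (ι ⊕ ι) K) • phi i g
      = (X (Sum.inr i) : MvPolynomial (ι ⊕ ι) K) • phi j g + EE g • (cc i j : CC K ι) := by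
  have h : (X (Sum.inr j) : MvPolynomial (ι ⊕ ι) K) • phi (K := K) i
      = (X (Sum.inr i) : MvPolynomial (ι ⊕ ι) K) • phi j
        + (LinearMap.toSpanSingleton (MvPolynomial (ι ⊕ ι) K) (CC K ι) (cc i j)).compDer EE := by
    refine derivation_ext fun k => ?_
    rcases k with k | k
    · simp [phi_u, EE_u]
    · simp [phi_v, EE_v, jacobi i j k]
  have := congrArg (fun D => D g) h
  simpa using this

/-- v-degree -/
def vdeg [Fintype ι] (m : (ι ⊕ ι) →₀ ℕ) : ℕ := ∑ i, m (Sum.inr i)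

lemma EE_monomial [Fintype ι] (m : (ι ⊕ ι) →₀ ℕ) (a : K) :
    EE (monomial m a) = monomial m ((vdeg m : K) * a) := by
  unfold EE vdeg
  rw [mkDerivation_monomial, Finsupp.sum_fintype _ _ (by simp), Fintype.sum_sum_type]
  simp only [Sum.elim_inl, Sum.elim_inr, mul_zero, Finset.sum_const_zero, zero_add, smul_eq_mul]
  have : ∀ i : ι, (monomial (m - Finsupp.single (Sum.inr i) 1)) ((m (Sum.inr i) : ℕ) : K) * X (Sum.inr i)
      = monomial m ((m (Sum.inr i) : ℕ) : K) := by
    intro i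
    rw [X, monomial_mul, mul_one]
    by_cases h : m (Sum.inr i) = 0
    · simp [h]
    · rw [tsub_add_cancel_of_le]
      simpa [Finsupp.single_le_iff] using Nat.one_le_iff_ne_zero.2 h
  rw [Finset.sum_congr rfl fun i _ => this i, ← map_sum, smul_monomial, smul_eq_mul]
  push_cast
  rw [mul_comm]

end genB

section genC

variable {K : Type*} [Field K] {ι : Type*}

open MvPolynomial

/-- scaling by the inverse of `t + vdeg` -/
def SS [Fintype ι] (t : ℕ) : MvPolynomial (ι ⊕ ι) K →ₗ[K] MvPolynomial (ι ⊕ ι) K :=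
  (basisMonomials (ι ⊕ ι) K).constr K fun m => monomial m ((t + vdeg m : ℕ) : K)⁻¹

lemma SS_monomial [Fintype ι] (t : ℕ) (m : (ι ⊕ ι) →₀ ℕ) (a : K) :
    SS t (monomial m a) = monomial m (a * ((t + vdeg m : ℕ) : K)⁻¹) := by
  have h : SS (K := K) t (monomial m 1) = monomial m ((t + vdeg m : ℕ) : K)⁻¹ := by
    have := (basisMonomials (ι ⊕ ι) K).constr_basis K
      (fun m => monomial m ((t + vdeg m : ℕ) : K)⁻¹) m
    rwa [coe_basisMonomials] at this
  have h2 : monomial m a = a • monomial m (1 : K) := by rw [smul_monomial, smul_eq_mul, mul_one]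
  rw [h2, map_smul, h, smul_monomial, smul_eq_mul]

lemma vdeg_add [Fintype ι] (m n : (ι ⊕ ι) →₀ ℕ) : vdeg (m + n) = vdeg m + vdeg n := by
  simp [vdeg, Finset.sum_add_distrib]

lemma vdeg_single [Fintype ι] [DecidableEq ι] (j : ι) : vdeg (Finsupp.single (Sum.inr j : ι ⊕ ι) 1) = 1 := by
  simp [vdeg, Finsupp.single_apply]

lemma SS_X [Fintype ι] [DecidableEq ι] (j : ι) (g : MvPolynomial (ι ⊕ ι) K) :
    X (Sum.inr j) * SS 2 g = SS 1 (X (Sum.inr j) * g) := by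
  induction g using MvPolynomial.induction_on' with
  | monomial m a =>
    rw [SS_monomial, X, monomial_mul, monomial_mul, SS_monomial, vdeg_add, vdeg_single, one_mul,
      one_mul]
    have e : 2 + vdeg m = 1 + (1 + vdeg m) := by omega
    rw [e]
  | add p q h1 h2 => rw [map_add, mul_add, h1, h2, mul_add, map_add]

lemma SS_EE [CharZero K] [Fintype ι] (t : ℕ) (g : MvPolynomial (ι ⊕ ι) K) :
    ((t + 1 : ℕ) : MvPolynomial (ι ⊕ ι) K) * SS (t + 1) g + EE (SS (t + 1) g) = g := by
  induction g using MvPolynomial.induction_on' with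
  | monomial m a =>
    rw [SS_monomial, EE_monomial]
    have : ((t + 1 : ℕ) : MvPolynomial (ι ⊕ ι) K) = C ((t + 1 : ℕ) : K) := by simp
    rw [this, C_mul_monomial, ← map_add]
    congr 1
    have : (((t + 1 + vdeg m : ℕ)) : K) ≠ 0 := by exact_mod_cast (by omega)
    field_simp
    push_cast
    ring
  | add p q h1 h2 =>
    rw [map_add, map_add, mul_add]
    nth_rewrite 3 [← h1]
    nth_rewrite 3 [← h2]
    ring

variable [DecidableEq ι]

/-- images of the generators -/
def matG (k i : ι) : Matrix (Fin 2) (Fin 2) (MvPolynomial (ι ⊕ ι) K) :=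
  !![X (Sum.inl i), if i = k then 1 else 0; 0, X (Sum.inl i) + X (Sum.inr i)]

lemma lift_tri (k : ι) (a : FreeAlgebra K ι) :
    (FreeAlgebra.lift K (matG (K := K) k) a) 1 0 = 0 := by
  induction a using FreeAlgebra.induction with
  | grade0 r => simp [Matrix.algebraMap_matrix_apply]
  | grade1 i => simp [matG]
  | mul a b h1 h2 => simp [Matrix.mul_apply, Fin.sum_univ_two, h1, h2]
  | add a b h1 h2 => simp [h1, h2]

lemma mat_comm {R : Type*} [CommRing R] {A B : Matrix (Fin 2) (Fin 2) R} (hA : A 1 0 = 0)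
    (hB : B 1 0 = 0) :
    (A * B - B * A) 0 0 = 0 ∧ (A * B - B * A) 1 0 = 0 ∧ (A * B - B * A) 1 1 = 0 := by
  simp only [Matrix.sub_apply, Matrix.mul_apply, Fin.sum_univ_two, hA, hB]
  refine ⟨by ring, by ring, by ring⟩

lemma theta_wd (k : ι) ⦃x y : FreeAlgebra K ι⦄ (h : MetabRelI K ι x y) :
    FreeAlgebra.lift K (matG (K := K) k) x = FreeAlgebra.lift K (matG (K := K) k) y := by
  obtain ⟨rfl, a, b, c, e, rfl⟩ := h
  rw [map_mul, map_sub, map_sub, map_mul, map_mul, map_mul, map_mul, map_zero]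
  have h1 := mat_comm (lift_tri (K := K) k a) (lift_tri k b)
  have h2 := mat_comm (lift_tri (K := K) k c) (lift_tri k e)
  generalize FreeAlgebra.lift K (matG (K := K) k) a * FreeAlgebra.lift K (matG (K := K) k) b
    - FreeAlgebra.lift K (matG (K := K) k) b * FreeAlgebra.lift K (matG (K := K) k) a = A at h1 ⊢
  generalize FreeAlgebra.lift K (matG (K := K) k) c * FreeAlgebra.lift K (matG (K := K) k) e
    - FreeAlgebra.lift K (matG (K := K) k) e * FreeAlgebra.lift K (matG (K := K) k) c = B at h2 ⊢
  ext i j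
  rw [Matrix.mul_apply, Fin.sum_univ_two]
  fin_cases i <;> fin_cases j <;> simp [h1, h2]

/-- triangular representation -/
def theta (k : ι) : FMet K ι →ₐ[K] Matrix (Fin 2) (Fin 2) (MvPolynomial (ι ⊕ ι) K) :=
  RingQuot.liftAlgHom K ⟨FreeAlgebra.lift K (matG k), theta_wd k⟩

lemma theta_x (k i : ι) : theta (K := K) k (xI K ι i) = matG k i := by
  unfold theta xI
  rw [RingQuot.liftAlgHom_mkAlgHom_apply, FreeAlgebra.lift_ι_apply]

lemma theta_tri (k : ι) (a : FMet K ι) : theta k a 1 0 = 0 := by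
  obtain ⟨a, rfl⟩ := RingQuot.mkAlgHom_surjective K (MetabRelI K ι) a
  unfold theta
  rw [RingQuot.liftAlgHom_mkAlgHom_apply]
  exact lift_tri k a

lemma theta_CC (k : ι) {w : FMet K ι} (hw : w ∈ CC K ι) : theta k w 0 0 = 0 ∧ theta k w 1 1 = 0 := by
  have hw' : w ∈ commIdealI K ι := hw
  unfold commIdealI at hw'
  induction hw' using Submodule.span_induction with
  | mem x h =>
    obtain ⟨a, f, g, b, rfl⟩ := h
    have h1 := mat_comm (theta_tri (K := K) k f) (theta_tri k g)
    rw [map_mul, map_mul, map_sub, map_mul, map_mul]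
    generalize theta k f * theta k g - theta k g * theta k f = A at h1 ⊢
    simp [Matrix.mul_apply, Fin.sum_univ_two, h1, theta_tri]
  | zero => simp
  | add x y hx hy h1 h2 => simp [h1 hx, h2 hy]
  | smul r x hx h1 => simp [Matrix.mul_apply, Fin.sum_univ_two, h1 hx, theta_tri]

/-- the component embedding -/
def psi (k : ι) : CC K ι →ₗ[MvPolynomial (ι ⊕ ι) K] MvPolynomial (ι ⊕ ι) K where
  toFun w := theta k w.1 0 1
  map_add' x y := by simp
  map_smul' q w := by
    rw [RingHom.id_apply, smul_eq_mul]
    induction q using MvPolynomial.induction_on generalizing w with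
    | C a =>
      have : (C a : MvPolynomial (ι ⊕ ι) K) • w = a • w := by
        rw [← algebraMap_eq, algebraMap_smul]
      rw [this, C_mul']
      simp
    | add p q h1 h2 => rw [add_smul, Submodule.coe_add, map_add, Matrix.add_apply, h1, h2, add_mul]
    | mul_X p i h =>
      rw [mul_smul, h, mul_assoc]
      congr 1
      have h2 := theta_CC k w.2
      rcases i with i | i
      · rw [u_smul_coe, map_mul, theta_x]
        simp [matG, Matrix.mul_apply, Fin.sum_univ_two, h2]
      · rw [v_smul_coe, map_sub, map_mul, map_mul, theta_x]
        rw [Matrix.sub_apply, Matrix.mul_apply, Matrix.mul_apply, Fin.sum_univ_two,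
          Fin.sum_univ_two, h2.1, h2.2]
        simp [matG]
        ring

lemma psi_apply (k : ι) (w : CC K ι) : psi k w = theta k w.1 0 1 := rfl

lemma psi_cc (k i j : ι) : psi (K := K) k (cc i j)
    = (if i = k then X (Sum.inr j) else 0) - (if j = k then X (Sum.inr i) else 0) := by
  rw [psi_apply]
  unfold cc
  rw [map_sub, map_mul, map_mul, theta_x, theta_x]
  simp only [matG, Matrix.sub_apply, Matrix.mul_apply, Fin.sum_univ_two, Matrix.of_apply,
    Matrix.cons_val', Matrix.cons_val_zero, Matrix.cons_val_one]
  split_ifs <;> simp <;> ring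

/-- key operator -/
lemma phi_psi [Fintype ι] (g : MvPolynomial (ι ⊕ ι) K) (i j : ι) :
    ∑ k, phi k (psi k (g • cc i j)) = ((2 : ℕ) * g + EE g) • (cc i j : CC K ι) := by
  have h1 : ∀ k, psi k (g • (cc i j : CC K ι))
      = (if k = i then g * X (Sum.inr j) else 0) - (if k = j then g * X (Sum.inr i) else 0) := by
    intro k
    rw [map_smul, psi_cc, smul_eq_mul, mul_sub]
    simp [eq_comm]
  have h0 : ∀ k, phi k (psi k (g • (cc i j : CC K ι)))
        + (if k = j then phi k (g * X (Sum.inr i)) else 0)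
      = (if k = i then phi k (g * X (Sum.inr j)) else 0) := by
    intro k
    have e1 : (if k = j then phi (K := K) k (g * X (Sum.inr i)) else 0)
      = phi k (if k = j then g * X (Sum.inr i) else 0) := by split_ifs <;> simp
    have e2 : (if k = i then phi (K := K) k (g * X (Sum.inr j)) else 0)
      = phi k (if k = i then g * X (Sum.inr j) else 0) := by split_ifs <;> simp
    rw [h1, e1, e2, ← map_add, sub_add_cancel]
  have h2 : ∀ (a : ι) (f : ι → CC K ι), (∑ k, if k = a then f k else 0) = f a := by
    intro a f; simp
  have h3 := Finset.sum_congr (rfl : (Finset.univ : Finset ι) = Finset.univ) fun k _ => h0 k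
  rw [Finset.sum_add_distrib, h2 i (fun k => phi k (g * X (Sum.inr j))),
    h2 j (fun k => phi k (g * X (Sum.inr i)))] at h3
  refine add_right_cancel (b := phi j (g * X (Sum.inr i))) (h3.trans ?_)
  rw [Derivation.leibniz, Derivation.leibniz, phi_v, phi_v, phi_rel i j, add_smul,
    Nat.cast_ofNat, two_mul, add_smul]
  have h4 : g • (cc i j : CC K ι) + g • cc j i = 0 := by
    rw [← smul_add, cc_swap, smul_zero]
  have h5 : g • (cc i j : CC K ι) + g • cc i j + EE g • cc i j
      + (g • cc j i + (X (Sum.inr i) : MvPolynomial (ι ⊕ ι) K) • phi j g)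
      = g • cc i j + EE g • cc i j + (X (Sum.inr i) : MvPolynomial (ι ⊕ ι) K) • phi j g
        + (g • (cc i j : CC K ι) + g • cc j i) := by abel
  rw [h5, h4]
  abel

lemma psi_inj [CharZero K] [Fintype ι] (w : CC K ι) (h : ∀ k, psi k w = 0) : w = 0 := by
  obtain ⟨q, rfl⟩ := (Submodule.mem_span_range_iff_exists_fun _).1 (CC_gen w)
  have h1 : ∀ k, psi k (∑ i : ι × ι, SS 2 (q i) • (cc i.1 i.2 : CC K ι))
      = SS 1 (psi k (∑ i : ι × ι, q i • (cc i.1 i.2 : CC K ι))) := by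
    intro k
    simp only [map_sum, map_smul, psi_cc, smul_eq_mul]
    refine Finset.sum_congr rfl fun i _ => ?_
    have e : ∀ j, SS 2 (q i) * X (Sum.inr j) = SS 1 (q i * X (Sum.inr j)) := by
      intro j; rw [mul_comm, SS_X, mul_comm]
    rw [mul_sub, mul_sub, map_sub]
    split_ifs <;> simp [e]
  have h2 : ∑ k, phi k (psi k (∑ i : ι × ι, SS 2 (q i) • (cc i.1 i.2 : CC K ι)))
      = ∑ i : ι × ι, q i • (cc i.1 i.2 : CC K ι) := by
    simp only [map_sum (psi _), map_sum (phi _)]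
    rw [Finset.sum_comm]
    refine Finset.sum_congr rfl fun i _ => ?_
    rw [phi_psi, SS_EE 1]
  rw [← h2]
  simp [h1, h]

end genC

section abs

lemma abs_basis {K M V1 V2 A I J : Type*} [Field K] [AddCommMonoid M] [Module K M]
    [AddCommMonoid V1] [Module K V1] [AddCommMonoid V2] [Module K V2]
    (δ : M →ₗ[K] M) (δ1 : V1 →ₗ[K] V1) (δ2 : V2 →ₗ[K] V2)
    (α : A → V1 →ₗ[K] M) (β : A → V2 →ₗ[K] M)
    (hinj : Function.Injective (LinearMap.coprod (Finsupp.lsum K α) (Finsupp.lsum K β)))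
    (hsurj : Function.Surjective (LinearMap.coprod (Finsupp.lsum K α) (Finsupp.lsum K β)))
    (hα : ∀ a x, δ (α a x) = α a (δ1 x)) (hβ : ∀ a x, δ (β a x) = β a (δ2 x))
    (dd : I → V1) (g : J → V2) (hdd : LinearIndependent K dd) (hg : LinearIndependent K g)
    (hdds : Submodule.span K (Set.range dd) = LinearMap.ker δ1)
    (hgs : Submodule.span K (Set.range g) = LinearMap.ker δ2) :
    LinearIndependent K (Sum.elim (fun x : I × A => α x.2 (dd x.1))
      (fun x : J × A => β x.2 (g x.1))) ∧
    Submodule.span K (Set.range (Sum.elim (fun x : I × A => α x.2 (dd x.1))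
      (fun x : J × A => β x.2 (g x.1)))) = LinearMap.ker δ := by
  constructor
  · have h1 : LinearIndependent K (fun x : I × A => (Finsupp.single x.2 (dd x.1) : A →₀ V1)) := by
      have := Finsupp.linearIndependent_single (ι := A) (φ := fun _ => I) (f := fun _ => dd)
        (fun _ => hdd)
      exact this.comp (fun x : I × A => (⟨x.2, x.1⟩ : Σ _ : A, I))
        (fun x y h => by cases x; cases y; simp at h; simp [h])
    have h2 : LinearIndependent K (fun x : J × A => (Finsupp.single x.2 (g x.1) : A →₀ V2)) := by
      have := Finsupp.linearIndependent_single (ι := A) (φ := fun _ => J) (f := fun _ => g)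
        (fun _ => hg)
      exact this.comp (fun x : J × A => (⟨x.2, x.1⟩ : Σ _ : A, J))
        (fun x y h => by cases x; cases y; simp at h; simp [h])
    have h3 := linearIndependent_inl_union_inr' h1 h2
    have h4 := h3.map_injOn (LinearMap.coprod (Finsupp.lsum K α) (Finsupp.lsum K β))
      (hinj.injOn)
    convert h4 using 1
    funext x
    rcases x with x | x <;> simp
  · apply le_antisymm
    · rw [Submodule.span_le]
      rintro _ ⟨x | x, rfl⟩
      · have : dd x.1 ∈ LinearMap.ker δ1 := hdds ▸ Submodule.subset_span ⟨_, rfl⟩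
        simp only [SetLike.mem_coe, LinearMap.mem_ker, Sum.elim_inl, hα]
        rw [LinearMap.mem_ker.1 this, map_zero]
      · have : g x.1 ∈ LinearMap.ker δ2 := hgs ▸ Submodule.subset_span ⟨_, rfl⟩
        simp only [SetLike.mem_coe, LinearMap.mem_ker, Sum.elim_inr, hβ]
        rw [LinearMap.mem_ker.1 this, map_zero]
    · intro w hw
      obtain ⟨⟨D, G⟩, rfl⟩ := hsurj w
      have h0 : LinearMap.coprod (Finsupp.lsum K α) (Finsupp.lsum K β)
          (Finsupp.mapRange δ1 (map_zero _) D, Finsupp.mapRange δ2 (map_zero _) G) = 0 := by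
        rw [LinearMap.mem_ker] at hw
        rw [← hw]
        simp only [LinearMap.coprod_apply, Finsupp.lsum_apply, map_add, map_finsuppSum, hα, hβ]
        rw [Finsupp.sum_mapRange_index (by simp), Finsupp.sum_mapRange_index (by simp)]
      have h1 := hinj (h0.trans (map_zero _).symm)
      rw [Prod.mk_eq_zero] at h1
      have hD : ∀ a, D a ∈ Submodule.span K (Set.range dd) := fun a => by
        rw [hdds, LinearMap.mem_ker]; simpa using DFunLike.congr_fun h1.1 a
      have hG : ∀ a, G a ∈ Submodule.span K (Set.range g) := fun a => by
        rw [hgs, LinearMap.mem_ker]; simpa using DFunLike.congr_fun h1.2 a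
      rw [LinearMap.coprod_apply, Finsupp.lsum_apply, Finsupp.lsum_apply]
      refine Submodule.add_mem _ (Submodule.sum_mem _ fun a _ => ?_)
        (Submodule.sum_mem _ fun a _ => ?_)
      · have := Submodule.mem_map_of_mem (f := α a) (hD a)
        rw [Submodule.map_span] at this
        refine Submodule.span_mono ?_ this
        rintro _ ⟨_, ⟨i, rfl⟩, rfl⟩
        exact ⟨Sum.inl (i, a), rfl⟩
      · have := Submodule.mem_map_of_mem (f := β a) (hG a)
        rw [Submodule.map_span] at this
        refine Submodule.span_mono ?_ this
        rintro _ ⟨_, ⟨i, rfl⟩, rfl⟩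
        exact ⟨Sum.inr (i, a), rfl⟩

end abs

end Met

namespace Met

section small

open MvPolynomial

variable {K : Type*} [Field K] {s : ℕ} {p : Fin s → ℕ}

/-- polynomials not involving `u_d`, `v_d` -/
abbrev P0 (K : Type*) [Field K] (s : ℕ) (p : Fin s → ℕ) : Subalgebra K (PolyJ K s p) :=
  supported K {j | j ≠ Sum.inl (Sum.inr ()) ∧ j ≠ Sum.inr (Sum.inr ())}

lemma mem_P0 (q : PolyJ K s p) : q ∈ P0 K s p ↔
    ∀ m, coeff m q ≠ 0 → m (Sum.inl (Sum.inr ())) = 0 ∧ m (Sum.inr (Sum.inr ())) = 0 := by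
  rw [mem_supported]
  constructor
  · intro h m hm
    constructor
    · by_contra h1
      have : Sum.inl (Sum.inr ()) ∈ q.vars :=
        (mem_vars_iff_mem_support _).2 ⟨m, mem_support_iff.2 hm, Finsupp.mem_support_iff.2 h1⟩
      exact (h this).1 rfl
    · by_contra h1
      have : Sum.inr (Sum.inr ()) ∈ q.vars :=
        (mem_vars_iff_mem_support _).2 ⟨m, mem_support_iff.2 hm, Finsupp.mem_support_iff.2 h1⟩
      exact (h this).2 rfl
  · intro h j hj
    obtain ⟨m, hm, hj⟩ := (mem_vars_iff_mem_support _).1 hj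
    have := h m (mem_support_iff.1 hm)
    rw [Finsupp.mem_support_iff] at hj
    constructor
    · rintro rfl; exact hj this.1
    · rintro rfl; exact hj this.2

lemma mem_omega (q : PolyJ K s p) : q ∈ omegaSmall K s p ↔
    ∀ m, coeff m q ≠ 0 → m (Sum.inl (Sum.inr ())) = 0 ∧ m (Sum.inr (Sum.inr ())) = 0 ∧
    (∃ tk : SmallVar s p, m (Sum.inr (Sum.inl tk)) ≠ 0) := by
  constructor
  · intro h
    unfold omegaSmall at h
    induction h using Submodule.span_induction with
    | mem x h =>
      obtain ⟨m', h1, h2, h3, rfl⟩ := h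
      intro m hm
      rw [coeff_monomial] at hm
      have : m' = m := by by_contra h; simp [h] at hm
      subst this
      exact ⟨h1, h2, h3⟩
    | zero => simp
    | add x y _ _ h1 h2 =>
      intro m hm
      rw [coeff_add] at hm
      by_cases hx : coeff m x = 0
      · exact h2 m (by simpa [hx] using hm)
      · exact h1 m hx
    | smul a x _ h1 =>
      intro m hm
      rw [coeff_smul] at hm
      exact h1 m (right_ne_zero_of_mul hm)
  · intro h
    rw [as_sum q]
    refine Submodule.sum_mem _ fun m hm => ?_
    obtain ⟨h1, h2, h3⟩ := h m (mem_support_iff.1 hm)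
    have e : monomial m (coeff m q) = coeff m q • monomial m (1 : K) := by
      rw [smul_monomial, smul_eq_mul, mul_one]
    rw [e]
    exact Submodule.smul_mem _ _ (Submodule.subset_span ⟨m, h1, h2, h3, rfl⟩)

lemma omega_P0 {q : PolyJ K s p} (h : q ∈ omegaSmall K s p) : q ∈ P0 K s p :=
  (mem_P0 q).2 fun m hm => ⟨((mem_omega q).1 h m hm).1, ((mem_omega q).1 h m hm).2.1⟩

lemma X_mul_omega (tk : SmallVar s p) {q : PolyJ K s p} (h : q ∈ P0 K s p) :
    X (Sum.inr (Sum.inl tk)) * q ∈ omegaSmall K s p := by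
  rw [mem_omega]
  intro m hm
  have h1 : X (Sum.inr (Sum.inl tk)) * q ∈ P0 K s p :=
    Subalgebra.mul_mem _ (X_mem_supported.2 (by simp)) h
  have h2 := (mem_P0 _).1 h1 m hm
  refine ⟨h2.1, h2.2, tk, fun h0 => hm ?_⟩
  rw [coeff_X_mul', if_neg]
  simpa using h0

lemma omega_ind {q : PolyJ K s p} (h : q ∈ omegaSmall K s p) (T : Submodule K (PolyJ K s p))
    (hT : ∀ tk : SmallVar s p, ∀ r ∈ P0 K s p, X (Sum.inr (Sum.inl tk)) * r ∈ T) : q ∈ T := by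
  unfold omegaSmall at h
  refine Submodule.span_le.2 ?_ h
  rintro _ ⟨m, h1, h2, ⟨tk, h3⟩, rfl⟩
  have e : monomial m (1 : K) = X (Sum.inr (Sum.inl tk))
      * monomial (m - Finsupp.single (Sum.inr (Sum.inl tk)) 1) 1 := by
    rw [X, monomial_mul, mul_one, add_tsub_cancel_of_le]
    simpa [Finsupp.single_le_iff] using Nat.one_le_iff_ne_zero.2 h3
  rw [e]
  refine hT _ _ ?_
  rw [mem_P0]
  intro m' hm'
  rw [coeff_monomial] at hm'
  have : m - Finsupp.single (Sum.inr (Sum.inl tk)) 1 = m' := by by_contra h; simp [h] at hm'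
  subst this
  simp [h1, h2]

lemma Fsmall_mul {a : FMet K (JVar s p)} (ha : a ∈ Fsmall K s p) :
    ∀ w ∈ smallComm K s p, a * w ∈ smallComm K s p ∧ w * a ∈ smallComm K s p := by
  intro w hw
  unfold smallComm at hw
  induction hw using Submodule.span_induction with
  | mem x h =>
    obtain ⟨a', f, g, b, ha', hf, hg, hb, rfl⟩ := h
    refine ⟨Submodule.subset_span ⟨a * a', f, g, b, mul_mem ha ha', hf, hg, hb, ?_⟩,
      Submodule.subset_span ⟨a', f, g, b * a, ha', hf, hg, mul_mem hb ha, ?_⟩⟩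
    · simp only [mul_assoc]
    · simp only [mul_assoc]
  | zero => simp
  | add x y _ _ h1 h2 =>
    rw [mul_add, add_mul]
    exact ⟨add_mem h1.1 h2.1, add_mem h1.2 h2.2⟩
  | smul r x _ h1 =>
    rw [mul_smul_comm, smul_mul_assoc]
    exact ⟨Submodule.smul_mem _ _ h1.1, Submodule.smul_mem _ _ h1.2⟩

lemma small_le_CC : smallComm K s p ≤ CC K (JVar s p) := by
  refine Submodule.span_le.2 ?_
  rintro _ ⟨a, f, g, b, _, _, _, _, rfl⟩
  exact gen_mem _ _ _ _

lemma small_le_F {w : FMet K (JVar s p)} (hw : w ∈ smallComm K s p) : w ∈ Fsmall K s p := by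
  have : smallComm K s p ≤ Subalgebra.toSubmodule (Fsmall K s p) := by
    refine Submodule.span_le.2 ?_
    rintro _ ⟨a, f, g, b, ha, hf, hg, hb, rfl⟩
    show _ ∈ Fsmall K s p
    exact mul_mem (mul_mem ha (sub_mem (mul_mem hf hg) (mul_mem hg hf))) hb
  exact this hw

lemma x_mem (i : SmallVar s p) : xI K (JVar s p) (Sum.inl i) ∈ Fsmall K s p :=
  Algebra.subset_adjoin ⟨i, rfl⟩

/-- the small commutator ideal inside `CC` -/
def V1 (K : Type*) [Field K] (s : ℕ) (p : Fin s → ℕ) : Submodule K (CC K (JVar s p)) :=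
  (smallComm K s p).comap (CC K (JVar s p)).subtype

lemma mem_V1 (w : CC K (JVar s p)) : w ∈ V1 K s p ↔ w.1 ∈ smallComm K s p := Iff.rfl

lemma V1_smul {q : PolyJ K s p} (hq : q ∈ P0 K s p) :
    ∀ w ∈ V1 K s p, q • w ∈ V1 K s p := by
  replace hq : q ∈ Algebra.adjoin K (X '' _) := hq
  induction hq using Algebra.adjoin_induction with
  | mem x hx =>
    obtain ⟨j, hj, rfl⟩ := hx
    intro w hw
    rw [mem_V1] at hw ⊢
    rcases j with (i | i) | (i | i)
    · rw [u_smul_coe]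
      exact (Fsmall_mul (x_mem i) _ hw).1
    · exact absurd rfl hj.1
    · rw [v_smul_coe]
      exact sub_mem (Fsmall_mul (x_mem i) _ hw).2 (Fsmall_mul (x_mem i) _ hw).1
    · exact absurd rfl hj.2
  | algebraMap r =>
    intro w hw
    rw [algebraMap_smul]
    exact Submodule.smul_mem _ _ hw
  | add x y _ _ h1 h2 =>
    intro w hw
    rw [add_smul]
    exact Submodule.add_mem _ (h1 w hw) (h2 w hw)
  | mul x y _ _ h1 h2 =>
    intro w hw
    rw [mul_smul]
    exact h1 _ (h2 w hw)

lemma cc_V1 (i j : SmallVar s p) : (cc (Sum.inl i) (Sum.inl j) : CC K (JVar s p)) ∈ V1 K s p :=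
  Submodule.subset_span ⟨1, _, _, 1, one_mem _, x_mem i, x_mem j, one_mem _, by
    rw [one_mul, mul_one]; rfl⟩

lemma phi_V1 (i : SmallVar s p) {q : PolyJ K s p} (hq : q ∈ P0 K s p) :
    phi (Sum.inl i) q ∈ V1 K s p := by
  replace hq : q ∈ Algebra.adjoin K (X '' _) := hq
  induction hq using Algebra.adjoin_induction with
  | mem x hx =>
    obtain ⟨j, hj, rfl⟩ := hx
    rcases j with (j | j) | (j | j)
    · rw [phi_u]; exact zero_mem _
    · rw [phi_u]; exact zero_mem _
    · rw [phi_v]; exact cc_V1 _ _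
    · exact absurd rfl hj.2
  | algebraMap r => rw [Derivation.map_algebraMap]; exact zero_mem _
  | add x y _ _ h1 h2 => rw [map_add]; exact add_mem h1 h2
  | mul x y hx hy h1 h2 =>
    rw [Derivation.leibniz]
    exact add_mem (V1_smul hx _ h2) (V1_smul hy _ h1)

lemma theta_P0 (k : JVar s p) {a : FMet K (JVar s p)} (ha : a ∈ Fsmall K s p) :
    ∀ i j, theta k a i j ∈ P0 K s p := by
  unfold Fsmall at ha
  induction ha using Algebra.adjoin_induction with
  | mem x hx =>
    obtain ⟨t, rfl⟩ := hx
    have h1 : (X (Sum.inl (Sum.inl t)) : PolyJ K s p) ∈ P0 K s p := X_mem_supported.2 (by simp)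
    have h2 : (X (Sum.inr (Sum.inl t)) : PolyJ K s p) ∈ P0 K s p := X_mem_supported.2 (by simp)
    intro i j
    rw [theta_x]
    fin_cases i <;> fin_cases j
    · exact h1
    · simp only [matG]
      by_cases h : Sum.inl t = k
      · simp [h]
      · simp [h]
    · exact zero_mem _
    · exact add_mem h1 h2
  | algebraMap r =>
    intro i j
    rw [AlgHom.commutes, Matrix.algebraMap_matrix_apply]
    split_ifs
    · exact Subalgebra.algebraMap_mem _ _
    · exact zero_mem _
  | add x y _ _ h1 h2 =>
    intro i j
    rw [map_add]; exact add_mem (h1 i j) (h2 i j)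
  | mul x y _ _ h1 h2 =>
    intro i j
    rw [map_mul, Matrix.mul_apply]
    exact Subalgebra.sum_mem _ fun l _ => mul_mem (h1 _ _) (h2 _ _)

lemma theta_last {a : FMet K (JVar s p)} (ha : a ∈ Fsmall K s p) :
    theta (Sum.inr ()) a 0 1 = 0 := by
  unfold Fsmall at ha
  induction ha using Algebra.adjoin_induction with
  | mem x hx =>
    obtain ⟨t, rfl⟩ := hx
    rw [theta_x]
    simp [matG]
  | algebraMap r =>
    rw [AlgHom.commutes, Matrix.algebraMap_matrix_apply]
    simp
  | add x y _ _ h1 h2 => rw [map_add, Matrix.add_apply, h1, h2, add_zero]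
  | mul x y _ _ h1 h2 =>
    rw [map_mul, Matrix.mul_apply, Fin.sum_univ_two, h1, h2]
    simp

lemma coeff_EE (q : PolyJ K s p) (m) : coeff m (EE q) = (vdeg m : K) * coeff m q := by
  induction q using MvPolynomial.induction_on' with
  | monomial n a =>
    rw [EE_monomial, coeff_monomial, coeff_monomial]
    split_ifs with h
    · rw [h]
    · simp
  | add x y h1 h2 => rw [map_add, coeff_add, coeff_add, h1, h2, mul_add]

lemma EE_P0 {q : PolyJ K s p} (hq : q ∈ P0 K s p) : EE q ∈ P0 K s p := by
  rw [mem_P0] at hq ⊢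
  intro m hm
  rw [coeff_EE] at hm
  exact hq m (right_ne_zero_of_mul hm)

lemma EE_omega [CharZero K] {q : PolyJ K s p} (hq : q ∈ omegaSmall K s p) (h : EE q = 0) : q = 0 := by
  rw [mem_omega] at hq
  ext m
  by_contra hm
  obtain ⟨_, _, tk, h3⟩ := hq m hm
  have h4 : coeff m (EE q) = 0 := by rw [h, coeff_zero]
  rw [coeff_EE] at h4
  have h5 : vdeg m ≠ 0 := by
    have : m (Sum.inr (Sum.inl tk)) ≤ vdeg m :=
      Finset.single_le_sum (f := fun i : JVar s p => m (Sum.inr i)) (fun _ _ => Nat.zero_le _)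
        (Finset.mem_univ (Sum.inl tk))
    omega
  rcases mul_eq_zero.1 h4 with h6 | h6
  · exact h5 (by exact_mod_cast h6)
  · exact hm h6

lemma psi_phi_last {q : PolyJ K s p} (hq : q ∈ P0 K s p) :
    psi (Sum.inr ()) (phi (Sum.inr ()) q) = EE q := by
  have := derivation_eqOn_supported
    (D₁ := (psi (K := K) (ι := JVar s p) (Sum.inr ())).compDer (phi (Sum.inr ()))) (D₂ := EE)
    (s := {j | j ≠ Sum.inl (Sum.inr ()) ∧ j ≠ Sum.inr (Sum.inr ())}) (fun j hj => by
      rcases j with (i | i) | (i | i)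
      · simp [phi_u, EE_u]
      · exact absurd rfl hj.1
      · simp [phi_v, EE_v, psi_cc]
      · exact absurd rfl hj.2) hq
  simpa using this

/-- `u_d^m v_d^n` -/
def pw (K : Type*) [Field K] (s : ℕ) (p : Fin s → ℕ) (a : ℕ × ℕ) : PolyJ K s p :=
  uLast K s p ^ a.1 * vLast K s p ^ a.2

/-- exponent of `u_d^m v_d^n` -/
def pe (s : ℕ) (p : Fin s → ℕ) (a : ℕ × ℕ) : (JVar s p ⊕ JVar s p) →₀ ℕ :=
  Finsupp.single (Sum.inl (Sum.inr ())) a.1 + Finsupp.single (Sum.inr (Sum.inr ())) a.2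

lemma pw_eq (a : ℕ × ℕ) : pw K s p a = monomial (pe s p a) 1 := by
  simp [pw, pe, uLast, vLast, X_pow_eq_monomial, monomial_mul]

lemma free_ind (t : Finset (ℕ × ℕ)) (q : ℕ × ℕ → PolyJ K s p) (hq : ∀ a, q a ∈ P0 K s p)
    (h : ∑ a ∈ t, pw K s p a * q a = 0) : ∀ a ∈ t, q a = 0 := by
  intro a ha
  ext m
  by_contra hm
  have hm' := (mem_P0 _).1 (hq a) m hm
  apply hm
  have h1 := congrArg (coeff (pe s p a + m)) h
  rw [coeff_sum, coeff_zero, Finset.sum_eq_single a] at h1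
  · rw [pw_eq, coeff_monomial_mul, one_mul] at h1
    simpa using h1
  · intro b _ hb
    rw [pw_eq, coeff_monomial_mul', one_mul]
    split_ifs with hle
    · by_contra hc
      have h2 := (mem_P0 _).1 (hq b) _ hc
      have l1 := hle (Sum.inl (Sum.inr ()))
      have l2 := hle (Sum.inr (Sum.inr ()))
      simp [pe, hm'] at h2 l1 l2
      exact hb (Prod.ext (by omega) (by omega))
    · rfl
  · intro h; exact absurd ha h

end small

end Met

namespace Met

section small2

open MvPolynomial

variable {K : Type*} [Field K] {s : ℕ} {p : Fin s → ℕ}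

lemma mono_P0 {q : PolyJ K s p} (a : ℕ × ℕ) : pw K s p a • q = pw K s p a * q := rfl

lemma phi_monomial (i : JVar s p) (m) (a : K) : phi i (monomial m a) =
    a • ∑ j : JVar s p, m (Sum.inr j) •
      ((monomial (m - Finsupp.single (Sum.inr j) 1) (1 : K)) • (cc i j : CC K (JVar s p))) := by
  unfold phi
  rw [mkDerivation_monomial, Finsupp.sum_fintype _ _ (by simp), Fintype.sum_sum_type]
  congr 1
  simp only [Sum.elim_inl, Sum.elim_inr, smul_zero, Finset.sum_const_zero, zero_add]
  refine Finset.sum_congr rfl fun j _ => ?_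
  have : (monomial (m - Finsupp.single (Sum.inr j) 1)) ((m (Sum.inr j) : ℕ) : K) =
    (m (Sum.inr j)) • (monomial (m - Finsupp.single (Sum.inr j) 1) (1 : K)) := by
    rw [smul_monomial, nsmul_one]
  rw [this, smul_assoc]

lemma pi_eq (q : PolyJ K s p) : piMapI K s p q = (phi (Sum.inr ()) q : CC K (JVar s p)).1 := by
  conv_rhs => rw [as_sum q, map_sum]
  unfold piMapI
  rw [AddSubmonoidClass.coe_finsetSum]
  refine Finset.sum_congr rfl fun m _ => ?_
  rw [phi_monomial]
  rw [Submodule.coe_smul, Fintype.sum_sum_type]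
  congr 1
  simp only [Finset.univ_unique, Finset.sum_singleton]
  rw [show (default : Unit) = () from rfl, cc_self, smul_zero, smul_zero, add_zero]
  rw [AddSubmonoidClass.coe_finsetSum]
  refine Finset.sum_congr rfl fun j _ => ?_
  rw [AddSubmonoidClass.coe_nsmul, monomial_smul]
  rfl

lemma psi_V1 (k : JVar s p) {w : CC K (JVar s p)} (h : w ∈ V1 K s p) : psi k w ∈ P0 K s p := by
  rw [psi_apply]
  exact theta_P0 k (small_le_F h) _ _

lemma psi_V1_last {w : CC K (JVar s p)} (h : w ∈ V1 K s p) : psi (Sum.inr ()) w = 0 := by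
  rw [psi_apply]
  exact theta_last (small_le_F h)

lemma inj_aux [CharZero K] (t : Finset (ℕ × ℕ)) (D : ℕ × ℕ → CC K (JVar s p)) (G : ℕ × ℕ → PolyJ K s p)
    (hD : ∀ a, D a ∈ V1 K s p) (hG : ∀ a, G a ∈ omegaSmall K s p)
    (h : ∑ a ∈ t, pw K s p a • D a + ∑ a ∈ t, pw K s p a • phi (Sum.inr ()) (G a) = 0) :
    ∀ a ∈ t, D a = 0 ∧ G a = 0 := by
  have hG0 : ∀ a ∈ t, G a = 0 := by
    intro a ha
    apply EE_omega (hG a)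
    refine free_ind t (fun a => EE (G a)) (fun a => EE_P0 (omega_P0 (hG a))) ?_ a ha
    have h1 := congrArg (psi (Sum.inr ())) h
    rw [map_add, map_sum, map_sum, map_zero] at h1
    simp only [map_smul, psi_V1_last (hD _), psi_phi_last (omega_P0 (hG _)), smul_zero,
      Finset.sum_const_zero, zero_add] at h1
    exact h1
  intro a ha
  refine ⟨?_, hG0 a ha⟩
  apply psi_inj
  intro k
  refine free_ind t (fun a => psi k (D a)) (fun a => psi_V1 k (hD a)) ?_ a ha
  have h1 := congrArg (psi k) h
  rw [Finset.sum_congr (s₁ := t) (f := fun a => pw K s p a • phi (Sum.inr ()) (G a))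
    (g := fun a => 0) rfl (fun a ha => by rw [hG0 a ha, map_zero, smul_zero])] at h1
  rw [Finset.sum_const_zero, add_zero, map_sum, map_zero] at h1
  simp only [map_smul] at h1
  exact h1

lemma inj_of_zero {K M N : Type*} [Field K] [AddCommMonoid M] [Module K M] [AddCommMonoid N]
    [Module K N] (f : M →ₗ[K] N) (h : ∀ x, f x = 0 → x = 0) : Function.Injective f := by
  let _ := Module.addCommMonoidToAddCommGroup K (M := M)
  let _ := Module.addCommMonoidToAddCommGroup K (M := N)
  exact (injective_iff_map_eq_zero f).2 h

/-- `α` maps -/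
def al (K : Type*) [Field K] (s : ℕ) (p : Fin s → ℕ) (a : ℕ × ℕ) :
    V1 K s p →ₗ[K] CC K (JVar s p) where
  toFun w := pw K s p a • w.1
  map_add' x y := by rw [Submodule.coe_add, smul_add]
  map_smul' c x := by rw [Submodule.coe_smul, smul_comm, RingHom.id_apply]

/-- `β` maps -/
def be (K : Type*) [Field K] (s : ℕ) (p : Fin s → ℕ) (a : ℕ × ℕ) :
    omegaSmall K s p →ₗ[K] CC K (JVar s p) where
  toFun w := pw K s p a • phi (Sum.inr ()) w.1
  map_add' x y := by rw [Submodule.coe_add, map_add, smul_add]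
  map_smul' c x := by rw [Submodule.coe_smul, Derivation.map_smul, smul_comm, RingHom.id_apply]

lemma al_apply (a w) : al K s p a w = pw K s p a • w.1 := rfl
lemma be_apply (a w) : be K s p a w = pw K s p a • phi (Sum.inr ()) w.1 := rfl

/-- total map -/
def Phi (K : Type*) [Field K] (s : ℕ) (p : Fin s → ℕ) :=
  LinearMap.coprod (Finsupp.lsum K (al K s p)) (Finsupp.lsum K (be K s p))

lemma Phi_inj [CharZero K] : Function.Injective (Phi K s p) := by
  have : ∀ x, Phi K s p x = 0 → x = 0 := by
    rintro ⟨D, G⟩ h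
    unfold Phi at h
    rw [LinearMap.coprod_apply, Finsupp.lsum_apply, Finsupp.lsum_apply] at h
    rw [Finsupp.sum_of_support_subset D (s := D.support ∪ G.support) Finset.subset_union_left
      _ (by simp), Finsupp.sum_of_support_subset G (s := D.support ∪ G.support)
      Finset.subset_union_right _ (by simp)] at h
    have h2 := inj_aux _ (fun a => (D a).1) (fun a => (G a).1) (fun a => (D a).2)
      (fun a => (G a).2) h
    refine Prod.ext ?_ ?_
    · ext1 a
      by_cases ha : a ∈ D.support
      · exact Subtype.ext (h2 a (Finset.mem_union_left _ ha)).1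
      · exact Finsupp.notMem_support_iff.1 ha
    · ext1 a
      by_cases ha : a ∈ G.support
      · exact Subtype.ext (h2 a (Finset.mem_union_right _ ha)).2
      · exact Finsupp.notMem_support_iff.1 ha
  exact inj_of_zero _ this

end small2

end Met

namespace Met

section small3

open MvPolynomial

variable {K : Type*} [Field K] {s : ℕ} {p : Fin s → ℕ}

lemma mem_of_add {K M : Type*} [Field K] [AddCommMonoid M] [Module K M] (S : Submodule K M)
    {x y : M} (h : x + y ∈ S) (hy : y ∈ S) : x ∈ S := by
  let _ := Module.addCommMonoidToAddCommGroup K (M := M)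
  exact (Submodule.add_mem_iff_left S hy).1 h

lemma R_al (a : ℕ × ℕ) {w : CC K (JVar s p)} (h : w ∈ V1 K s p) :
    pw K s p a • w ∈ LinearMap.range (Phi K s p) := by
  refine ⟨(Finsupp.single a ⟨w, h⟩, 0), ?_⟩
  unfold Phi
  rw [LinearMap.coprod_apply, map_zero, add_zero, Finsupp.lsum_single]
  rfl

lemma R_be (a : ℕ × ℕ) {q : PolyJ K s p} (h : q ∈ omegaSmall K s p) :
    pw K s p a • phi (Sum.inr ()) q ∈ LinearMap.range (Phi K s p) := by
  refine ⟨(0, Finsupp.single a ⟨q, h⟩), ?_⟩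
  unfold Phi
  rw [LinearMap.coprod_apply, map_zero, zero_add, Finsupp.lsum_single]
  rfl

lemma split_mono (m : (JVar s p ⊕ JVar s p) →₀ ℕ) : ∃ a m0, 
    (monomial m0 (1 : K)) ∈ P0 K s p ∧ monomial m (1 : K) = pw K s p a * monomial m0 1 := by
  have hle : pe s p (m (Sum.inl (Sum.inr ())), m (Sum.inr (Sum.inr ()))) ≤ m := by
    intro j
    rcases j with (j | j) | (j | j) <;> simp [pe]
  refine ⟨(m (Sum.inl (Sum.inr ())), m (Sum.inr (Sum.inr ()))),
    m - pe s p (m (Sum.inl (Sum.inr ())), m (Sum.inr (Sum.inr ()))), ?_, ?_⟩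
  · rw [mem_P0]
    intro m' hm'
    rw [coeff_monomial] at hm'
    split_ifs at hm' with h
    · subst h
      simp [pe]
    · exact absurd rfl hm'
  · rw [pw_eq, monomial_mul, mul_one, add_tsub_cancel_of_le hle]

lemma pw_succ (a : ℕ × ℕ) : pw K s p (a.1, a.2 + 1) = pw K s p a * X (Sum.inr (Sum.inr ())) := by
  simp only [pw, vLast, pow_succ, mul_assoc]

lemma R_last [CharZero K] (m : (JVar s p ⊕ JVar s p) →₀ ℕ) (j : SmallVar s p) :
    (monomial m (1 : K)) • (cc (Sum.inr ()) (Sum.inl j) : CC K (JVar s p))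
      ∈ LinearMap.range (Phi K s p) := by
  obtain ⟨a, m0, h0, h1⟩ := split_mono (K := K) m
  have key : phi (Sum.inr ()) (X (Sum.inr (Sum.inl j)) * monomial m0 (1 : K)) =
      ((vdeg m0 : K) + 1) • ((monomial m0 (1 : K)) • (cc (Sum.inr ()) (Sum.inl j) : CC K (JVar s p)))
        + (X (Sum.inr (Sum.inr ())) : PolyJ K s p) • phi (Sum.inl j) (monomial m0 (1 : K)) := by
    rw [Derivation.leibniz, phi_rel, phi_v, EE_monomial]
    have : monomial m0 ((vdeg m0 : K) * 1) = (vdeg m0 : K) • monomial m0 (1 : K) := by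
      rw [smul_monomial, smul_eq_mul]
    rw [this, add_smul, one_smul, smul_assoc]
    abel
  have h2 := R_be a (X_mul_omega j h0)
  rw [key, smul_add, smul_comm, smul_smul, smul_smul, ← h1, ← pw_succ] at h2
  have h3 := mem_of_add _ h2 (R_al (a.1, a.2 + 1) (phi_V1 j h0))
  have h4 : ((vdeg m0 : K) + 1) ≠ 0 := by exact_mod_cast Nat.succ_ne_zero (vdeg m0)
  exact (Submodule.smul_mem_iff _ h4).1 h3

lemma R_cc [CharZero K] (m : (JVar s p ⊕ JVar s p) →₀ ℕ) (i j : JVar s p) :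
    (monomial m (1 : K)) • (cc i j : CC K (JVar s p)) ∈ LinearMap.range (Phi K s p) := by
  rcases i with i | i <;> rcases j with j | j
  · obtain ⟨a, m0, h0, h1⟩ := split_mono (K := K) m
    rw [h1, mul_smul]
    exact R_al _ (V1_smul h0 _ (cc_V1 _ _))
  · refine mem_of_add _ ?_ (R_last m i)
    rw [← smul_add, cc_swap, smul_zero]
    exact zero_mem _
  · exact R_last m j
  · rw [cc_self, smul_zero]
    exact zero_mem _

lemma Phi_surj [CharZero K] : Function.Surjective (Phi K s p) := by
  intro w
  have hw := CC_gen w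
  have : ∀ q : PolyJ K s p, q • w ∈ LinearMap.range (Phi K s p) := by
    induction hw using Submodule.span_induction with
    | mem x h =>
      obtain ⟨⟨i, j⟩, rfl⟩ := h
      intro q
      induction q using MvPolynomial.induction_on' with
      | monomial m a =>
        have : monomial m a = a • monomial m (1 : K) := by
          rw [smul_monomial, smul_eq_mul, mul_one]
        rw [this, smul_assoc]
        exact Submodule.smul_mem _ _ (R_cc m i j)
      | add x y h1 h2 => rw [add_smul]; exact add_mem h1 h2
    | zero => intro q; rw [smul_zero]; exact zero_mem _
    | add x y _ _ h1 h2 => intro q; rw [smul_add]; exact add_mem (h1 q) (h2 q)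
    | smul r x _ h => intro q; rw [smul_smul]; exact h _
  simpa using this 1

end small3

end Met

namespace Met

section small4

open MvPolynomial

variable {K : Type*} [Field K] {s : ℕ} {p : Fin s → ℕ}

/-- compatibility of the action on the generators -/
def Hyp (δB : FMet K (JVar s p) →ₗ[K] FMet K (JVar s p))
    (δ' : Derivation K (PolyJ K s p) (PolyJ K s p)) (i : JVar s p) : Prop :=
  (δB (xI K (JVar s p) i) = 0 ∧ δ' (X (Sum.inl i)) = 0 ∧ δ' (X (Sum.inr i)) = 0) ∨
  ∃ tk : SmallVar s p, δB (xI K (JVar s p) i) = xI K (JVar s p) (Sum.inl tk) ∧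
    δ' (X (Sum.inl i)) = X (Sum.inl (Sum.inl tk)) ∧ δ' (X (Sum.inr i)) = X (Sum.inr (Sum.inl tk))

variable (δB : FMet K (JVar s p) →ₗ[K] FMet K (JVar s p))
    (δ' : Derivation K (PolyJ K s p) (PolyJ K s p))

lemma d_one (hleib : ∀ a b : FMet K (JVar s p), δB (a * b) = δB a * b + a * δB b)
    : δB 1 = 0 := by
  have := hleib 1 1
  rw [mul_one, mul_one, one_mul] at this
  simpa using this

lemma d_gen (hleib : ∀ a b : FMet K (JVar s p), δB (a * b) = δB a * b + a * δB b)
    (a f g b : FMet K (JVar s p)) : δB (a * (f * g - g * f) * b) =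
    δB a * (f * g - g * f) * b + a * (δB f * g - g * δB f) * b + a * (f * δB g - δB g * f) * b
      + a * (f * g - g * f) * δB b := by
  simp only [hleib, map_sub, mul_sub, sub_mul, mul_add, mul_assoc]
  abel

lemma d_CC (hleib : ∀ a b : FMet K (JVar s p), δB (a * b) = δB a * b + a * δB b)
    (w) (hw : w ∈ CC K (JVar s p)) : δB w ∈ CC K (JVar s p) := by
  have hw' : w ∈ commIdealI K (JVar s p) := hw
  unfold commIdealI at hw'
  suffices H : w ∈ CC K (JVar s p) ∧ δB w ∈ CC K (JVar s p) from H.2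
  induction hw' using Submodule.span_induction with
  | mem x h =>
    obtain ⟨a, f, g, b, rfl⟩ := h
    rw [d_gen δB hleib]
    exact ⟨gen_mem _ _ _ _, add_mem (add_mem (add_mem (gen_mem _ _ _ _) (gen_mem _ _ _ _))
      (gen_mem _ _ _ _)) (gen_mem _ _ _ _)⟩
  | zero => rw [map_zero]; exact ⟨zero_mem _, zero_mem _⟩
  | add x y hx hy h1 h2 =>
    rw [map_add]
    have h1 := h1 hx
    have h2 := h2 hy
    exact ⟨add_mem h1.1 h2.1, add_mem h1.2 h2.2⟩
  | smul r x hx h1 =>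
    have h1 := h1 hx
    rw [smul_eq_mul, hleib]
    exact ⟨left_mem _ h1.1, add_mem (left_mem _ h1.1) (left_mem _ h1.2)⟩

lemma d_F (hleib : ∀ a b : FMet K (JVar s p), δB (a * b) = δB a * b + a * δB b)
    (h : ∀ i, Hyp δB δ' i) {w} (hw : w ∈ Fsmall K s p) : δB w ∈ Fsmall K s p := by
  have hw' := hw
  unfold Fsmall at hw'
  induction hw' using Algebra.adjoin_induction with
  | mem x hx =>
    obtain ⟨t, rfl⟩ := hx
    rcases h (Sum.inl t) with h | ⟨tk, h, _⟩
    · simp only [h.1]; exact zero_mem _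
    · simp only [h]; exact x_mem _
  | algebraMap r =>
    rw [Algebra.algebraMap_eq_smul_one, map_smul, d_one δB hleib, smul_zero]
    exact zero_mem _
  | add x y hx hy h1 h2 =>
    rw [map_add]; exact add_mem (h1 hx) (h2 hy)
  | mul x y hx hy h1 h2 =>
    rw [hleib]; exact add_mem (mul_mem (h1 hx) hy) (mul_mem hx (h2 hy))

lemma d_small (hleib : ∀ a b : FMet K (JVar s p), δB (a * b) = δB a * b + a * δB b)
    (h : ∀ i, Hyp δB δ' i) (w) (hw : w ∈ smallComm K s p) :
    δB w ∈ smallComm K s p := by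
  unfold smallComm at hw
  induction hw using Submodule.span_induction with
  | mem x hx =>
    obtain ⟨a, f, g, b, ha, hf, hg, hb, rfl⟩ := hx
    rw [d_gen δB hleib]
    have da := d_F δB δ' hleib h ha
    have df := d_F δB δ' hleib h hf
    have dg := d_F δB δ' hleib h hg
    have db := d_F δB δ' hleib h hb
    exact add_mem (add_mem (add_mem
      (Submodule.subset_span ⟨_, _, _, _, da, hf, hg, hb, rfl⟩)
      (Submodule.subset_span ⟨_, _, _, _, ha, df, hg, hb, rfl⟩))
      (Submodule.subset_span ⟨_, _, _, _, ha, hf, dg, hb, rfl⟩))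
      (Submodule.subset_span ⟨_, _, _, _, ha, hf, hg, db, rfl⟩)
  | zero => rw [map_zero]; exact zero_mem _
  | add x y _ _ h1 h2 => rw [map_add]; exact add_mem h1 h2
  | smul r x _ h1 => rw [map_smul]; exact Submodule.smul_mem _ _ h1

/-- restriction of `δ` to the commutator ideal -/
def dC (hleib : ∀ a b : FMet K (JVar s p), δB (a * b) = δB a * b + a * δB b) : CC K (JVar s p) →ₗ[K] CC K (JVar s p) := δB.restrict (d_CC δB hleib)

lemma dC_coe (hleib : ∀ a b : FMet K (JVar s p), δB (a * b) = δB a * b + a * δB b)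
    (w : CC K (JVar s p)) : (dC δB hleib w).1 = δB w.1 := rfl

lemma dC_smul (hleib : ∀ a b : FMet K (JVar s p), δB (a * b) = δB a * b + a * δB b)
    (h : ∀ i, Hyp δB δ' i) (q : PolyJ K s p) : ∀ w : CC K (JVar s p),
    dC δB hleib (q • w) = δ' q • w + q • dC δB hleib w := by
  induction q using MvPolynomial.induction_on with
  | C a =>
    intro w
    have : (C a : PolyJ K s p) = algebraMap K _ a := rfl
    rw [this, Derivation.map_algebraMap, zero_smul, zero_add, algebraMap_smul, algebraMap_smul,
      map_smul]
  | add x y h1 h2 =>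
    intro w
    rw [add_smul, map_add, map_add, h1, h2, add_smul, add_smul]
    abel
  | mul_X q j ih =>
    intro w
    have key : dC δB hleib ((X j : PolyJ K s p) • w) = δ' (X j) • w
        + (X j : PolyJ K s p) • dC δB hleib w := by
      apply Subtype.ext
      rcases j with i | i
      · rw [dC_coe, u_smul_coe, hleib, Submodule.coe_add, u_smul_coe, dC_coe]
        rcases h i with h | ⟨tk, h⟩
        · rw [h.1, h.2.1, zero_smul, zero_mul]; rfl
        · rw [h.1, h.2.1, u_smul_coe]
      · rw [dC_coe, v_smul_coe, map_sub, hleib, hleib, Submodule.coe_add, v_smul_coe, dC_coe]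
        rcases h i with h | ⟨tk, h⟩
        · rw [h.1, h.2.2, zero_smul, zero_mul, mul_zero, Submodule.coe_zero]; abel
        · rw [h.1, h.2.2, v_smul_coe]; abel
    rw [mul_smul, ih, key, Derivation.leibniz, smul_eq_mul, smul_eq_mul, smul_add, add_smul,
      smul_smul, smul_smul, smul_smul, mul_comm (δ' q)]
    abel

lemma dC_phi (hleib : ∀ a b : FMet K (JVar s p), δB (a * b) = δB a * b + a * δB b)
    (h : ∀ i, Hyp δB δ' i) (hl : δB (xI K (JVar s p) (Sum.inr ())) = 0)
    (q : PolyJ K s p) : dC δB hleib (phi (Sum.inr ()) q) = phi (Sum.inr ()) (δ' q) := by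
  induction q using MvPolynomial.induction_on with
  | C a =>
    have : (C a : PolyJ K s p) = algebraMap K _ a := rfl
    rw [this, Derivation.map_algebraMap, Derivation.map_algebraMap, map_zero, map_zero]
  | add x y h1 h2 => rw [map_add, map_add, map_add, map_add, h1, h2]
  | mul_X q j ih =>
    have key : dC δB hleib (phi (Sum.inr ()) (X j)) = phi (Sum.inr ()) (δ' (X j)) := by
      rcases j with i | i
      · rw [phi_u, map_zero]
        rcases h i with h | ⟨tk, h⟩
        · rw [h.2.1, map_zero]
        · rw [h.2.1, phi_u]
      · rw [phi_v]
        apply Subtype.ext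
        rw [dC_coe]
        unfold cc
        rw [map_sub, hleib, hleib, hl]
        rcases h i with h | ⟨tk, h⟩
        · rw [h.1, h.2.2, map_zero]; simp
        · rw [h.1, h.2.2, phi_v]; simp [cc]
    rw [Derivation.leibniz, Derivation.leibniz, map_add, map_add, dC_smul δB δ' hleib h,
      dC_smul δB δ' hleib h, key, ih, smul_eq_mul, smul_eq_mul, Derivation.leibniz,
      Derivation.leibniz]
    abel

lemma d_P0 (h : ∀ i, Hyp δB δ' i) {q} (hq : q ∈ P0 K s p) : δ' q ∈ P0 K s p := by
  replace hq : q ∈ Algebra.adjoin K (X '' _) := hq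
  induction hq using Algebra.adjoin_induction with
  | mem x hx =>
    obtain ⟨j, hj, rfl⟩ := hx
    rcases j with i | i
    · rcases h i with h | ⟨tk, h⟩
      · rw [h.2.1]; exact zero_mem _
      · rw [h.2.1]; exact X_mem_supported.2 (by simp)
    · rcases h i with h | ⟨tk, h⟩
      · rw [h.2.2]; exact zero_mem _
      · rw [h.2.2]; exact X_mem_supported.2 (by simp)
  | algebraMap r => rw [Derivation.map_algebraMap]; exact zero_mem _
  | add x y _ _ h1 h2 => rw [map_add]; exact add_mem h1 h2
  | mul x y hx hy h1 h2 =>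
    rw [Derivation.leibniz]
    exact add_mem (mul_mem hx h2) (mul_mem hy h1)

lemma d_omega (h : ∀ i, Hyp δB δ' i) (q) (hq : q ∈ omegaSmall K s p) :
    δ' q ∈ omegaSmall K s p := by
  refine omega_ind hq ((omegaSmall K s p).comap δ'.toLinearMap) fun tk r hr => ?_
  show δ' _ ∈ omegaSmall K s p
  rw [Derivation.leibniz, smul_eq_mul, smul_eq_mul]
  refine add_mem (X_mul_omega _ (d_P0 δB δ' h hr)) ?_
  rcases h (Sum.inl tk) with h | ⟨tk', h⟩
  · rw [h.2.2, mul_zero]; exact zero_mem _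
  · rw [h.2.2, mul_comm]; exact X_mul_omega _ hr

lemma map_ker' {K V M : Type*} [Field K] [AddCommMonoid V] [Module K V] [AddCommMonoid M]
    [Module K M] (f : V →ₗ[K] M) (hf : Function.Injective f) (δ1 : V →ₗ[K] V) (δ : M →ₗ[K] M)
    (h : ∀ x, f (δ1 x) = δ (f x)) :
    (LinearMap.ker δ1).map f = LinearMap.range f ⊓ LinearMap.ker δ := by
  ext y
  constructor
  · rintro ⟨x, hx, rfl⟩
    refine ⟨⟨x, rfl⟩, ?_⟩
    show δ (f x) = 0
    rw [← h, show δ1 x = 0 from hx, map_zero]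
  · rintro ⟨⟨x, rfl⟩, hx⟩
    refine ⟨x, ?_, rfl⟩
    apply hf
    rw [h, map_zero]
    exact hx

lemma span_pull {K V M I : Type*} [Field K] [AddCommMonoid V] [Module K V] [AddCommMonoid M]
    [Module K M] (f : V →ₗ[K] M) (hf : Function.Injective f) (δ1 : V →ₗ[K] V) (δ : M →ₗ[K] M)
    (h : ∀ x, f (δ1 x) = δ (f x)) (d : I → V) :
    Submodule.span K (Set.range d) = LinearMap.ker δ1 ↔
    Submodule.span K (Set.range fun i => f (d i)) = LinearMap.range f ⊓ LinearMap.ker δ := by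
  have e : (Set.range fun i => f (d i)) = f '' Set.range d := by rw [← Set.range_comp]; rfl
  rw [← map_ker' f hf δ1 δ h, e, ← Submodule.map_span]
  exact (Submodule.map_injective_of_injective hf).eq_iff.symm

end small4

end Met

section Main

variable (K : Type*) [Field K] [CharZero K] (s : ℕ) (p : Fin s → ℕ)

/-- Assume `δ(x_d) = 0` and that `x_1,…,x_{d-1}` is a Jordan basis of the
nilpotent action of `δ`.  If `{d_i}` is a homogeneous (in both gradings) basis of
`(F_{d-1}')^δ` and `{g_j}` a homogeneous basis of `K[U_{d-1},V_{d-1}]_ω^δ`, then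
`{d_i u_d^m v_d^n, π(g_j) u_d^m v_d^n}` is a basis of `(F_d')^δ`. -/
theorem basis_of_constants
    (hne : ∃ t, 0 < p t)
    (δB : FMet K (JVar s p) →ₗ[K] FMet K (JVar s p))
    (hleib : ∀ a b : FMet K (JVar s p), δB (a * b) = δB a * b + a * δB b)
    (hx0 : ∀ t : Fin s, δB (xI K (JVar s p) (Sum.inl ⟨t, 0⟩)) = 0)
    (hxsucc : ∀ (t : Fin s) (k : Fin (p t)),
      δB (xI K (JVar s p) (Sum.inl ⟨t, k.succ⟩)) = xI K (JVar s p) (Sum.inl ⟨t, k.castSucc⟩))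
    (hxlast : δB (xI K (JVar s p) (Sum.inr ())) = 0)
    (δ' : Derivation K (PolyJ K s p) (PolyJ K s p))
    (hu0 : ∀ t : Fin s, δ' (MvPolynomial.X (Sum.inl (Sum.inl ⟨t, 0⟩))) = 0)
    (husucc : ∀ (t : Fin s) (k : Fin (p t)),
      δ' (MvPolynomial.X (Sum.inl (Sum.inl ⟨t, k.succ⟩)))
        = MvPolynomial.X (Sum.inl (Sum.inl ⟨t, k.castSucc⟩)))
    (hulast : δ' (uLast K s p) = 0)
    (hv0 : ∀ t : Fin s, δ' (MvPolynomial.X (Sum.inr (Sum.inl ⟨t, 0⟩))) = 0)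
    (hvsucc : ∀ (t : Fin s) (k : Fin (p t)),
      δ' (MvPolynomial.X (Sum.inr (Sum.inl ⟨t, k.succ⟩)))
        = MvPolynomial.X (Sum.inr (Sum.inl ⟨t, k.castSucc⟩)))
    (hvlast : δ' (vLast K s p) = 0)
    (I J : Type*) (dd : I → FMet K (JVar s p)) (g : J → PolyJ K s p)
    (hddind : LinearIndependent K dd)
    (hddspan : Submodule.span K (Set.range dd) = smallComm K s p ⊓ LinearMap.ker δB)
    (hddhom : ∀ i, ∃ n q r, dd i ∈ degCompI K (JVar s p) n ∧ dd i ∈ biCompI K s p (q, r))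
    (hgind : LinearIndependent K g)
    (hgspan : Submodule.span K (Set.range g)
      = omegaSmall K s p ⊓ LinearMap.ker δ'.toLinearMap)
    (hghom : ∀ j, ∃ n q r,
      g j ∈ MvPolynomial.homogeneousSubmodule (JVar s p ⊕ JVar s p) K n ∧
      g j ∈ MvPolynomial.weightedHomogeneousSubmodule K
        (Sum.elim (bdeg s p) (bdeg s p)) (q, r)) :
    LinearIndependent K
      (Sum.elim
        (fun x : I × ℕ × ℕ =>
          actI K (JVar s p) (uLast K s p ^ x.2.1 * vLast K s p ^ x.2.2) (dd x.1))
        (fun x : J × ℕ × ℕ =>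
          actI K (JVar s p) (uLast K s p ^ x.2.1 * vLast K s p ^ x.2.2) (piMapI K s p (g x.1)))) ∧
    Submodule.span K (Set.range
      (Sum.elim
        (fun x : I × ℕ × ℕ =>
          actI K (JVar s p) (uLast K s p ^ x.2.1 * vLast K s p ^ x.2.2) (dd x.1))
        (fun x : J × ℕ × ℕ =>
          actI K (JVar s p) (uLast K s p ^ x.2.1 * vLast K s p ^ x.2.2) (piMapI K s p (g x.1)))))
      = (commIdealI K (JVar s p)).restrictScalars K ⊓ LinearMap.ker δB := by
  have hyp : ∀ i, Met.Hyp δB δ' i := by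
    rintro (⟨t, k⟩ | ⟨⟩)
    · induction k using Fin.cases with
      | zero => exact Or.inl ⟨hx0 t, hu0 t, hv0 t⟩
      | succ k => exact Or.inr ⟨⟨t, k.castSucc⟩, hxsucc t k, husucc t k, hvsucc t k⟩
    · exact Or.inl ⟨hxlast, hulast, hvlast⟩
  have hpw : ∀ a, δ' (Met.pw K s p a) = 0 := by
    intro a
    unfold Met.pw
    rw [Derivation.leibniz, Derivation.leibniz_pow, Derivation.leibniz_pow, hulast, hvlast]
    simp
  have hddm : ∀ i, dd i ∈ smallComm K s p := fun i => by
    have : dd i ∈ smallComm K s p ⊓ LinearMap.ker δB :=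
      hddspan ▸ Submodule.subset_span ⟨i, rfl⟩
    exact this.1
  have hgm : ∀ j, g j ∈ omegaSmall K s p := fun j => by
    have : g j ∈ omegaSmall K s p ⊓ LinearMap.ker δ'.toLinearMap :=
      hgspan ▸ Submodule.subset_span ⟨j, rfl⟩
    exact this.1
  let δC := Met.dC δB hleib
  let δ1 : Met.V1 K s p →ₗ[K] Met.V1 K s p :=
    δC.restrict (fun w hw => Met.d_small δB δ' hleib hyp w.1 hw)
  let δ2 : omegaSmall K s p →ₗ[K] omegaSmall K s p :=
    δ'.toLinearMap.restrict (fun w hw => Met.d_omega δB δ' hyp w hw)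
  let dd' : I → Met.V1 K s p := fun i => ⟨⟨dd i, Met.small_le_CC (hddm i)⟩, hddm i⟩
  let g' : J → omegaSmall K s p := fun j => ⟨g j, hgm j⟩
  let f0 : Met.CC K (JVar s p) →ₗ[K] FMet K (JVar s p) := (Met.CC K (JVar s p)).subtype
  have hf0 : Function.Injective f0 := Subtype.val_injective
  let f1 : Met.V1 K s p →ₗ[K] FMet K (JVar s p) := f0 ∘ₗ (Met.V1 K s p).subtype
  have hf1 : Function.Injective f1 := hf0.comp Subtype.val_injective
  let f2 : omegaSmall K s p →ₗ[K] PolyJ K s p := (omegaSmall K s p).subtype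
  have hf2 : Function.Injective f2 := Subtype.val_injective
  have r0 : LinearMap.range f0 = Met.CC K (JVar s p) := Submodule.range_subtype _
  have r2 : LinearMap.range f2 = omegaSmall K s p := Submodule.range_subtype _
  have r1 : LinearMap.range f1 = smallComm K s p := by
    ext y
    constructor
    · rintro ⟨x, rfl⟩
      exact x.2
    · intro hy
      exact ⟨⟨⟨y, Met.small_le_CC hy⟩, hy⟩, rfl⟩
  have hdd' : LinearIndependent K dd' := LinearIndependent.of_comp f1 hddind
  have hg' : LinearIndependent K g' := LinearIndependent.of_comp f2 hgind
  have hdds : Submodule.span K (Set.range dd') = LinearMap.ker δ1 :=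
    (Met.span_pull f1 hf1 δ1 δB (fun _ => rfl) dd').2 (by rw [r1]; exact hddspan)
  have hgs : Submodule.span K (Set.range g') = LinearMap.ker δ2 :=
    (Met.span_pull f2 hf2 δ2 δ'.toLinearMap (fun _ => rfl) g').2 (by rw [r2]; exact hgspan)
  have main := Met.abs_basis δC δ1 δ2 (Met.al K s p) (Met.be K s p) Met.Phi_inj Met.Phi_surj
    (fun a x => by
      rw [Met.al_apply, Met.al_apply]
      show Met.dC δB hleib _ = _
      rw [Met.dC_smul δB δ' hleib hyp, hpw, zero_smul, zero_add]
      rfl)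
    (fun a x => by
      rw [Met.be_apply, Met.be_apply]
      show Met.dC δB hleib _ = _
      rw [Met.dC_smul δB δ' hleib hyp, hpw, zero_smul, zero_add,
        Met.dC_phi δB δ' hleib hyp hxlast]
      rfl)
    dd' g' hdd' hg' hdds hgs
  have fam : (Sum.elim
        (fun x : I × ℕ × ℕ =>
          actI K (JVar s p) (uLast K s p ^ x.2.1 * vLast K s p ^ x.2.2) (dd x.1))
        (fun x : J × ℕ × ℕ =>
          actI K (JVar s p) (uLast K s p ^ x.2.1 * vLast K s p ^ x.2.2) (piMapI K s p (g x.1))))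
      = fun x => f0 (Sum.elim (fun x : I × ℕ × ℕ => Met.al K s p x.2 (dd' x.1))
          (fun x : J × ℕ × ℕ => Met.be K s p x.2 (g' x.1)) x) := by
    funext x
    rcases x with x | x
    · exact Met.act_eq _ (⟨dd x.1, Met.small_le_CC (hddm x.1)⟩ : Met.CC K (JVar s p))
    · simp only [Sum.elim_inr]
      rw [Met.pi_eq, Met.act_eq]
      rfl
  rw [fam]
  refine ⟨main.1.map_injOn f0 hf0.injOn, ?_⟩
  have := (Met.span_pull f0 hf0 δC δB (fun _ => rfl) _).1 main.2
  rw [r0] at this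
  exact this

end Main
end
end
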